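/- Let F = ℚ(√d) with d ≥ 6 squarefree. If Nm_{F/ℚ}(ε) = 1 and H = (−1,−ε/F), let 𝒪₂‡ = O_F + O_F·i + O_F·j + O_F·k be the O_F-order generated by i and j. Then t(H, D₂‡) + t(H, D₄) + t(H, S₄) + t(H, D₆) = ℶ(𝒪₂‡). If Nm_{F/ℚ}(ε) = −1, or if H is a totally definite quaternion F-algebra not F-isomorphic to (−1,−ε/F), then t(H, D₂‡) = 0. -/

import Mathlib

open NumberField Quaternion

noncomputable section

namespace QuatPaper

variable (F : Type) [Field F] [NumberField F]

def scalarSet (H : Type) [Ring H] [Algebra F H] : Set H :=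
  Set.range fun r : 𝓞 F => algebraMap F H (algebraMap (𝓞 F) F r)

def IsOrder {H : Type} [Ring H] [Algebra F H] (O : Subring H) : Prop :=
  scalarSet F H ⊆ ↑O ∧ O.toAddSubgroup.FG ∧ Submodule.span F (O : Set H) = ⊤

def IsMaximalOrder {H : Type} [Ring H] [Algebra F H] (O : Subring H) : Prop :=
  IsOrder F O ∧ ∀ O' : Subring H, IsOrder F O' → O ≤ O' → O' = O

def IsScalarUnit {H : Type} [Ring H] [Algebra F H] {O : Subring H} (u : (↥O)ˣ) : Prop :=
  ∃ r : (𝓞 F)ˣ, ((u : ↥O) : H) = algebraMap F H (algebraMap (𝓞 F) F ↑r)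

def RedUnitIso {H : Type} [Ring H] [Algebra F H] (O : Subring H) (G : Type*) [Group G] : Prop :=
  ∃ φ : (↥O)ˣ →* G, Function.Surjective φ ∧ ∀ u, φ u = 1 ↔ IsScalarUnit F u

def IsConjugate {H : Type} [Ring H] (x : Hˣ) (O O' : Subring H) : Prop :=
  ∀ y : H, y ∈ O ↔ (x : H) * y * ((x⁻¹ : Hˣ) : H) ∈ O'

def ConjRel {H : Type} [Ring H] (O O' : Subring H) : Prop :=
  ∃ x : Hˣ, IsConjugate x O O'

def typeNum (H : Type) [Ring H] [Algebra F H] (G : Type*) [Group G] : ℕ :=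
  Nat.card (Quot fun O O' : {O : Subring H // IsMaximalOrder F O ∧ RedUnitIso F O G} =>
    ConjRel O.1 O'.1)

def IsQuatAlg (H : Type) [Ring H] [Algebra F H] : Prop :=
  ∃ a b : F, a ≠ 0 ∧ b ≠ 0 ∧ Nonempty (H ≃ₐ[F] ℍ[F, a, b])

def TotallyDefinite (H : Type) [Ring H] [Algebra F H] : Prop :=
  ∀ σ : F →+* ℝ,
    letI : Algebra F ℝ := σ.toAlgebra
    ∀ x : TensorProduct F ℝ H, x ≠ 0 → IsUnit x

/-- The reduced norm `Nr(x) = x·x̄` of a quaternion `x ∈ ℍ[F, A, B]`. -/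
def redNorm {A B : F} (x : ℍ[F, A, B]) : F := (x * star x).re

/-- The reduced unit group of `O` is isomorphic to the dihedral group `D_n` and is
of the *first kind*: every element of order `2` in `O^×/O_F^×` admits a representative
whose reduced norm is the square of a unit of `O_F`. -/
def RedUnitDihedralFirstKind {A B : F} (n : ℕ) (O : Subring ℍ[F, A, B]) : Prop :=
  ∃ φ : (↥O)ˣ →* DihedralGroup n, Function.Surjective φ ∧
    (∀ u, φ u = 1 ↔ IsScalarUnit F u) ∧
    ∀ u : (↥O)ˣ, φ u ≠ 1 → φ u * φ u = 1 →
      ∃ u' : (↥O)ˣ, φ u' = φ u ∧ ∃ r : (𝓞 F)ˣ,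
        redNorm F ((u' : ↥O) : ℍ[F, A, B]) = algebraMap (𝓞 F) F ↑r ^ 2

/-- The reduced unit group of `O` is isomorphic to the dihedral group `D_n` and is
of the *second kind*: some element of order `2` in `O^×/O_F^×` has no representative
whose reduced norm is the square of a unit of `O_F`. -/
def RedUnitDihedralSecondKind {A B : F} (n : ℕ) (O : Subring ℍ[F, A, B]) : Prop :=
  ∃ φ : (↥O)ˣ →* DihedralGroup n, Function.Surjective φ ∧
    (∀ u, φ u = 1 ↔ IsScalarUnit F u) ∧
    ∃ u : (↥O)ˣ, φ u ≠ 1 ∧ φ u * φ u = 1 ∧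
      ∀ u' : (↥O)ˣ, φ u' = φ u → ∀ r : (𝓞 F)ˣ,
        redNorm F ((u' : ↥O) : ℍ[F, A, B]) ≠ algebraMap (𝓞 F) F ↑r ^ 2

/-- `t(H, D_n†)`: the number of conjugacy classes of maximal orders whose reduced unit
group is isomorphic to `D_n` of the first kind. -/
def typeNumDnFirstKind (A B : F) (n : ℕ) : ℕ :=
  Nat.card (Quot fun O O' : {O : Subring ℍ[F, A, B] //
      IsMaximalOrder F O ∧ RedUnitDihedralFirstKind F n O} => ConjRel O.1 O'.1)

/-- `t(H, D_n‡)`: the number of conjugacy classes of maximal orders whose reduced unit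
group is isomorphic to `D_n` of the second kind. -/
def typeNumDnSecondKind (A B : F) (n : ℕ) : ℕ :=
  Nat.card (Quot fun O O' : {O : Subring ℍ[F, A, B] //
      IsMaximalOrder F O ∧ RedUnitDihedralSecondKind F n O} => ConjRel O.1 O'.1)

/-- `ℵ(O₀)`: the number of maximal orders containing `O₀`. -/
def alephNum {H : Type} [Ring H] [Algebra F H] (O₀ : Subring H) : ℕ :=
  Nat.card {O : Subring H // IsMaximalOrder F O ∧ O₀ ≤ O}

/-- `ℶ(O₀)`: the number of orbits of the conjugation action of the normalizer
`N(O₀)` on the set of maximal orders containing `O₀`. -/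
def bethNum {H : Type} [Ring H] [Algebra F H] (O₀ : Subring H) : ℕ :=
  Nat.card (Quot fun O O' : {O : Subring H // IsMaximalOrder F O ∧ O₀ ≤ O} =>
    ∃ x : Hˣ, IsConjugate x O₀ O₀ ∧ IsConjugate x O.1 O'.1)

set_option linter.unusedSectionVars false

section RealQuadratic

variable {F}

/-- The field-theoretic facts about `F` and the fundamental unit `e` used below; `σ₀` and `σ₁` are
the two real embeddings of `F`. -/
structure UnitData (σ₀ σ₁ : F →+* ℝ) (e : F) : Prop where
  pos₀ : 0 < σ₀ e
  pos₁ : 0 < σ₁ e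
  not_sq : ∀ a : F, a ^ 2 ≠ e
  unit : ∃ v : (𝓞 F)ˣ, e = algebraMap (𝓞 F) F v
  eq_int : ∀ a : F, IsIntegral ℤ a → |σ₀ a| ≤ 2 → |σ₁ a| ≤ 2 → ∃ n : ℤ, a = n
  units : ∀ u : (𝓞 F)ˣ, 0 < σ₀ (algebraMap (𝓞 F) F u) → 0 < σ₁ (algebraMap (𝓞 F) F u) →
    ∃ l : (𝓞 F)ˣ, algebraMap (𝓞 F) F u = algebraMap (𝓞 F) F l ^ 2 ∨
      algebraMap (𝓞 F) F u = e * algebraMap (𝓞 F) F l ^ 2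

lemma exists_coords {d : ℕ} {s : F} (hs : s ^ 2 = (d : F)) (hgen : Algebra.adjoin ℚ {s} = ⊤)
    (x : F) : ∃ p q : ℚ, x = p + q * s := by
  have hx : x ∈ Algebra.adjoin ℚ {s} := hgen ▸ Algebra.mem_top
  induction hx using Algebra.adjoin_induction with
  | mem x hx => exact ⟨0, 1, by simp_all⟩
  | algebraMap r => exact ⟨r, 0, by simp⟩
  | add x y _ _ hx hy =>
    obtain ⟨p, q, rfl⟩ := hx
    obtain ⟨p', q', rfl⟩ := hy
    exact ⟨p + p', q + q', by push_cast; ring⟩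
  | mul x y _ _ hx hy =>
    obtain ⟨p, q, rfl⟩ := hx
    obtain ⟨p', q', rfl⟩ := hy
    exact ⟨p * p' + d * q * q', p * q' + q * p', by push_cast; linear_combination q * q' * hs⟩

lemma sqrt_not_rat {d : ℕ} (hd : 6 ≤ d) (hsf : Squarefree d) {s : F} (hs : s ^ 2 = (d : F))
    (q : ℚ) : s ≠ q := by
  rintro rfl
  have h : q ^ 2 = d := by exact_mod_cast hs
  have h2 : IsSquare (d : ℚ) := ⟨q, by rw [← h, sq]⟩
  rw [Rat.isSquare_natCast_iff] at h2
  obtain ⟨m, rfl⟩ := h2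
  have := hsf m (dvd_refl _)
  rw [Nat.isUnit_iff] at this
  subst this
  omega

lemma exists_conj {d : ℕ} (hd : 6 ≤ d) (hsf : Squarefree d) {s : F} (hs : s ^ 2 = (d : F))
    (hgen : Algebra.adjoin ℚ {s} = ⊤) : ∃ τ : F →ₐ[ℚ] F, τ s = -s := by
  have hint : IsIntegral ℚ s := Algebra.IsIntegral.isIntegral s
  have hmonic : (Polynomial.X ^ 2 - Polynomial.C (d : ℚ)).Monic :=
    Polynomial.monic_X_pow_sub_C _ two_ne_zero
  have hmin : minpoly ℚ s = Polynomial.X ^ 2 - Polynomial.C (d : ℚ) := by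
    symm
    apply Polynomial.eq_of_monic_of_dvd_of_natDegree_le (minpoly.monic hint) hmonic
    · apply minpoly.dvd
      simp [hs]
    · rw [Polynomial.natDegree_X_pow_sub_C, minpoly.two_le_natDegree_iff hint]
      rintro ⟨q, hq⟩
      exact sqrt_not_rat hd hsf hs q (by simpa using hq.symm)
  let pb := PowerBasis.ofAdjoinEqTop' hint hgen
  have hpb : pb.gen = s := PowerBasis.ofAdjoinEqTop'_gen hint hgen
  refine ⟨pb.lift (-s) ?_, ?_⟩
  · rw [hpb, hmin]
    simp [hs]
  · have h := pb.lift_gen (-s) (by rw [hpb, hmin]; simp [hs])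
    exact (congrArg _ hpb.symm).trans h

lemma norm_coords {d : ℕ} (hd : 6 ≤ d) (hsf : Squarefree d) {s : F} (hs : s ^ 2 = (d : F))
    (hgen : Algebra.adjoin ℚ {s} = ⊤) (p q : ℚ) :
    Algebra.norm ℚ ((p : F) + q * s) = p ^ 2 - d * q ^ 2 := by
  have hli : LinearIndependent ℚ ![(1 : F), s] := by
    rw [LinearIndependent.pair_iff]
    intro a b h
    have hb : b = 0 := by
      by_contra hb
      refine sqrt_not_rat hd hsf hs (-a / b) ?_
      have hb' : (b : F) ≠ 0 := by exact_mod_cast hb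
      simp only [Algebra.smul_def, eq_ratCast] at h
      push_cast
      field_simp
      linear_combination h
    subst hb
    simpa using h
  have hsp : ⊤ ≤ Submodule.span ℚ (Set.range ![(1 : F), s]) := by
    intro x _
    obtain ⟨a, b, rfl⟩ := exists_coords hs hgen x
    simp only [Matrix.range_cons, Matrix.range_empty, Set.union_empty, Set.singleton_union]
    rw [Submodule.mem_span_pair]
    exact ⟨a, b, by simp [Algebra.smul_def]⟩
  let b := Module.Basis.mk hli hsp
  have hb0 : b 0 = 1 := by simp [b]
  have hb1 : b 1 = s := by simp [b]
  have key : Algebra.lmul ℚ F ((p : F) + q * s) = Matrix.toLin b b !![p, d * q; q, p] := by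
    apply b.ext
    intro i
    fin_cases i
    · change Algebra.lmul ℚ F ((p : F) + q * s) (b 0) = Matrix.toLin b b !![p, d * q; q, p] (b 0)
      rw [Matrix.toLin_self, Fin.sum_univ_two]
      simp [hb0, hb1, Algebra.smul_def]
    · change Algebra.lmul ℚ F ((p : F) + q * s) (b 1) = Matrix.toLin b b !![p, d * q; q, p] (b 1)
      rw [Matrix.toLin_self, Fin.sum_univ_two]
      simp [hb0, hb1, Algebra.smul_def]
      linear_combination (q : F) * hs
  rw [Algebra.norm_apply]
  erw [key]
  rw [LinearMap.det_toLin, Matrix.det_fin_two_of]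
  ring

lemma exists_int_of_integral_rat (q : ℚ) (h : IsIntegral ℤ (q : F)) : ∃ n : ℤ, q = n := by
  have h2 : IsIntegral ℤ (algebraMap ℚ F q) := by simpa using h
  rw [isIntegral_algebraMap_iff (algebraMap ℚ F).injective] at h2
  obtain ⟨n, hn⟩ := IsIntegrallyClosed.isIntegral_iff.1 h2
  exact ⟨n, by simpa using hn.symm⟩

lemma int_of_sq_mul {d : ℕ} (hsf : Squarefree d) (q : ℚ) (m : ℤ) (h : d * q ^ 2 = m) :
    ∃ n : ℤ, q = n := by
  have hden : (d : ℤ) * q.num ^ 2 = m * (q.den : ℤ) ^ 2 := by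
    have h1 := q.num_div_den
    have h2 : (q.den : ℚ) ≠ 0 := by exact_mod_cast q.den_ne_zero
    rw [← h1] at h
    field_simp at h
    rw [mul_comm m]
    exact_mod_cast h
  have hdvd : (q.den : ℤ) ^ 2 ∣ d := by
    have : IsCoprime ((q.den : ℤ) ^ 2) (q.num ^ 2) := by
      apply IsCoprime.pow
      rw [Int.isCoprime_iff_gcd_eq_one, Int.gcd_comm]
      simpa [Int.gcd] using q.reduced
    exact this.dvd_of_dvd_mul_right (Dvd.intro_left m hden.symm)
  have : q.den * q.den ∣ d := by
    rw [← sq]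
    exact_mod_cast hdvd
  have h1 := Nat.isUnit_iff.1 (hsf _ this)
  exact ⟨q.num, ((Rat.den_eq_one_iff q).1 h1).symm⟩

lemma eq_int_of_bounded {d : ℕ} (hd : 6 ≤ d) (hsf : Squarefree d) {s : F} (hs : s ^ 2 = (d : F))
    (hgen : Algebra.adjoin ℚ {s} = ⊤) (τ : F →ₐ[ℚ] F) (hτ : τ s = -s) (σ : F →+* ℝ)
    (hσ : 0 < σ s) (a : F) (ha : IsIntegral ℤ a) (h0 : |σ a| ≤ 2) (h1 : |σ (τ a)| ≤ 2) :
    ∃ n : ℤ, a = n := by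
  obtain ⟨p, q, rfl⟩ := exists_coords hs hgen a
  have ha' : IsIntegral ℤ (τ ((p : F) + q * s)) := ha.map (τ.restrictScalars ℤ)
  have hτa : τ ((p : F) + q * s) = p - q * s := by
    rw [map_add, map_mul, map_ratCast, map_ratCast, hτ]; ring
  rw [hτa] at ha' h1
  obtain ⟨m, hm⟩ := exists_int_of_integral_rat (F := F) (2 * p) (by
    have h := ha.add ha'
    rwa [show (p : F) + q * s + (p - q * s) = ((2 * p : ℚ) : F) by push_cast; ring] at h)
  obtain ⟨k, hk⟩ := exists_int_of_integral_rat (F := F) (p ^ 2 - d * q ^ 2) (by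
    have h := ha.mul ha'
    rwa [show ((p : F) + q * s) * (p - q * s) = ((p ^ 2 - d * q ^ 2 : ℚ) : F) by
      push_cast; linear_combination -(q : F) ^ 2 * hs] at h)
  obtain ⟨n, hn⟩ := int_of_sq_mul hsf (2 * q) (m ^ 2 - 4 * k) (by
    push_cast; rw [← hm, ← hk]; ring)
  have hmn : (d : ℤ) * n ^ 2 = m ^ 2 - 4 * k := by
    have : (d : ℚ) * n ^ 2 = m ^ 2 - 4 * k := by rw [← hm, ← hk, ← hn]; ring
    exact_mod_cast this
  have hr2 : (σ s) ^ 2 = d := by rw [← map_pow, hs, map_natCast]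
  set r := σ s with hr
  simp only [map_add, map_sub, map_mul, map_ratCast, ← hr] at h0 h1
  have hp : (p : ℝ) = m / 2 := by
    rw [eq_div_iff two_ne_zero, mul_comm]; exact_mod_cast hm
  have hq : (q : ℝ) = n / 2 := by
    rw [eq_div_iff two_ne_zero, mul_comm]; exact_mod_cast hn
  rw [hp, hq] at h0 h1
  have hn0 : n = 0 := by
    by_contra hne
    rw [abs_le] at h0 h1
    have hsum : (m : ℝ) ^ 2 + 2 * |(m : ℝ)| * |(n : ℝ)| * r + n ^ 2 * d ≤ 16 := by
      rw [← hr2]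
      have h4 : |(m : ℝ)| + |(n : ℝ)| * r ≤ 4 := by
        rcases abs_cases (m : ℝ) with ⟨e1, _⟩ | ⟨e1, _⟩ <;>
        rcases abs_cases (n : ℝ) with ⟨e2, _⟩ | ⟨e2, _⟩ <;> rw [e1, e2] <;> linarith
      have h5 : 0 ≤ |(m : ℝ)| + |(n : ℝ)| * r := by positivity
      have h6 := sq_abs (m : ℝ)
      have h7 := sq_abs (n : ℝ)
      nlinarith
    have hdR : (6 : ℝ) ≤ d := by exact_mod_cast hd
    have hn1 : (1 : ℝ) ≤ |(n : ℝ)| := by exact_mod_cast Int.one_le_abs hne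
    have hn2 : |n| = 1 := by
      have : (n : ℝ) ^ 2 * 6 ≤ 16 := by
        have : 0 ≤ 2 * |(m : ℝ)| * |(n : ℝ)| * r := by positivity
        nlinarith [sq_nonneg (n : ℝ), sq_nonneg (m : ℝ)]
      have h3 : n ^ 2 * 6 ≤ 16 := by exact_mod_cast this
      have h4 : |n| < 2 := by
        by_contra hh
        have h5 := sq_abs n
        nlinarith
      have := Int.one_le_abs hne
      omega
    have hnsq : n ^ 2 = 1 := by rw [← sq_abs, hn2]; norm_num
    have hn2' : |(n : ℝ)| = 1 := by exact_mod_cast hn2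
    rw [hnsq] at hmn
    rcases Int.even_or_odd m with ⟨c, hc⟩ | ⟨c, hc⟩
    · have : (2 * 2 : ℤ) ∣ d := ⟨c ^ 2 - k, by rw [hc] at hmn; linear_combination hmn⟩
      have h22 := hsf 2 (by exact_mod_cast this)
      simp at h22
    · have hm1 : (1 : ℝ) ≤ |(m : ℝ)| := by
        exact_mod_cast Int.one_le_abs (by omega : m ≠ 0)
      have hnsqR : (n : ℝ) ^ 2 = 1 := by exact_mod_cast hnsq
      rw [hn2', hnsqR] at hsum
      have hr3 : r ≤ 3 := by
        have h6 := sq_abs (m : ℝ)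
        nlinarith
      have hd9 : (d : ℝ) ≤ 9 := by nlinarith
      have hd9' : d ≤ 9 := by exact_mod_cast hd9
      have hmod : (d : ℤ) = 4 * (c ^ 2 + c - k) + 1 := by rw [hc] at hmn; linear_combination hmn
      have hd' : d = 9 := by omega
      subst hd'
      have h33 := hsf 3 ⟨1, by norm_num⟩
      simp at h33
  subst hn0
  have hq0 : q = 0 := by simpa using hn
  subst hq0
  obtain ⟨n, hn⟩ := exists_int_of_integral_rat (F := F) p (by simpa using ha)
  exact ⟨n, by simp [hn]⟩

lemma unit_eq_fund_zpow (σ : F →+* ℝ) (ε : (𝓞 F)ˣ) (hε : 1 < σ (algebraMap (𝓞 F) F ↑ε))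
    (hfund : ∀ u : (𝓞 F)ˣ, 1 < σ (algebraMap (𝓞 F) F ↑u) →
      σ (algebraMap (𝓞 F) F ↑ε) ≤ σ (algebraMap (𝓞 F) F ↑u))
    (u : (𝓞 F)ˣ) (hu : 0 < σ (algebraMap (𝓞 F) F ↑u)) : ∃ n : ℤ, u = ε ^ n := by
  let f : (𝓞 F)ˣ →* ℝˣ :=
    Units.map ((σ.comp (algebraMap (𝓞 F) F) : 𝓞 F →+* ℝ) : 𝓞 F →* ℝ)
  have hf : ∀ v : (𝓞 F)ˣ, σ (algebraMap (𝓞 F) F ↑v) = (f v : ℝ) := fun v => rfl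
  simp only [hf] at hε hfund hu
  obtain ⟨n, hn1, hn2⟩ := exists_mem_Ico_zpow hu hε
  refine ⟨n, ?_⟩
  have hpos : (0 : ℝ) < (f ε : ℝ) ^ n := zpow_pos (by linarith) n
  have hq : (f (u * ε ^ (-n)) : ℝ) = (f u : ℝ) / (f ε : ℝ) ^ n := by
    rw [map_mul, map_zpow]; push_cast; rw [zpow_neg, div_eq_mul_inv]
  have h1 : (1 : ℝ) ≤ f (u * ε ^ (-n)) := by rw [hq, le_div_iff₀ hpos]; linarith
  have h2 : (f (u * ε ^ (-n)) : ℝ) < f ε := by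
    rw [hq, div_lt_iff₀ hpos, ← zpow_one_add₀ (by linarith), add_comm]
    exact hn2
  have h3 : (f (u * ε ^ (-n)) : ℝ) = 1 := by
    by_contra hne
    exact absurd (hfund _ (lt_of_le_of_ne h1 (Ne.symm hne))) (not_le.2 h2)
  have h4 : u * ε ^ (-n) = 1 := by
    apply Units.ext
    apply FaithfulSMul.algebraMap_injective (𝓞 F) F
    apply σ.injective
    rw [hf, h3]
    simp
  rw [zpow_neg] at h4
  exact mul_inv_eq_one.1 h4

lemma fund_not_sq (σ : F →+* ℝ) (ε : (𝓞 F)ˣ) (hε : 1 < σ (algebraMap (𝓞 F) F ↑ε))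
    (hfund : ∀ u : (𝓞 F)ˣ, 1 < σ (algebraMap (𝓞 F) F ↑u) →
      σ (algebraMap (𝓞 F) F ↑ε) ≤ σ (algebraMap (𝓞 F) F ↑u)) (a : F) :
    a ^ 2 ≠ algebraMap (𝓞 F) F ↑ε := by
  have hkey : ∀ a : F, a ^ 2 = algebraMap (𝓞 F) F ↑ε → 0 < σ a → False := by
    intro a ha hpos
    have hint : IsIntegral ℤ a :=
      IsIntegral.of_pow two_pos (ha ▸ RingOfIntegers.isIntegral_coe _)
    obtain ⟨b, rfl⟩ : ∃ b : 𝓞 F, algebraMap (𝓞 F) F b = a := ⟨⟨a, hint⟩, rfl⟩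
    have hunit : IsUnit b := by
      apply isUnit_of_mul_isUnit_left (y := b)
      have hb : b * b = ε := by
        apply FaithfulSMul.algebraMap_injective (𝓞 F) F
        rw [← ha, sq, map_mul]
      exact hb ▸ ε.isUnit
    obtain ⟨v, hv⟩ := hunit
    have hv' : algebraMap (𝓞 F) F ↑v = algebraMap (𝓞 F) F b := by rw [hv]
    set a := algebraMap (𝓞 F) F b
    have h1 : σ a ^ 2 = σ (algebraMap (𝓞 F) F ↑ε) := by rw [← map_pow, ha]
    have h2 : 1 < σ a := by nlinarith
    have h3 := hfund v (by rwa [hv'])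
    rw [hv', ← h1] at h3
    nlinarith
  intro ha
  have hne : σ a ≠ 0 := by
    intro h
    rw [← ha, map_pow, h] at hε
    norm_num at hε
  rcases lt_or_gt_of_ne hne with h | h
  · exact hkey (-a) (by rw [neg_sq, ha]) (by rw [map_neg]; linarith)
  · exact hkey a ha h

lemma norm_eq_mul_conj {d : ℕ} (hd : 6 ≤ d) (hsf : Squarefree d) {s : F} (hs : s ^ 2 = (d : F))
    (hgen : Algebra.adjoin ℚ {s} = ⊤) (τ : F →ₐ[ℚ] F) (hτ : τ s = -s) (a : F) :
    ((Algebra.norm ℚ a : ℚ) : F) = a * τ a := by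
  obtain ⟨p, q, rfl⟩ := exists_coords hs hgen a
  rw [norm_coords hd hsf hs hgen, map_add, map_mul, map_ratCast, map_ratCast, hτ]
  push_cast
  linear_combination (q : F) ^ 2 * hs

lemma exists_unitData {d : ℕ} (hd : 6 ≤ d) (hsf : Squarefree d) {s : F} (hs : s ^ 2 = (d : F))
    (hgen : Algebra.adjoin ℚ {s} = ⊤) (σ : F →+* ℝ) (hσ : 0 < σ s)
    (ε : (𝓞 F)ˣ) (hε : 1 < σ (algebraMap (𝓞 F) F ↑ε))
    (hfund : ∀ u : (𝓞 F)ˣ, 1 < σ (algebraMap (𝓞 F) F ↑u) →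
      σ (algebraMap (𝓞 F) F ↑ε) ≤ σ (algebraMap (𝓞 F) F ↑u)) :
    ∃ σ₁ : F →+* ℝ,
      (Algebra.norm ℚ (algebraMap (𝓞 F) F ↑ε) = 1 → UnitData σ σ₁ (algebraMap (𝓞 F) F ↑ε)) ∧
      (Algebra.norm ℚ (algebraMap (𝓞 F) F ↑ε) = -1 → ∀ u : (𝓞 F)ˣ,
        0 < σ (algebraMap (𝓞 F) F u) → 0 < σ₁ (algebraMap (𝓞 F) F u) →
        ∃ l : (𝓞 F)ˣ, algebraMap (𝓞 F) F u = algebraMap (𝓞 F) F l ^ 2) := by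
  obtain ⟨τ, hτ⟩ := exists_conj hd hsf hs hgen
  have hN := norm_eq_mul_conj hd hsf hs hgen τ hτ (algebraMap (𝓞 F) F ↑ε)
  have hN' : ((Algebra.norm ℚ (algebraMap (𝓞 F) F ↑ε) : ℚ) : ℝ) =
      σ (algebraMap (𝓞 F) F ↑ε) * σ (τ (algebraMap (𝓞 F) F ↑ε)) := by
    rw [← map_mul, ← hN, map_ratCast]
  refine ⟨σ.comp τ, fun h => ?_, fun h u hu hu' => ?_⟩
  · rw [h, Rat.cast_one] at hN'
    refine ⟨by linarith, ?_, fund_not_sq σ ε hε hfund, ⟨ε, rfl⟩, fun a ha h0 h1 =>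
      eq_int_of_bounded hd hsf hs hgen τ hτ σ hσ a ha h0 h1, fun u hu _ => ?_⟩
    · change 0 < σ (τ _)
      by_contra hh
      nlinarith
    · obtain ⟨n, rfl⟩ := unit_eq_fund_zpow σ ε hε hfund u hu
      rcases Int.even_or_odd' n with ⟨k, rfl | rfl⟩
      · refine ⟨ε ^ k, Or.inl ?_⟩
        rw [← map_pow, ← Units.val_pow_eq_pow_val, mul_comm, zpow_mul]
        rfl
      · refine ⟨ε ^ k, Or.inr ?_⟩
        rw [← map_pow, ← map_mul, ← Units.val_pow_eq_pow_val, ← Units.val_mul, zpow_add, mul_comm,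
          mul_comm 2 k, zpow_mul, zpow_one]
        rfl
  · obtain ⟨n, rfl⟩ := unit_eq_fund_zpow σ ε hε hfund u hu
    rcases Int.even_or_odd' n with ⟨k, rfl | rfl⟩
    · refine ⟨ε ^ k, ?_⟩
      rw [← map_pow, ← Units.val_pow_eq_pow_val, mul_comm, zpow_mul]
      rfl
    · exfalso
      rw [h] at hN'
      push_cast at hN'
      rw [add_comm, mul_comm 2 k, zpow_add, zpow_mul, zpow_one, Units.val_mul, map_mul, map_mul]
        at hu'
      have h1 : 0 ≤ (σ.comp τ) (algebraMap (𝓞 F) F ((ε ^ k) ^ (2 : ℤ) : (𝓞 F)ˣ)) := by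
        rw [zpow_ofNat, Units.val_pow_eq_pow_val, map_pow, map_pow]
        exact sq_nonneg _
      have h2 : (σ.comp τ) (algebraMap (𝓞 F) F ε) < 0 := by
        change σ (τ _) < 0
        by_contra hh
        nlinarith
      nlinarith

lemma norm_unit (u : (𝓞 F)ˣ) : Algebra.norm ℚ (algebraMap (𝓞 F) F ↑u) = 1 ∨
    Algebra.norm ℚ (algebraMap (𝓞 F) F ↑u) = -1 := by
  have h := NumberField.isUnit_iff_norm.1 u.isUnit
  rw [RingOfIntegers.coe_norm] at h
  exact (abs_eq zero_le_one).1 h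

end RealQuadratic

section Orders

variable {F}

lemma algebraMap_eq_coe {A B : F} (r : F) : algebraMap F ℍ[F, A, B] r = (r : ℍ[F, A, B]) := rfl

section Basic

variable {A B : F}

lemma redNorm_eq (x : ℍ[F, A, B]) :
    redNorm F x = x.re ^ 2 - A * x.imI ^ 2 - B * x.imJ ^ 2 + A * B * x.imK ^ 2 := by
  simp [redNorm]; ring

lemma mul_star_eq (x : ℍ[F, A, B]) : x * star x = ((redNorm F x : F) : ℍ[F, A, B]) :=
  QuaternionAlgebra.mul_star_eq_coe x

lemma star_mul_eq (x : ℍ[F, A, B]) : star x * x = ((redNorm F x : F) : ℍ[F, A, B]) := by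
  rw [← mul_star_eq]; ext <;> simp <;> ring

lemma redNorm_mul (x y : ℍ[F, A, B]) : redNorm F (x * y) = redNorm F x * redNorm F y := by
  simp only [redNorm_eq]; simp; ring

lemma redNorm_coe (r : F) : redNorm F (r : ℍ[F, A, B]) = r ^ 2 := by
  simp [redNorm_eq]

lemma redNorm_smul (r : F) (x : ℍ[F, A, B]) : redNorm F (r • x) = r ^ 2 * redNorm F x := by
  simp only [redNorm_eq]; simp; ring

lemma redNorm_one : redNorm F (1 : ℍ[F, A, B]) = 1 := by
  simp [redNorm_eq]

lemma redNorm_pos (σ : F →+* ℝ) (hA : σ A < 0) (hB : σ B < 0) {x : ℍ[F, A, B]} (hx : x ≠ 0) :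
    0 < σ (redNorm F x) := by
  rw [redNorm_eq]
  simp only [map_add, map_sub, map_mul, map_pow]
  have hAB : 0 < σ A * σ B := mul_pos_of_neg_of_neg hA hB
  have h0 := sq_nonneg (σ x.re)
  have h1 : 0 ≤ -σ A * σ x.imI ^ 2 := mul_nonneg (by linarith) (sq_nonneg _)
  have h2 : 0 ≤ -σ B * σ x.imJ ^ 2 := mul_nonneg (by linarith) (sq_nonneg _)
  have h3 : 0 ≤ σ A * σ B * σ x.imK ^ 2 := mul_nonneg hAB.le (sq_nonneg _)
  by_contra hle
  apply hx
  have e0 : σ x.re ^ 2 = 0 := by linarith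
  have e1 : -σ A * σ x.imI ^ 2 = 0 := by linarith
  have e2 : -σ B * σ x.imJ ^ 2 = 0 := by linarith
  have e3 : σ A * σ B * σ x.imK ^ 2 = 0 := by linarith
  ext
  · simpa using e0
  · simpa [hA.ne] using e1
  · simpa [hB.ne] using e2
  · simpa [hA.ne, hB.ne] using e3

lemma redNorm_ne_zero (σ : F →+* ℝ) (hA : σ A < 0) (hB : σ B < 0) {x : ℍ[F, A, B]} (hx : x ≠ 0) :
    redNorm F x ≠ 0 := by
  intro h
  have := redNorm_pos σ hA hB hx
  rw [h, map_zero] at this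
  exact lt_irrefl _ this

lemma isUnit_of_redNorm_ne_zero {x : ℍ[F, A, B]} (hx : redNorm F x ≠ 0) : IsUnit x := by
  refine ⟨⟨x, (redNorm F x)⁻¹ • star x, ?_, ?_⟩, rfl⟩
  · rw [mul_smul_comm, mul_star_eq, QuaternionAlgebra.smul_coe, inv_mul_cancel₀ hx]; rfl
  · rw [smul_mul_assoc, star_mul_eq, QuaternionAlgebra.smul_coe, inv_mul_cancel₀ hx]; rfl

lemma sq_eq (x : ℍ[F, A, B]) : x * x = (2 * x.re) • x - ((redNorm F x : F) : ℍ[F, A, B]) := by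
  have h := redNorm_eq x
  generalize redNorm F x = N at h
  subst h
  generalize hN : x.re ^ 2 - A * x.imI ^ 2 - B * x.imJ ^ 2 + A * B * x.imK ^ 2 = N
  ext <;> simp only [QuaternionAlgebra.re_sub, QuaternionAlgebra.imI_sub, QuaternionAlgebra.imJ_sub,
    QuaternionAlgebra.imK_sub, QuaternionAlgebra.re_coe, QuaternionAlgebra.imI_coe,
    QuaternionAlgebra.imJ_coe, QuaternionAlgebra.imK_coe, QuaternionAlgebra.re_smul,
    QuaternionAlgebra.imI_smul, QuaternionAlgebra.imJ_smul, QuaternionAlgebra.imK_smul,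
    QuaternionAlgebra.re_mul, QuaternionAlgebra.imI_mul, QuaternionAlgebra.imJ_mul,
    QuaternionAlgebra.imK_mul, smul_eq_mul, ← hN] <;> ring

lemma star_eq_sub (x : ℍ[F, A, B]) : star x = ((2 * x.re : F) : ℍ[F, A, B]) - x := by
  rw [QuaternionAlgebra.star_eq_two_re_sub, zero_mul, add_zero]

end Basic

lemma IsOrder.isIntegral {H : Type} [Ring H] [Algebra F H] {O : Subring H} (hO : IsOrder F O)
    {x : H} (hx : x ∈ O) : IsIntegral ℤ x := by
  refine IsIntegral.of_mem_of_fg (subalgebraOfSubring O) ?_ x hx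
  rw [Submodule.fg_iff_addSubgroup_fg]
  exact hO.2.1

lemma IsOrder.algebraMap_mem {H : Type} [Ring H] [Algebra F H] {O : Subring H} (hO : IsOrder F O)
    (r : 𝓞 F) : algebraMap F H (algebraMap (𝓞 F) F r) ∈ O := hO.1 ⟨r, rfl⟩

lemma IsOrder.smul_mem {H : Type} [Ring H] [Algebra F H] {O : Subring H} (hO : IsOrder F O)
    (r : 𝓞 F) {x : H} (hx : x ∈ O) : algebraMap (𝓞 F) F r • x ∈ O := by
  rw [Algebra.smul_def]
  exact O.mul_mem (hO.algebraMap_mem r) hx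

section Integral

variable {A B : F}

lemma isIntegral_star {x : ℍ[F, A, B]} (hx : IsIntegral ℤ x) : IsIntegral ℤ (star x) := by
  obtain ⟨p, hp, h⟩ := hx
  refine ⟨p, hp, ?_⟩
  have hs : ∀ q : Polynomial ℤ, q.eval₂ (algebraMap ℤ ℍ[F, A, B]) (star x) =
      star (q.eval₂ (algebraMap ℤ ℍ[F, A, B]) x) := by
    intro q
    induction q using Polynomial.induction_on' with
    | add p q hp hq => rw [Polynomial.eval₂_add, Polynomial.eval₂_add, hp, hq, star_add]
    | monomial n a =>
      rw [Polynomial.eval₂_monomial, Polynomial.eval₂_monomial, star_mul, star_pow]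
      simp only [eq_intCast, star_intCast]
      exact Int.cast_commute _ _
  rw [hs, h, star_zero]

lemma isIntegral_coe_iff {r : F} : IsIntegral ℤ (r : ℍ[F, A, B]) ↔ IsIntegral ℤ r := by
  constructor
  · rintro ⟨p, hp, h⟩
    refine ⟨p, hp, ?_⟩
    apply QuaternionAlgebra.algebraMap_injective (c₁ := A) (c₂ := 0) (c₃ := B)
    rw [Polynomial.hom_eval₂, map_zero, ← h]
    congr 1
  · exact fun h => h.map ((Algebra.ofId F ℍ[F, A, B]).restrictScalars ℤ)

lemma isIntegral_trace_norm {x : ℍ[F, A, B]} (hx : IsIntegral ℤ x) :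
    IsIntegral ℤ (2 * x.re) ∧ IsIntegral ℤ (redNorm F x) := by
  let S := Algebra.adjoin F ({x} : Set ℍ[F, A, B])
  have hxS : x ∈ S := Algebra.subset_adjoin rfl
  have hcoe : ∀ r : F, (r : ℍ[F, A, B]) ∈ S := fun r => S.algebraMap_mem r
  have hs : star x ∈ S := by
    rw [star_eq_sub]
    exact S.sub_mem (hcoe _) hxS
  have : IsMulCommutative S := Algebra.isMulCommutative_adjoin F (by
    rintro a rfl b rfl; rfl)
  have hinj : Function.Injective (S.val.restrictScalars ℤ) := Subtype.val_injective
  have h1 : IsIntegral ℤ (⟨x, hxS⟩ : S) :=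
    (isIntegral_algHom_iff (S.val.restrictScalars ℤ) hinj).1 hx
  have h2 : IsIntegral ℤ (⟨star x, hs⟩ : S) :=
    (isIntegral_algHom_iff (S.val.restrictScalars ℤ) hinj).1 (isIntegral_star hx)
  constructor
  · rw [← isIntegral_coe_iff (A := A) (B := B)]
    have := (h1.add h2).map (S.val.restrictScalars ℤ)
    have e : ((2 * x.re : F) : ℍ[F, A, B]) = x + star x := by
      rw [star_eq_sub]; abel
    rw [e]
    exact this
  · rw [← isIntegral_coe_iff (A := A) (B := B), ← mul_star_eq]
    exact (h1.mul h2).map (S.val.restrictScalars ℤ)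

lemma IsOrder.trace_mem {O : Subring ℍ[F, A, B]} (hO : IsOrder F O) {x : ℍ[F, A, B]}
    (hx : x ∈ O) : ∃ r : 𝓞 F, algebraMap (𝓞 F) F r = 2 * x.re :=
  ⟨⟨_, (isIntegral_trace_norm (hO.isIntegral hx)).1⟩, rfl⟩

lemma IsOrder.norm_mem {O : Subring ℍ[F, A, B]} (hO : IsOrder F O) {x : ℍ[F, A, B]}
    (hx : x ∈ O) : ∃ r : 𝓞 F, algebraMap (𝓞 F) F r = redNorm F x :=
  ⟨⟨_, (isIntegral_trace_norm (hO.isIntegral hx)).2⟩, rfl⟩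

lemma IsOrder.star_mem {O : Subring ℍ[F, A, B]} (hO : IsOrder F O) {x : ℍ[F, A, B]}
    (hx : x ∈ O) : star x ∈ O := by
  obtain ⟨r, hr⟩ := hO.trace_mem hx
  have : star x = algebraMap F ℍ[F, A, B] (algebraMap (𝓞 F) F r) - x := by
    rw [hr, algebraMap_eq_coe, star_eq_sub]
  rw [this]
  exact O.sub_mem (hO.algebraMap_mem r) hx

lemma IsOrder.exists_unit {O : Subring ℍ[F, A, B]} (hO : IsOrder F O) {x : ℍ[F, A, B]}
    (hx : x ∈ O) (r : (𝓞 F)ˣ) (hr : redNorm F x = algebraMap (𝓞 F) F r) :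
    ∃ u : (↥O)ˣ, ((u : ↥O) : ℍ[F, A, B]) = x := by
  have hinv : algebraMap (𝓞 F) F ↑r⁻¹ * redNorm F x = 1 := by
    rw [hr, ← map_mul, ← Units.val_mul, inv_mul_cancel]; simp
  refine ⟨⟨⟨x, hx⟩, ⟨_, hO.smul_mem (↑r⁻¹ : 𝓞 F) (hO.star_mem hx)⟩, ?_, ?_⟩, rfl⟩
  · apply Subtype.ext
    change x * _ = 1
    rw [mul_smul_comm, mul_star_eq, QuaternionAlgebra.smul_coe, hinv]; rfl
  · apply Subtype.ext
    change _ * x = 1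
    rw [smul_mul_assoc, star_mul_eq, QuaternionAlgebra.smul_coe, hinv]; rfl

lemma IsOrder.unit_norm {O : Subring ℍ[F, A, B]} (hO : IsOrder F O) (u : (↥O)ˣ) :
    ∃ r : (𝓞 F)ˣ, redNorm F ((u : ↥O) : ℍ[F, A, B]) = algebraMap (𝓞 F) F r := by
  obtain ⟨r, hr⟩ := hO.norm_mem (u : ↥O).2
  obtain ⟨s, hs⟩ := hO.norm_mem ((u⁻¹ : (↥O)ˣ) : ↥O).2
  have h : r * s = 1 := by
    apply FaithfulSMul.algebraMap_injective (𝓞 F) F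
    rw [map_mul, hr, hs, ← redNorm_mul, map_one, ← Subring.coe_mul, ← Units.val_mul,
      mul_inv_cancel]
    exact redNorm_one
  exact ⟨⟨r, s, h, by rw [mul_comm, h]⟩, hr.symm⟩

end Integral

end Orders

section Definite

variable {F}

/-- The data of `UnitData` together with the definiteness of `ℍ[F, A, B]` at both real places. -/
structure DefData (σ₀ σ₁ : F →+* ℝ) (A B e : F) : Prop extends UnitData σ₀ σ₁ e where
  A₀ : σ₀ A < 0
  A₁ : σ₁ A < 0
  B₀ : σ₀ B < 0
  B₁ : σ₁ B < 0

variable {A B e : F} {σ₀ σ₁ : F →+* ℝ}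

lemma re_sq_le (σ : F →+* ℝ) (hA : σ A < 0) (hB : σ B < 0) (x : ℍ[F, A, B]) :
    σ x.re ^ 2 ≤ σ (redNorm F x) := by
  rw [redNorm_eq]
  simp only [map_add, map_sub, map_mul, map_pow]
  have hAB : 0 < σ A * σ B := mul_pos_of_neg_of_neg hA hB
  have h1 : 0 ≤ -σ A * σ x.imI ^ 2 := mul_nonneg (by linarith) (sq_nonneg _)
  have h2 : 0 ≤ -σ B * σ x.imJ ^ 2 := mul_nonneg (by linarith) (sq_nonneg _)
  have h3 : 0 ≤ σ A * σ B * σ x.imK ^ 2 := mul_nonneg hAB.le (sq_nonneg _)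
  linarith

lemma UnitData.ne_zero (h : UnitData σ₀ σ₁ e) : e ≠ 0 := by
  rintro rfl
  exact h.not_sq 0 (by simp)

lemma DefData.norm_ne_zero (h : DefData σ₀ σ₁ A B e) {x : ℍ[F, A, B]} (hx : x ≠ 0) :
    redNorm F x ≠ 0 := redNorm_ne_zero σ₀ h.A₀ h.B₀ hx

lemma DefData.isUnit (h : DefData σ₀ σ₁ A B e) {x : ℍ[F, A, B]} (hx : x ≠ 0) : IsUnit x :=
  isUnit_of_redNorm_ne_zero (h.norm_ne_zero hx)

lemma DefData.eq_zero_or (h : DefData σ₀ σ₁ A B e) {x y : ℍ[F, A, B]} (hxy : x * y = 0) :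
    x = 0 ∨ y = 0 := by
  by_contra! hc
  have := congrArg (redNorm F) hxy
  rw [redNorm_mul] at this
  exact mul_ne_zero (h.norm_ne_zero hc.1) (h.norm_ne_zero hc.2) (by simpa [redNorm_eq] using this)

lemma DefData.trace_norm_one (h : DefData σ₀ σ₁ A B e) {O : Subring ℍ[F, A, B]}
    (hO : IsOrder F O) {x : ℍ[F, A, B]} (hx : x ∈ O) (hn : redNorm F x = 1) :
    ∃ m : ℤ, 2 * x.re = m ∧ (m = 0 ∨ m = 1 ∨ m = -1 ∨ m = 2 ∨ m = -2) := by
  have key : ∀ σ : F →+* ℝ, σ A < 0 → σ B < 0 → |σ (2 * x.re)| ≤ 2 := by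
    intro σ hA hB
    have := re_sq_le σ hA hB x
    rw [hn, map_one] at this
    rw [map_mul, map_ofNat, abs_mul, abs_two]
    have := abs_le_one_iff_mul_self_le_one.2 (by rwa [← sq] : σ x.re * σ x.re ≤ 1)
    linarith
  obtain ⟨m, hm⟩ := h.eq_int _ (isIntegral_trace_norm (hO.isIntegral hx)).1
    (key σ₀ h.A₀ h.B₀) (key σ₁ h.A₁ h.B₁)
  refine ⟨m, hm, ?_⟩
  have := key σ₀ h.A₀ h.B₀
  rw [hm, map_intCast] at this
  have h2 : |m| ≤ 2 := by exact_mod_cast this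
  rw [abs_le] at h2
  omega

lemma DefData.eq_coe_of_re_sq (h : DefData σ₀ σ₁ A B e) {x : ℍ[F, A, B]}
    (hx : x.re ^ 2 = redNorm F x) : x = (x.re : ℍ[F, A, B]) := by
  by_contra hne
  refine h.norm_ne_zero (sub_ne_zero.2 hne) ?_
  rw [redNorm_eq] at hx ⊢
  simp
  linear_combination -hx

lemma UnitData.inv_smul_mem (h : UnitData σ₀ σ₁ e) {H : Type} [Ring H] [Algebra F H]
    {O : Subring H} (hO : IsOrder F O) {x : H} (hx : x ∈ O) : e⁻¹ • x ∈ O := by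
  obtain ⟨v, hv⟩ := h.unit
  have : e⁻¹ = algebraMap (𝓞 F) F ↑v⁻¹ := by
    refine inv_eq_of_mul_eq_one_right ?_
    rw [hv, ← map_mul, Units.mul_inv, map_one]
  rw [this]
  exact hO.smul_mem _ hx

lemma trace_sq (y : ℍ[F, A, B]) : 2 * (y * y).re = (2 * y.re) ^ 2 - 2 * redNorm F y := by
  rw [redNorm_eq]; simp; ring

lemma DefData.trace_norm_e (h : DefData σ₀ σ₁ A B e) {O : Subring ℍ[F, A, B]}
    (hO : IsOrder F O) {y : ℍ[F, A, B]} (hy : y ∈ O) (hn : redNorm F y = e) :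
    y.re = 0 ∨ (2 * y.re) ^ 2 = 2 * e ∨ (2 * y.re) ^ 2 = 3 * e := by
  have he := h.ne_zero
  obtain ⟨m, hm, hc⟩ := h.trace_norm_one hO (h.inv_smul_mem hO (O.mul_mem hy hy)) (by
    rw [redNorm_smul, redNorm_mul, hn]; field_simp)
  have h1 := trace_sq y
  rw [hn] at h1
  have h2 : (2 * y.re) ^ 2 = (m + 2) * e := by
    rw [← hm, QuaternionAlgebra.re_smul, smul_eq_mul]
    field_simp
    linear_combination -h1 / 2
  rcases hc with rfl | rfl | rfl | rfl | rfl <;> push_cast at h2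
  · right; left; linear_combination h2
  · right; right; linear_combination h2
  · exact absurd (by linear_combination h2) (h.not_sq (2 * y.re))
  · exact absurd (by linear_combination h2 / 4) (h.not_sq y.re)
  · left
    have : y.re ^ 2 = 0 := by linear_combination h2 / 4
    simpa using this

/-- Every unit of an order is a scalar multiple of an element of norm `1` or `e`. -/
lemma DefData.unit_cases (h : DefData σ₀ σ₁ A B e) {O : Subring ℍ[F, A, B]}
    (hO : IsOrder F O) (u : (↥O)ˣ) : ∃ (l : (𝓞 F)ˣ) (x : ℍ[F, A, B]), x ∈ O ∧
      ((u : ↥O) : ℍ[F, A, B]) = algebraMap (𝓞 F) F l • x ∧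
      (redNorm F x = 1 ∨ redNorm F x = e) := by
  obtain ⟨r, hr⟩ := hO.unit_norm u
  have hu : ((u : ↥O) : ℍ[F, A, B]) ≠ 0 := by
    intro h0
    rw [h0] at hr
    have : redNorm F (0 : ℍ[F, A, B]) = 0 := by simp [redNorm_eq]
    rw [this] at hr
    exact r.ne_zero (FaithfulSMul.algebraMap_injective (𝓞 F) F (by rw [← hr, map_zero]))
  obtain ⟨l, hl⟩ := h.units r (by rw [← hr]; exact redNorm_pos _ h.A₀ h.B₀ hu)
    (by rw [← hr]; exact redNorm_pos _ h.A₁ h.B₁ hu)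
  have hinv : algebraMap (𝓞 F) F l * algebraMap (𝓞 F) F ↑l⁻¹ = 1 := by
    rw [← map_mul, Units.mul_inv, map_one]
  refine ⟨l, algebraMap (𝓞 F) F ↑l⁻¹ • ((u : ↥O) : ℍ[F, A, B]), hO.smul_mem _ (u : ↥O).2, ?_, ?_⟩
  · rw [smul_smul, hinv, one_smul]
  · rw [redNorm_smul, hr]
    rcases hl with hl | hl
    · left; rw [hl]; linear_combination (algebraMap (𝓞 F) F l * algebraMap (𝓞 F) F ↑l⁻¹ + 1) * hinv
    · right; rw [hl]
      linear_combination e * (algebraMap (𝓞 F) F l * algebraMap (𝓞 F) F ↑l⁻¹ + 1) * hinv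

end Definite

section Pairs

variable {F}
variable {A B e : F} {σ₀ σ₁ : F →+* ℝ}

/-- A pair of elements satisfying the defining relations of `ℍ[F, -1, -e]`. -/
structure StdPair (e : F) (I J : ℍ[F, A, B]) : Prop where
  sq_left : I * I = -1
  sq_right : J * J = -(e : ℍ[F, A, B])
  anti : I * J = -(J * I)

lemma StdPair.of_re {I J : ℍ[F, A, B]} (hI : I.re = 0) (hJ : J.re = 0) (hIJ : (I * J).re = 0)
    (nI : redNorm F I = 1) (nJ : redNorm F J = e) : StdPair e I J := by
  have st : ∀ x : ℍ[F, A, B], x.re = 0 → star x = -x := fun x hx => by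
    rw [star_eq_sub, hx, mul_zero, QuaternionAlgebra.coe_zero, zero_sub]
  refine ⟨?_, ?_, ?_⟩
  · rw [sq_eq, hI, nI, mul_zero, zero_smul, zero_sub, QuaternionAlgebra.coe_one]
  · rw [sq_eq, hJ, nJ, mul_zero, zero_smul, zero_sub]
  · have := st _ hIJ
    rw [star_mul, st _ hI, st _ hJ, neg_mul_neg] at this
    rw [this, neg_neg]

lemma re_eq_zero_of_sq {x : ℍ[F, A, B]} (hx : ∀ r : F, x ≠ (r : ℍ[F, A, B])) {s : F}
    (hs : x * x = (s : ℍ[F, A, B])) : x.re = 0 := by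
  by_contra hne
  rw [sq_eq, sub_eq_iff_eq_add] at hs
  have h2 : (2 * x.re) ≠ 0 := by simpa using hne
  apply hx ((2 * x.re)⁻¹ * (s + redNorm F x))
  rw [QuaternionAlgebra.coe_mul, QuaternionAlgebra.coe_add, ← hs, QuaternionAlgebra.coe_mul_eq_smul,
    smul_smul, inv_mul_cancel₀ h2, one_smul]

lemma IsOrder.isScalarUnit_iff {O : Subring ℍ[F, A, B]} (hO : IsOrder F O) (u : (↥O)ˣ) :
    IsScalarUnit F u ↔ ∃ r : F, ((u : ↥O) : ℍ[F, A, B]) = (r : ℍ[F, A, B]) := by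
  constructor
  · rintro ⟨r, hr⟩
    exact ⟨_, hr⟩
  · rintro ⟨r, hr⟩
    have hint : IsIntegral ℤ r := by
      rw [← isIntegral_coe_iff (A := A) (B := B), ← hr]
      exact hO.isIntegral (u : ↥O).2
    obtain ⟨n, hn⟩ := hO.unit_norm u
    rw [hr, redNorm_coe] at hn
    let r' : 𝓞 F := ⟨r, hint⟩
    have h1 : r' * (r' * ↑n⁻¹) = 1 := by
      apply FaithfulSMul.algebraMap_injective (𝓞 F) F
      have : algebraMap (𝓞 F) F r' = r := rfl
      rw [map_mul, map_mul, this, ← mul_assoc, ← sq, hn, ← map_mul, Units.mul_inv]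
    exact ⟨⟨r', r' * ↑n⁻¹, h1, by rw [mul_comm, h1]⟩, hr⟩

lemma DefData.pow_scalar (h : DefData σ₀ σ₁ A B e) {x : ℍ[F, A, B]} (hn : redNorm F x = 1)
    {m : ℤ} (hm : 2 * x.re = m) (hc : m = 0 ∨ m = 1 ∨ m = -1 ∨ m = 2 ∨ m = -2) :
    (∃ s : F, x ^ 2 = (s : ℍ[F, A, B])) ∨ ∃ s : F, x ^ 3 = (s : ℍ[F, A, B]) := by
  have hsq := sq_eq x
  rw [hn, hm, QuaternionAlgebra.coe_one, ← sq] at hsq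
  have hsc : x.re ^ 2 = 1 → ∃ s : F, x ^ 2 = (s : ℍ[F, A, B]) := fun hre =>
    ⟨x.re ^ 2, by
      conv_lhs => rw [h.eq_coe_of_re_sq (hre.trans hn.symm)]
      rw [← QuaternionAlgebra.coe_pow]⟩
  rcases hc with rfl | rfl | rfl | rfl | rfl
  · exact Or.inl ⟨-1, by rw [hsq]; simp⟩
  · refine Or.inr ⟨-1, ?_⟩
    rw [Int.cast_one, one_smul] at hsq
    rw [pow_succ, hsq, sub_mul, one_mul, ← sq, hsq]; simp
  · refine Or.inr ⟨1, ?_⟩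
    rw [Int.cast_neg, Int.cast_one, neg_smul, one_smul] at hsq
    rw [pow_succ, hsq, sub_mul, one_mul, neg_mul, ← sq, hsq]; simp
  · exact Or.inl (hsc (by push_cast at hm; linear_combination (x.re / 2 + 1 / 2) * hm))
  · exact Or.inl (hsc (by push_cast at hm; linear_combination (x.re / 2 - 1 / 2) * hm))

/-- `g` is the image of a unit of reduced norm `c`. -/
def HasNorm {G : Type*} [Group G] {O : Subring ℍ[F, A, B]} (φ : (↥O)ˣ →* G) (c : F) (g : G) :
    Prop :=
  ∃ u : (↥O)ˣ, φ u = g ∧ redNorm F ((u : ↥O) : ℍ[F, A, B]) = c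

section Group

variable {G : Type*} [Group G] {O : Subring ℍ[F, A, B]} {φ : (↥O)ˣ →* G}

lemma exists_smul_unit (hO : IsOrder F O) (hker : ∀ u, φ u = 1 ↔ IsScalarUnit F u) (u : (↥O)ˣ)
    (r : (𝓞 F)ˣ) : ∃ u' : (↥O)ˣ, φ u' = φ u ∧
      ((u' : ↥O) : ℍ[F, A, B]) = algebraMap (𝓞 F) F r • ((u : ↥O) : ℍ[F, A, B]) := by
  obtain ⟨v, hv⟩ := hO.exists_unit (hO.algebraMap_mem (r : 𝓞 F)) (r ^ 2) (by
    rw [algebraMap_eq_coe, redNorm_coe]; simp)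
  refine ⟨v * u, ?_, ?_⟩
  · rw [map_mul, (hker v).2 ⟨r, hv⟩, one_mul]
  · rw [Units.val_mul, Subring.coe_mul, hv, Algebra.smul_def]

lemma DefData.exists_rep (h : DefData σ₀ σ₁ A B e) (hO : IsOrder F O)
    (hker : ∀ u, φ u = 1 ↔ IsScalarUnit F u) (hs : Function.Surjective φ) (g : G) :
    HasNorm φ 1 g ∨ HasNorm φ e g := by
  obtain ⟨u, rfl⟩ := hs g
  obtain ⟨l, x, -, hu, hx⟩ := h.unit_cases hO u
  obtain ⟨v, hv, hvx⟩ := exists_smul_unit hO hker u l⁻¹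
  have : ((v : ↥O) : ℍ[F, A, B]) = x := by
    rw [hvx, hu, smul_smul, ← map_mul, Units.inv_mul, map_one, one_smul]
  rcases hx with hx | hx
  · exact Or.inl ⟨v, hv, by rw [this, hx]⟩
  · exact Or.inr ⟨v, hv, by rw [this, hx]⟩

lemma HasNorm.mul {c c' : F} {g g' : G} (h : HasNorm φ c g) (h' : HasNorm φ c' g') :
    HasNorm φ (c * c') (g * g') := by
  obtain ⟨u, rfl, rfl⟩ := h
  obtain ⟨v, rfl, rfl⟩ := h'
  exact ⟨u * v, map_mul _ _ _, by rw [Units.val_mul, Subring.coe_mul, redNorm_mul]⟩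

lemma DefData.hasNorm_mul_self (h : DefData σ₀ σ₁ A B e) (hO : IsOrder F O)
    (hker : ∀ u, φ u = 1 ↔ IsScalarUnit F u) {g g' : G} (hg : HasNorm φ e g)
    (hg' : HasNorm φ e g') : HasNorm φ 1 (g * g') := by
  obtain ⟨u, hu, hn⟩ := hg.mul hg'
  obtain ⟨v, hv⟩ := h.unit
  obtain ⟨w, hw, hwx⟩ := exists_smul_unit hO hker u v⁻¹
  refine ⟨w, by rw [hw, hu], ?_⟩
  rw [hwx, redNorm_smul, hn, hv]
  have : algebraMap (𝓞 F) F ↑v⁻¹ * algebraMap (𝓞 F) F v = 1 := by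
    rw [← map_mul, Units.inv_mul, map_one]
  linear_combination (algebraMap (𝓞 F) F ↑v⁻¹ * algebraMap (𝓞 F) F v + 1) * this

lemma re_eq_zero_of_involution (hO : IsOrder F O)
    (hker : ∀ u, φ u = 1 ↔ IsScalarUnit F u) {u : (↥O)ˣ} (h1 : φ u ≠ 1) (h2 : φ u * φ u = 1) :
    ((u : ↥O) : ℍ[F, A, B]).re = 0 := by
  rw [← map_mul, hker, hO.isScalarUnit_iff] at h2
  rw [Ne, hker, hO.isScalarUnit_iff] at h1
  push Not at h1
  obtain ⟨s, hs⟩ := h2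
  exact re_eq_zero_of_sq h1 (s := s) (by rw [← hs]; rfl)

lemma exists_stdPair (hO : IsOrder F O) (hker : ∀ u, φ u = 1 ↔ IsScalarUnit F u) {g k : G}
    (hg : HasNorm φ 1 g) (hk : HasNorm φ e k) (g1 : g ≠ 1) (g2 : g * g = 1) (k1 : k ≠ 1)
    (k2 : k * k = 1) (gk1 : g * k ≠ 1) (gk2 : g * k * (g * k) = 1) :
    ∃ I ∈ O, ∃ J ∈ O, StdPair e I J := by
  obtain ⟨u, rfl, hu⟩ := hg
  obtain ⟨v, rfl, hv⟩ := hk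
  refine ⟨_, (u : ↥O).2, _, (v : ↥O).2, .of_re (re_eq_zero_of_involution hO hker g1 g2)
    (re_eq_zero_of_involution hO hker k1 k2) ?_ hu hv⟩
  rw [← map_mul] at gk1 gk2
  exact re_eq_zero_of_involution hO hker gk1 gk2

lemma DefData.exists_stdPair_of_right (h : DefData σ₀ σ₁ A B e) (hO : IsOrder F O)
    (hker : ∀ u, φ u = 1 ↔ IsScalarUnit F u) (hs : Function.Surjective φ) {g k : G}
    (hk : HasNorm φ e k) (g1 : g ≠ 1) (g2 : g * g = 1) (k1 : k ≠ 1)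
    (k2 : k * k = 1) (gk1 : g * k ≠ 1) (gk2 : g * k * (g * k) = 1) :
    ∃ I ∈ O, ∃ J ∈ O, StdPair e I J := by
  rcases h.exists_rep hO hker hs g with hg | hg
  · exact exists_stdPair hO hker hg hk g1 g2 k1 k2 gk1 gk2
  · refine exists_stdPair hO hker (h.hasNorm_mul_self hO hker hg hk) hk gk1 gk2 k1 k2 ?_ ?_
    · rwa [mul_assoc g k k, k2, mul_one]
    · rwa [mul_assoc g k k, k2, mul_one]

lemma DefData.hasNorm_e_of_pow (h : DefData σ₀ σ₁ A B e) (hO : IsOrder F O)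
    (hker : ∀ u, φ u = 1 ↔ IsScalarUnit F u) (hs : Function.Surjective φ) {r : G}
    (r2 : r ^ 2 ≠ 1) (r3 : r ^ 3 ≠ 1) : HasNorm φ e r := by
  refine (h.exists_rep hO hker hs r).resolve_left ?_
  rintro ⟨u, rfl, hu⟩
  obtain ⟨m, hm, hc⟩ := h.trace_norm_one hO (u : ↥O).2 hu
  rcases h.pow_scalar hu hm hc with ⟨s, hs⟩ | ⟨s, hs⟩
  · exact r2 (by rw [← map_pow, hker, hO.isScalarUnit_iff]; exact ⟨s, hs⟩)
  · exact r3 (by rw [← map_pow, hker, hO.isScalarUnit_iff]; exact ⟨s, hs⟩)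

lemma DefData.exists_stdPair_of_second_kind (h : DefData σ₀ σ₁ A B e) (hO : IsOrder F O)
    (hD : RedUnitDihedralSecondKind F 2 O) : ∃ I ∈ O, ∃ J ∈ O, StdPair e I J := by
  obtain ⟨φ, hs, hker, u, u1, u2, hu⟩ := hD
  have hk : HasNorm φ e (φ u) := (h.exists_rep hO hker hs (φ u)).resolve_left (by
    rintro ⟨v, hv, hn⟩
    exact hu v hv 1 (by rw [hn]; simp))
  generalize φ u = k at *
  have key : ∀ k : DihedralGroup 2, k ≠ 1 → k * k = 1 → ∃ g : DihedralGroup 2,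
      g ≠ 1 ∧ g * g = 1 ∧ g * k ≠ 1 ∧ g * k * (g * k) = 1 := by decide
  obtain ⟨g, g1, g2, g3, g4⟩ := key k u1 u2
  exact h.exists_stdPair_of_right hO hker hs hk g1 g2 u1 u2 g3 g4

lemma DefData.exists_stdPair_of_order_four (h : DefData σ₀ σ₁ A B e) (hO : IsOrder F O)
    (hker : ∀ u, φ u = 1 ↔ IsScalarUnit F u) (hs : Function.Surjective φ) (r s : G)
    (r2 : r ^ 2 ≠ 1) (r3 : r ^ 3 ≠ 1) (r4 : r ^ 2 * r ^ 2 = 1) (s1 : s ≠ 1) (s2 : s * s = 1)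
    (sr1 : s * r ≠ 1) (sr2 : s * r * (s * r) = 1) (rs1 : r ^ 2 * s ≠ 1)
    (rs2 : r ^ 2 * s * (r ^ 2 * s) = 1) (rsr1 : r ^ 2 * (s * r) ≠ 1)
    (rsr2 : r ^ 2 * (s * r) * (r ^ 2 * (s * r)) = 1) : ∃ I ∈ O, ∃ J ∈ O, StdPair e I J := by
  have hr := h.hasNorm_e_of_pow hO hker hs r2 r3
  have hr2 : HasNorm φ 1 (r ^ 2) := by
    rw [sq]; exact h.hasNorm_mul_self hO hker hr hr
  rcases h.exists_rep hO hker hs s with h1 | h1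
  · have : HasNorm φ e (s * r) := by simpa using h1.mul hr
    exact exists_stdPair hO hker hr2 this r2 r4 sr1 sr2 rsr1 rsr2
  · exact exists_stdPair hO hker hr2 h1 r2 r4 s1 s2 rs1 rs2

lemma DefData.exists_stdPair_of_dihedral_four (h : DefData σ₀ σ₁ A B e) (hO : IsOrder F O)
    (hD : RedUnitIso F O (DihedralGroup 4)) : ∃ I ∈ O, ∃ J ∈ O, StdPair e I J := by
  obtain ⟨φ, hs, hker⟩ := hD
  apply h.exists_stdPair_of_order_four hO hker hs (.r 1) (.sr 0) <;> decide

lemma DefData.exists_stdPair_of_perm (h : DefData σ₀ σ₁ A B e) (hO : IsOrder F O)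
    (hD : RedUnitIso F O (Equiv.Perm (Fin 4))) : ∃ I ∈ O, ∃ J ∈ O, StdPair e I J := by
  obtain ⟨φ, hs, hker⟩ := hD
  apply h.exists_stdPair_of_order_four hO hker hs (finRotate 4) (Equiv.swap 0 2) <;> decide

lemma DefData.exists_stdPair_of_dihedral_six (h : DefData σ₀ σ₁ A B e) (hO : IsOrder F O)
    (hD : RedUnitIso F O (DihedralGroup 6)) : ∃ I ∈ O, ∃ J ∈ O, StdPair e I J := by
  obtain ⟨φ, hs, hker⟩ := hD
  have hr : HasNorm φ e (.r 1) := by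
    apply h.hasNorm_e_of_pow hO hker hs <;> decide
  have hr3 : HasNorm φ e (.r 3) := by
    have := (h.hasNorm_mul_self hO hker hr hr).mul hr
    rw [one_mul] at this
    exact this
  apply h.exists_stdPair_of_right hO hker hs (g := .sr 0) hr3 <;> decide

end Group

lemma StdPair.algEquiv (h : DefData σ₀ σ₁ (-1) (-e) e) {I J : ℍ[F, A, B]} (hp : StdPair e I J)
    : Nonempty (ℍ[F, A, B] ≃ₐ[F] ℍ[F, -1, -e]) := by
  let b : QuaternionAlgebra.Basis ℍ[F, A, B] (-1 : F) 0 (-e) :=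
    { i := I, j := J, k := I * J
      i_mul_i := by rw [hp.sq_left]; simp
      j_mul_j := by rw [hp.sq_right, Algebra.smul_def, mul_one, algebraMap_eq_coe]; simp
      i_mul_j := rfl
      j_mul_i := by rw [hp.anti]; simp }
  let f : ℍ[F, -1, -e] →ₐ[F] ℍ[F, A, B] := b.liftHom
  have hinj : Function.Injective f := by
    rw [injective_iff_map_eq_zero]
    intro x hx
    by_contra hne
    have := (h.isUnit hne).map f
    rw [hx] at this
    exact not_isUnit_zero this
  have hsurj : Function.Surjective f := by
    have : Module.finrank F ℍ[F, -1, -e] = Module.finrank F ℍ[F, A, B] := by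
      rw [QuaternionAlgebra.finrank_eq_four, QuaternionAlgebra.finrank_eq_four]
    exact (LinearMap.injective_iff_surjective_of_finrank_eq_finrank
      (f := f.toLinearMap) this).1 hinj
  exact ⟨(AlgEquiv.ofBijective f ⟨hinj, hsurj⟩).symm⟩

/-- The reduced norms of units are squares when all totally positive units are squares. -/
lemma not_second_kind_of_units {O : Subring ℍ[F, A, B]} (hO : IsOrder F O)
    (hA₀ : σ₀ A < 0) (hB₀ : σ₀ B < 0) (hA₁ : σ₁ A < 0) (hB₁ : σ₁ B < 0)
    (hu : ∀ u : (𝓞 F)ˣ, 0 < σ₀ (algebraMap (𝓞 F) F u) → 0 < σ₁ (algebraMap (𝓞 F) F u) →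
      ∃ l : (𝓞 F)ˣ, algebraMap (𝓞 F) F u = algebraMap (𝓞 F) F l ^ 2) (n : ℕ) :
    ¬ RedUnitDihedralSecondKind F n O := by
  rintro ⟨φ, -, -, u, -, -, h⟩
  obtain ⟨r, hr⟩ := hO.unit_norm u
  have hu0 : ((u : ↥O) : ℍ[F, A, B]) ≠ 0 := by
    intro h0
    rw [h0] at hr
    have : redNorm F (0 : ℍ[F, A, B]) = 0 := by simp [redNorm_eq]
    rw [this] at hr
    exact r.ne_zero (FaithfulSMul.algebraMap_injective (𝓞 F) F (by rw [← hr, map_zero]))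
  obtain ⟨l, hl⟩ := hu r (by rw [← hr]; exact redNorm_pos _ hA₀ hB₀ hu0)
    (by rw [← hr]; exact redNorm_pos _ hA₁ hB₁ hu0)
  exact h u rfl l (by rw [hr, hl])

end Pairs

section Conjugation

variable {F}
variable {H : Type} [Ring H] [Algebra F H]

/-- Conjugation by a unit as an algebra automorphism. -/
def conjEquiv (x : Hˣ) : H ≃ₐ[F] H where
  toFun y := x * y * ((x⁻¹ : Hˣ) : H)
  invFun y := ((x⁻¹ : Hˣ) : H) * y * x
  left_inv y := by simp [mul_assoc]
  right_inv y := by simp [mul_assoc]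
  map_mul' y z := by simp [mul_assoc]
  map_add' y z := by simp [mul_add, add_mul]
  commutes' r := by simp [← Algebra.commutes r (x : H), mul_assoc]

lemma isConjugate_iff (x : Hˣ) (O O' : Subring H) :
    IsConjugate x O O' ↔ O' = O.map ((conjEquiv (F := F) x : H ≃ₐ[F] H) : H →+* H) := by
  constructor
  · intro h
    ext y
    rw [Subring.mem_map]
    constructor
    · intro hy
      refine ⟨((x⁻¹ : Hˣ) : H) * y * x, ?_, ?_⟩
      · rw [h]; simpa [mul_assoc] using hy
      · change (x : H) * (((x⁻¹ : Hˣ) : H) * y * x) * ((x⁻¹ : Hˣ) : H) = y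
        simp [mul_assoc]
    · rintro ⟨z, hz, rfl⟩
      exact (h z).1 hz
  · rintro rfl y
    rw [Subring.mem_map]
    constructor
    · exact fun hy => ⟨y, hy, rfl⟩
    · rintro ⟨z, hz, hzy⟩
      have : z = y := (conjEquiv (F := F) x).injective hzy
      exact this ▸ hz

lemma IsConjugate.refl (O : Subring H) : IsConjugate 1 O O := fun y => by simp

lemma IsConjugate.symm {x : Hˣ} {O O' : Subring H} (h : IsConjugate x O O') :
    IsConjugate x⁻¹ O' O := fun y => by
  rw [h]; simp [mul_assoc]

lemma IsConjugate.trans {x y : Hˣ} {O O' O'' : Subring H} (h : IsConjugate x O O')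
    (h' : IsConjugate y O' O'') : IsConjugate (y * x) O O'' := fun z => by
  rw [h, h']; simp [mul_assoc]

lemma conjRel_equivalence : Equivalence (ConjRel : Subring H → Subring H → Prop) where
  refl O := ⟨1, .refl O⟩
  symm := fun ⟨x, h⟩ => ⟨x⁻¹, h.symm⟩
  trans := fun ⟨x, h⟩ ⟨y, h'⟩ => ⟨y * x, h.trans h'⟩

lemma IsOrder.map {O : Subring H} (hO : IsOrder F O) (f : H ≃ₐ[F] H) :
    IsOrder F (O.map (f : H →+* H)) := by
  refine ⟨?_, ?_, ?_⟩
  · rintro _ ⟨r, rfl⟩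
    exact ⟨_, hO.1 ⟨r, rfl⟩, f.commutes _⟩
  · obtain ⟨S, hS⟩ := hO.2.1
    classical
    refine ⟨S.image f, ?_⟩
    have := AddMonoidHom.map_closure (f : H →+* H).toAddMonoidHom (S : Set H)
    rw [hS] at this
    rw [Finset.coe_image]
    exact this.symm
  · have : ((O.map (f : H →+* H) : Subring H) : Set H) = f.toLinearMap '' (O : Set H) := rfl
    rw [this, Submodule.span_image, hO.2.2, Submodule.map_top, LinearMap.range_eq_top]
    exact f.surjective

lemma map_map_symm (O : Subring H) (f : H ≃ₐ[F] H) :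
    (O.map (f : H →+* H)).map (f.symm : H →+* H) = O := by
  ext y
  simp [Subring.mem_map]

lemma IsMaximalOrder.map {O : Subring H} (hO : IsMaximalOrder F O) (f : H ≃ₐ[F] H) :
    IsMaximalOrder F (O.map (f : H →+* H)) := by
  refine ⟨hO.1.map f, fun O' hO' hle => ?_⟩
  have h1 : O'.map (f.symm : H →+* H) = O := by
    apply hO.2 _ (hO'.map f.symm)
    intro y hy
    exact ⟨f y, hle ⟨y, hy, rfl⟩, by simp⟩
  rw [← h1]
  have := map_map_symm O' f.symm
  rw [AlgEquiv.symm_symm] at this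
  exact this.symm

lemma RedUnitIso.map {O : Subring H} {G : Type*} [Group G] (h : RedUnitIso F O G) (f : H ≃ₐ[F] H) :
    RedUnitIso F (O.map (f : H →+* H)) G := by
  obtain ⟨φ, hs, hker⟩ := h
  let g : O ≃+* O.map (f : H →+* H) := f.toRingEquiv.subringMap
  let g' : (↥(O.map (f : H →+* H)))ˣ ≃* (↥O)ˣ := Units.mapEquiv g.symm.toMulEquiv
  refine ⟨φ.comp g'.toMonoidHom, hs.comp g'.surjective, fun u => ?_⟩
  obtain ⟨v, rfl⟩ := g'.symm.surjective u
  have hv : ((g'.symm v : ↥(O.map (f : H →+* H))) : H) = f ((v : ↥O) : H) := rfl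
  simp only [MonoidHom.comp_apply, MulEquiv.coe_toMonoidHom, MulEquiv.apply_symm_apply]
  rw [hker]
  constructor
  · rintro ⟨r, hr⟩
    exact ⟨r, by rw [hv, hr, f.commutes]⟩
  · rintro ⟨r, hr⟩
    refine ⟨r, f.injective ?_⟩
    rw [← hv, hr, f.commutes]

lemma RedUnitIso.card_eq {O : Subring H} {G G' : Type*} [Group G] [Group G']
    (h : RedUnitIso F O G) (h' : RedUnitIso F O G') : Nat.card G = Nat.card G' := by
  obtain ⟨φ, hs, hker⟩ := h
  obtain ⟨ψ, hs', hker'⟩ := h'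
  have : φ.ker = ψ.ker := by
    ext u; rw [MonoidHom.mem_ker, MonoidHom.mem_ker, hker, hker']
  have h1 := Subgroup.index_ker φ
  have h2 := Subgroup.index_ker ψ
  rw [MonoidHom.range_eq_top.2 hs, Nat.card_congr Subgroup.topEquiv.toEquiv] at h1
  rw [MonoidHom.range_eq_top.2 hs', Nat.card_congr Subgroup.topEquiv.toEquiv] at h2
  rw [← h1, ← h2, this]

end Conjugation

section Skolem

variable {F}
variable {e : F} {σ₀ σ₁ : F →+* ℝ}

lemma stdPair_std : StdPair e (⟨0, 1, 0, 0⟩ : ℍ[F, -1, -e]) ⟨0, 0, 1, 0⟩ := by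
  constructor <;> ext <;> simp

lemma DefData.exists_conj_pair (h : DefData σ₀ σ₁ (-1) (-e) e) {I J : ℍ[F, -1, -e]}
    (hp : StdPair e I J) : ∃ x : ℍ[F, -1, -e]ˣ, (x : ℍ[F, -1, -e]) * ⟨0, 1, 0, 0⟩ = I * x ∧
      (x : ℍ[F, -1, -e]) * ⟨0, 0, 1, 0⟩ = J * x := by
  have hs := stdPair_std (e := e)
  have hi0 : (⟨0, 1, 0, 0⟩ : ℍ[F, -1, -e]) ≠ 0 := fun h0 => by
    simpa using congrArg QuaternionAlgebra.imI h0
  have hj0 : (⟨0, 0, 1, 0⟩ : ℍ[F, -1, -e]) ≠ 0 := fun h0 => by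
    simpa using congrArg QuaternionAlgebra.imJ h0
  have hcomm : ∀ y : ℍ[F, -1, -e], (e : ℍ[F, -1, -e]) * y = y * e := fun y =>
    Algebra.commutes e y
  have he0 : (e : ℍ[F, -1, -e]) ≠ 0 := fun h0 => h.ne_zero (by
    simpa using congrArg QuaternionAlgebra.re h0)
  generalize (⟨0, 1, 0, 0⟩ : ℍ[F, -1, -e]) = i at *
  generalize (⟨0, 0, 1, 0⟩ : ℍ[F, -1, -e]) = j at *
  obtain ⟨ii, jj, ij⟩ := hs
  obtain ⟨II, JJ, IJ⟩ := hp
  generalize (e : ℍ[F, -1, -e]) = E at *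
  obtain ⟨x, hx0, hx⟩ : ∃ x : ℍ[F, -1, -e], x ≠ 0 ∧ x * i = I * x := by
    by_cases h0 : 1 - I * i = 0
    · refine ⟨j, hj0, ?_⟩
      have : I = -i := by
        have := congrArg (· * i) (sub_eq_zero.1 h0)
        simp only [one_mul, mul_assoc, ii, mul_neg, mul_one] at this
        rw [this, neg_neg]
      rw [this, neg_mul, ij, neg_neg]
    · refine ⟨_, h0, ?_⟩
      rw [sub_mul, mul_sub, mul_assoc, ii, ← mul_assoc, II]
      noncomm_ring
  obtain ⟨X, rfl⟩ := h.isUnit hx0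
  obtain ⟨J', hJ'⟩ : ∃ J', J * X = X * J' := ⟨((X⁻¹ : ℍ[F, -1, -e]ˣ) : ℍ[F, -1, -e]) * J * X, by
    rw [mul_assoc, ← mul_assoc (X : ℍ[F, -1, -e])]; simp⟩
  have cancel : ∀ {y z}, (X : ℍ[F, -1, -e]) * y = X * z → y = z := fun h => X.mul_right_inj.1 h
  have JJ' : J' * J' = -E := cancel (by
    rw [← mul_assoc, ← hJ', mul_assoc, ← hJ', ← mul_assoc, JJ, neg_mul, mul_neg, hcomm])
  have IJ' : i * J' = -(J' * i) := cancel (by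
    rw [← mul_assoc, hx, mul_assoc, ← hJ', ← mul_assoc, IJ, mul_neg, ← mul_assoc, ← hJ',
      mul_assoc, hx, neg_mul, mul_assoc])
  obtain ⟨y, hy0, hy, hy'⟩ : ∃ y : ℍ[F, -1, -e], y ≠ 0 ∧ y * i = i * y ∧ y * j = J' * y := by
    by_cases h0 : E - J' * j = 0
    · refine ⟨i, hi0, rfl, ?_⟩
      have : J' = -j := by
        have := congrArg (· * j) (sub_eq_zero.1 h0)
        simp only [mul_assoc, jj, mul_neg] at this
        rw [← hcomm] at this
        have h2 : E * (J' + j) = 0 := by rw [mul_add, this]; abel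
        exact eq_neg_of_add_eq_zero_left ((h.eq_zero_or h2).resolve_left he0)
      rw [this, neg_mul, ij]
    · refine ⟨_, h0, ?_, ?_⟩
      · rw [sub_mul, mul_sub, hcomm, ← mul_assoc i, IJ', mul_assoc, neg_mul, mul_assoc, ij]
        noncomm_ring
      · rw [sub_mul, mul_sub, mul_assoc, jj, ← mul_assoc, JJ', mul_neg, ← hcomm J', neg_mul]
        noncomm_ring
  obtain ⟨Y, rfl⟩ := h.isUnit hy0
  refine ⟨X * Y, ?_, ?_⟩
  · rw [Units.val_mul, mul_assoc, hy, ← mul_assoc, hx, mul_assoc]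
  · rw [Units.val_mul, mul_assoc, hy', ← mul_assoc, ← hJ', mul_assoc]

end Skolem

section Dihedral

lemma nonempty_mulEquiv_dihedral {Q : Type*} [Group Q] {n : ℕ} {r s : Q} (hr : orderOf r = n)
    (hs : s * s = 1) (hsr : s * r * s * r = 1) (hsz : ∀ k : ℤ, s ≠ r ^ k)
    (hall : ∀ q : Q, ∃ k : ℕ, q = r ^ k ∨ q = s * r ^ k) :
    Nonempty (Q ≃* DihedralGroup n) := by
  have hrn : (zmultiplesHom (Additive Q) (Additive.ofMul r)) n = 0 := by
    rw [← hr, zmultiplesHom_apply, natCast_zsmul, ← ofMul_pow, pow_orderOf_eq_one, ofMul_one]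
  let ρ : ZMod n →+ Additive Q := ZMod.lift n ⟨zmultiplesHom (Additive Q) (Additive.ofMul r), hrn⟩
  let P : ZMod n → Q := fun i => (ρ i).toMul
  have hPz : ∀ k : ℤ, P (k : ZMod n) = r ^ k := fun k => by
    change (ρ (k : ZMod n)).toMul = _
    rw [ZMod.lift_coe]
    rfl
  have hP : ∀ i : ZMod n, ∃ k : ℤ, (k : ZMod n) = i := ZMod.intCast_surjective
  have hadd : ∀ i j, P (i + j) = P i * P j := fun i j => by
    change (ρ (i + j)).toMul = _
    rw [map_add]; rfl
  have hneg : ∀ i, P (-i) = (P i)⁻¹ := fun i => by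
    change (ρ (-i)).toMul = _
    rw [map_neg]; rfl
  have hsinv : s⁻¹ = s := inv_eq_of_mul_eq_one_right hs
  have hcomm : ∀ i, P i * s = s * P (-i) := fun i => by
    obtain ⟨k, rfl⟩ := hP i
    rw [hneg, hPz, ← inv_zpow]
    have h1 : SemiconjBy s r⁻¹ r := by
      have h2 : r * s * r = s⁻¹ := eq_inv_of_mul_eq_one_right (by rw [← hsr]; group)
      rw [SemiconjBy, mul_inv_eq_iff_eq_mul, h2, hsinv]
    exact (h1.zpow_right k).symm
  let f : DihedralGroup n →* Q := MonoidHom.mk' (fun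
      | .r i => P i
      | .sr i => s * P i) (by
    rintro (i | i) (j | j)
    · exact hadd i j
    · simp only [DihedralGroup.r_mul_sr]
      rw [← mul_assoc, hcomm, mul_assoc, ← hadd, neg_add_eq_sub]
    · simp only [DihedralGroup.sr_mul_r]
      rw [hadd, mul_assoc]
    · simp only [DihedralGroup.sr_mul_sr]
      rw [mul_assoc, ← mul_assoc (P i), hcomm, mul_assoc, ← hadd, ← mul_assoc, hs, one_mul,
        neg_add_eq_sub])
  have hinj : Function.Injective f := by
    rw [injective_iff_map_eq_one]
    rintro (i | i) h
    · change P i = 1 at h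
      obtain ⟨k, rfl⟩ := hP i
      rw [hPz, ← orderOf_dvd_iff_zpow_eq_one, hr] at h
      rw [(ZMod.intCast_zmod_eq_zero_iff_dvd _ _).2 h]
      rfl
    · change s * P i = 1 at h
      obtain ⟨k, rfl⟩ := hP i
      rw [hPz, mul_eq_one_iff_eq_inv, ← zpow_neg] at h
      exact absurd h (hsz _)
  have hsurj : Function.Surjective f := by
    intro q
    obtain ⟨k, rfl | rfl⟩ := hall q
    · refine ⟨.r k, ?_⟩
      change P k = _
      have := hPz k
      simpa using this
    · refine ⟨.sr k, ?_⟩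
      change s * P k = _
      have := hPz k
      simpa using this
  exact ⟨(MulEquiv.ofBijective f ⟨hinj, hsurj⟩).symm⟩

variable {F}
variable {A B e : F} {σ₀ σ₁ : F →+* ℝ}

/-- The subgroup of scalar units. -/
def scalarUnits {O : Subring ℍ[F, A, B]} (hO : IsOrder F O) : Subgroup (↥O)ˣ where
  carrier := {u | ∃ r : F, ((u : ↥O) : ℍ[F, A, B]) = (r : ℍ[F, A, B])}
  one_mem' := ⟨1, by simp⟩
  mul_mem' := by
    rintro u v ⟨r, hr⟩ ⟨s, hs⟩
    exact ⟨r * s, by rw [Units.val_mul, Subring.coe_mul, hr, hs, QuaternionAlgebra.coe_mul]⟩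
  inv_mem' := by
    rintro u hu
    obtain ⟨r, hr⟩ := (hO.isScalarUnit_iff u).2 hu
    refine ⟨algebraMap (𝓞 F) F ↑r⁻¹, ?_⟩
    have h1 : ((u⁻¹ : (↥O)ˣ) : ℍ[F, A, B]) * ((u : ↥O) : ℍ[F, A, B]) = 1 := by
      rw [← Subring.coe_mul, Units.inv_mul]; rfl
    have h2 : ((u : ↥O) : ℍ[F, A, B]) * ((algebraMap (𝓞 F) F ↑r⁻¹ : F) : ℍ[F, A, B]) = 1 := by
      rw [hr, algebraMap_eq_coe, ← QuaternionAlgebra.coe_mul, ← map_mul, Units.mul_inv, map_one]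
      rfl
    exact left_inv_eq_right_inv h1 h2

instance {O : Subring ℍ[F, A, B]} (hO : IsOrder F O) : (scalarUnits hO).Normal where
  conj_mem := by
    rintro u ⟨r, hr⟩ v
    refine ⟨r, ?_⟩
    have : v * u = u * v := by
      apply Units.ext
      apply Subtype.ext
      change ((v : ↥O) : ℍ[F, A, B]) * ((u : ↥O) : ℍ[F, A, B]) = _ * _
      rw [hr]
      exact (Algebra.commutes r _).symm
    rw [this, mul_inv_cancel_right, hr]

lemma redUnitIso_of_quotient {O : Subring ℍ[F, A, B]} (hO : IsOrder F O) {G : Type*} [Group G]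
    (f : (↥O)ˣ ⧸ scalarUnits hO ≃* G) : RedUnitIso F O G := by
  refine ⟨f.toMonoidHom.comp (QuotientGroup.mk' _),
    f.surjective.comp (QuotientGroup.mk'_surjective _), fun u => ?_⟩
  rw [hO.isScalarUnit_iff, MonoidHom.comp_apply, MulEquiv.coe_toMonoidHom,
    EmbeddingLike.map_eq_one_iff, QuotientGroup.mk'_apply, QuotientGroup.eq_one_iff]
  rfl

lemma redUnitIso_dihedral {O : Subring ℍ[F, A, B]} (hO : IsOrder F O) {n : ℕ} (hn : 0 < n)
    {r s : (↥O)ˣ} (hrn : ∃ c : F, ((r : ↥O) : ℍ[F, A, B]) ^ n = c)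
    (hrp : ∀ p : ℕ, p.Prime → p ∣ n → ∀ c : F, ((r : ↥O) : ℍ[F, A, B]) ^ (n / p) ≠ c)
    (hs : ∃ c : F, ((s : ↥O) : ℍ[F, A, B]) * s = c)
    (hsr : ∃ c : F, ((s : ↥O) : ℍ[F, A, B]) * r * s * r = c)
    {w : ℍ[F, A, B]} (hw : ((r : ↥O) : ℍ[F, A, B]) * w = w * r)
    (hw' : ((s : ↥O) : ℍ[F, A, B]) * w ≠ w * s)
    (hall : ∀ u : (↥O)ˣ, ∃ (k : ℕ) (c : F), ((u : ↥O) : ℍ[F, A, B]) =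
      c * ((r : ↥O) : ℍ[F, A, B]) ^ k ∨
      ((u : ↥O) : ℍ[F, A, B]) = c * (((s : ↥O) : ℍ[F, A, B]) * ((r : ↥O) : ℍ[F, A, B]) ^ k)) :
    RedUnitIso F O (DihedralGroup n) := by
  have key : ∀ (u v : (↥O)ˣ) (c : F), ((u : ↥O) : ℍ[F, A, B]) = c * ((v : ↥O) : ℍ[F, A, B]) →
      (u : (↥O)ˣ ⧸ scalarUnits hO) = v := by
    intro u v c h
    refine (QuotientGroup.eq.2 ?_).symm
    refine ⟨c, ?_⟩
    change (((v⁻¹ : (↥O)ˣ) : ↥O) : ℍ[F, A, B]) * ((u : ↥O) : ℍ[F, A, B]) = c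
    rw [h]
    have : (c : ℍ[F, A, B]) * v = v * c := Algebra.commutes c _
    rw [this, ← mul_assoc, ← Subring.coe_mul, Units.inv_mul]
    simp
  have h1 : orderOf (r : (↥O)ˣ ⧸ scalarUnits hO) = n := by
    apply orderOf_eq_of_pow_and_pow_div_prime hn
    · rw [← QuotientGroup.mk_pow, QuotientGroup.eq_one_iff]
      exact hrn
    · intro p hp hpn
      rw [← QuotientGroup.mk_pow, Ne, QuotientGroup.eq_one_iff]
      rintro ⟨c, hc⟩
      exact hrp p hp hpn c hc
  have h2 : (s : (↥O)ˣ ⧸ scalarUnits hO) * s = 1 := by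
    rw [← QuotientGroup.mk_mul, QuotientGroup.eq_one_iff]
    exact hs
  have h3 : (s : (↥O)ˣ ⧸ scalarUnits hO) * r * s * r = 1 := by
    rw [← QuotientGroup.mk_mul, ← QuotientGroup.mk_mul, ← QuotientGroup.mk_mul,
      QuotientGroup.eq_one_iff]
    exact hsr
  have h4 : ∀ k : ℤ, (s : (↥O)ˣ ⧸ scalarUnits hO) ≠ (r : (↥O)ˣ ⧸ scalarUnits hO) ^ k := by
    intro k hk
    rw [← QuotientGroup.mk_zpow, QuotientGroup.eq] at hk
    let C : Subgroup (↥O)ˣ :=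
      { carrier := {u | Commute ((u : ↥O) : ℍ[F, A, B]) w}
        one_mem' := Commute.one_left w
        mul_mem' := fun hu hv => Commute.mul_left hu hv
        inv_mem' := fun {u} hu => Commute.units_inv_left
          (u := Units.map (O.subtype : O →* ℍ[F, A, B]) u) hu }
    have hsub : ∀ u ∈ scalarUnits hO, u ∈ C := by
      rintro u ⟨c, hc⟩
      change ((u : ↥O) : ℍ[F, A, B]) * w = w * u
      rw [hc]
      exact Algebra.commutes c w
    have hr : r ∈ C := hw
    have hsC : s ∈ C := by
      have := C.mul_mem (C.zpow_mem hr k) (C.inv_mem (hsub _ hk))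
      simpa using this
    exact hw' hsC
  have h5 : ∀ q : (↥O)ˣ ⧸ scalarUnits hO, ∃ k : ℕ, q = (r : (↥O)ˣ ⧸ scalarUnits hO) ^ k ∨
      q = s * (r : (↥O)ˣ ⧸ scalarUnits hO) ^ k := by
    intro q
    obtain ⟨u, rfl⟩ := QuotientGroup.mk_surjective q
    obtain ⟨k, c, h | h⟩ := hall u
    · exact ⟨k, Or.inl (by rw [← QuotientGroup.mk_pow]; exact key _ _ c h)⟩
    · exact ⟨k, Or.inr (by rw [← QuotientGroup.mk_pow, ← QuotientGroup.mk_mul]; exact key _ _ c h)⟩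
  obtain ⟨f⟩ := nonempty_mulEquiv_dihedral h1 h2 h3 h4 h5
  exact redUnitIso_of_quotient hO f

end Dihedral

section Classification

variable {F}
variable {e : F} {σ₀ σ₁ : F →+* ℝ}

lemma mk_mul (a b c d a' b' c' d' : F) : (⟨a, b, c, d⟩ : ℍ[F, -1, -e]) * ⟨a', b', c', d'⟩ =
    ⟨a * a' - b * b' - e * (c * c' + d * d'), a * b' + b * a' + e * (c * d' - d * c'),
      a * c' + c * a' - b * d' + d * b', a * d' + d * a' + b * c' - c * b'⟩ := by
  ext <;> simp <;> ring

lemma redNorm_mk (a b c d : F) : redNorm F (⟨a, b, c, d⟩ : ℍ[F, -1, -e]) =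
    a ^ 2 + b ^ 2 + e * (c ^ 2 + d ^ 2) := by
  rw [redNorm_eq]; ring

lemma star_mk (a b c d : F) : star (⟨a, b, c, d⟩ : ℍ[F, -1, -e]) = ⟨a, -b, -c, -d⟩ := by
  ext <;> simp

lemma neg_mk (a b c d : F) : -(⟨a, b, c, d⟩ : ℍ[F, -1, -e]) = ⟨-a, -b, -c, -d⟩ := by
  ext <;> simp

lemma k_mem {O : Subring ℍ[F, -1, -e]} (hi : ⟨0, 1, 0, 0⟩ ∈ O) (hj : ⟨0, 0, 1, 0⟩ ∈ O) :
    ⟨0, 0, 0, 1⟩ ∈ O := by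
  have := O.mul_mem hi hj
  rw [mk_mul] at this
  simpa using this

lemma sq_add_sq_eq_zero (σ₀ : F →+* ℝ) {c d : F}
    (hcd : c ^ 2 + d ^ 2 = 0) : c = 0 ∧ d = 0 := by
  have h1 := congrArg σ₀ hcd
  rw [map_add, map_pow, map_pow, map_zero] at h1
  have hc : σ₀ c ^ 2 = 0 := by nlinarith [sq_nonneg (σ₀ c), sq_nonneg (σ₀ d)]
  have hd : σ₀ d ^ 2 = 0 := by nlinarith [sq_nonneg (σ₀ c), sq_nonneg (σ₀ d)]
  exact ⟨by simpa using hc, by simpa using hd⟩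

lemma DefData.trace_cases (h : DefData σ₀ σ₁ (-1) (-e) e) {O : Subring ℍ[F, -1, -e]}
    (hO : IsOrder F O) {a b c d : F} (hx : ⟨a, b, c, d⟩ ∈ O)
    (hn : a ^ 2 + b ^ 2 + e * (c ^ 2 + d ^ 2) = e) :
    a = 0 ∨ (2 * a) ^ 2 = 2 * e ∨ (2 * a) ^ 2 = 3 * e :=
  h.trace_norm_e hO hx (by rw [redNorm_mk, hn])

lemma DefData.exists_t (h : DefData σ₀ σ₁ (-1) (-e) e) {O : Subring ℍ[F, -1, -e]}
    (hO : IsOrder F O) (hi : ⟨0, 1, 0, 0⟩ ∈ O) (hj : ⟨0, 0, 1, 0⟩ ∈ O) {c d : F}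
    (hx : ⟨0, 0, c, d⟩ ∈ O) (hn : e * (c ^ 2 + d ^ 2) = 1) :
    ∃ p : F, 2 * p ^ 2 = e ∧ (⟨p, p, 0, 0⟩ : ℍ[F, -1, -e]) ∈ O := by
  have he := h.ne_zero
  have h1 : (⟨-(e * c), -(e * d), 0, 0⟩ : ℍ[F, -1, -e]) ∈ O := by
    have := O.mul_mem hx hj
    rw [mk_mul] at this
    convert this using 2 <;> ring
  have h2 : (⟨e * d, -(e * c), 0, 0⟩ : ℍ[F, -1, -e]) ∈ O := by
    have := O.mul_mem h1 hi
    rw [mk_mul] at this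
    convert this using 2 <;> ring
  have c1 := h.trace_cases hO h1 (by linear_combination e * hn)
  have c2 := h.trace_cases hO h2 (by linear_combination e * hn)
  have hs : (2 * (-(e * c))) ^ 2 + (2 * (e * d)) ^ 2 = 4 * e := by linear_combination 4 * e * hn
  have z1 : -(e * c) = 0 → (2 * (-(e * c))) ^ 2 = 0 := fun h => by rw [h]; ring
  have z2 : e * d = 0 → (2 * (e * d)) ^ 2 = 0 := fun h => by rw [h]; ring
  have hfin : (2 * (-(e * c))) ^ 2 = 2 * e ∧ (2 * (e * d)) ^ 2 = 2 * e := by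
    have n1 : e ≠ 0 := he
    rcases c1 with c1 | c1 | c1 <;> rcases c2 with c2 | c2 | c2
    · exact absurd (by linear_combination -hs + z1 c1 + z2 c2 : 4 * e = 0) (by simpa using he)
    · exact absurd (by linear_combination -hs + z1 c1 + c2 : 2 * e = 0) (by simpa using he)
    · exact absurd (by linear_combination -hs + z1 c1 + c2) he
    · exact absurd (by linear_combination -hs + c1 + z2 c2 : 2 * e = 0) (by simpa using he)
    · exact ⟨c1, c2⟩
    · exact absurd (by linear_combination hs - c1 - c2) he
    · exact absurd (by linear_combination -hs + c1 + z2 c2) he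
    · exact absurd (by linear_combination hs - c1 - c2) he
    · exact absurd (by linear_combination hs - c1 - c2 : 2 * e = 0) (by simpa using he)
  have hp : 2 * (-(e * c)) ^ 2 = e := by linear_combination hfin.1 / 2
  have hcd : (d - c) * (d + c) = 0 := by
    have : e ^ 2 * ((d - c) * (d + c)) = 0 := by linear_combination hfin.2 / 4 - hfin.1 / 4
    exact (mul_eq_zero.1 this).resolve_left (pow_ne_zero 2 he)
  refine ⟨_, hp, ?_⟩
  rcases mul_eq_zero.1 hcd with h3 | h3
  · rw [sub_eq_zero.1 h3] at h1
    exact h1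
  · have := hO.star_mem h1
    rw [star_mk, eq_neg_of_add_eq_zero_left h3] at this
    convert this using 2 <;> ring

/-- Coordinates of an element of norm one. -/
lemma DefData.norm_one_coords (h : DefData σ₀ σ₁ (-1) (-e) e) {O : Subring ℍ[F, -1, -e]}
    (hO : IsOrder F O) (hi : ⟨0, 1, 0, 0⟩ ∈ O) {a b c d : F}
    (hx : ⟨a, b, c, d⟩ ∈ O) (hn : a ^ 2 + b ^ 2 + e * (c ^ 2 + d ^ 2) = 1) :
    ∃ m n : ℤ, 2 * a = m ∧ 2 * b = n ∧ m ^ 2 + n ^ 2 ≤ 4 ∧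
      (m ^ 2 + n ^ 2 = 4 → c = 0 ∧ d = 0) := by
  obtain ⟨m, hm, -⟩ := h.trace_norm_one hO hx (by rw [redNorm_mk, hn])
  have h2 : (⟨b, -a, -d, c⟩ : ℍ[F, -1, -e]) ∈ O := by
    have := O.neg_mem (O.mul_mem hx hi)
    rw [mk_mul, neg_mk] at this
    convert this using 2 <;> ring
  obtain ⟨n, hb, -⟩ := h.trace_norm_one hO h2 (by rw [redNorm_mk]; linear_combination hn)
  refine ⟨m, n, hm, hb, ?_, fun h4 => ?_⟩
  · have h3 : (m : F) ^ 2 + (n : F) ^ 2 + 4 * e * (c ^ 2 + d ^ 2) = 4 := by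
      rw [← hm, ← hb]; linear_combination 4 * hn
    have := congrArg σ₀ h3
    simp only [map_add, map_mul, map_pow, map_intCast, map_ofNat] at this
    have h5 : 0 ≤ 4 * σ₀ e * (σ₀ c ^ 2 + σ₀ d ^ 2) :=
      mul_nonneg (by linarith [h.pos₀]) (by positivity)
    have : (m : ℝ) ^ 2 + (n : ℝ) ^ 2 ≤ 4 := by linarith
    exact_mod_cast this
  · have h4' : (m : F) ^ 2 + (n : F) ^ 2 = 4 := by exact_mod_cast h4
    rw [← hm, ← hb] at h4'
    apply sq_add_sq_eq_zero σ₀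
    have : e * (c ^ 2 + d ^ 2) = 0 := by linear_combination hn - h4' / 4
    exact (mul_eq_zero.1 this).resolve_left h.ne_zero

lemma int_sq_add_sq_le {m n : ℤ} (h : m ^ 2 + n ^ 2 ≤ 4) :
    (m = 0 ∧ n = 0) ∨ ((m = 1 ∨ m = -1) ∧ n = 0) ∨ (m = 0 ∧ (n = 1 ∨ n = -1)) ∨
      ((m = 1 ∨ m = -1) ∧ (n = 1 ∨ n = -1)) ∨ ((m = 2 ∨ m = -2) ∧ n = 0) ∨
      (m = 0 ∧ (n = 2 ∨ n = -2)) := by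
  have h1 : -2 ≤ m := by nlinarith [sq_nonneg n]
  have h2 : m ≤ 2 := by nlinarith [sq_nonneg n]
  have h3 : -2 ≤ n := by nlinarith [sq_nonneg m]
  have h4 : n ≤ 2 := by nlinarith [sq_nonneg m]
  interval_cases m <;> interval_cases n <;> simp_all

/-- The three kinds of orders containing `i` and `j`. -/
lemma DefData.trichotomy (h : DefData σ₀ σ₁ (-1) (-e) e) {O : Subring ℍ[F, -1, -e]}
    (hO : IsOrder F O) (hi : ⟨0, 1, 0, 0⟩ ∈ O) (hj : ⟨0, 0, 1, 0⟩ ∈ O) :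
    (∃ p : F, 2 * p ^ 2 = e ∧ (⟨p, p, 0, 0⟩ : ℍ[F, -1, -e]) ∈ O) ∨
    (∃ c : F, 4 * e * c ^ 2 = 3 ∧ ((⟨1 / 2, 0, c, 0⟩ : ℍ[F, -1, -e]) ∈ O ∨
      (⟨1 / 2, 0, 0, c⟩ : ℍ[F, -1, -e]) ∈ O)) ∨
    (∀ x ∈ O, redNorm F x = 1 → x = 1 ∨ x = -1 ∨ x = ⟨0, 1, 0, 0⟩ ∨ x = -⟨0, 1, 0, 0⟩) := by
  have he := h.ne_zero
  have hB : ∀ c d : F, (⟨1 / 2, 0, c, d⟩ : ℍ[F, -1, -e]) ∈ O → e * (c ^ 2 + d ^ 2) = 3 / 4 →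
      ∃ c : F, 4 * e * c ^ 2 = 3 ∧ ((⟨1 / 2, 0, c, 0⟩ : ℍ[F, -1, -e]) ∈ O ∨
        (⟨1 / 2, 0, 0, c⟩ : ℍ[F, -1, -e]) ∈ O) := by
    intro c d hx hn
    have h1 : (⟨-(e * c), -(e * d), 1 / 2, 0⟩ : ℍ[F, -1, -e]) ∈ O := by
      have := O.mul_mem hx hj
      rw [mk_mul] at this
      convert this using 2 <;> ring
    have h2 : (⟨-(e * d), e * c, 0, 1 / 2⟩ : ℍ[F, -1, -e]) ∈ O := by
      have := O.mul_mem hx (k_mem hi hj)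
      rw [mk_mul] at this
      convert this using 2 <;> ring
    have c1 := h.trace_cases hO h1 (by linear_combination e * hn)
    have c2 := h.trace_cases hO h2 (by linear_combination e * hn)
    have hs : (2 * (-(e * c))) ^ 2 + (2 * (-(e * d))) ^ 2 = 3 * e := by
      linear_combination 4 * e * hn
    have z1 : -(e * c) = 0 → (2 * (-(e * c))) ^ 2 = 0 := fun h => by rw [h]; ring
    have z2 : -(e * d) = 0 → (2 * (-(e * d))) ^ 2 = 0 := fun h => by rw [h]; ring
    rcases c1 with c1 | c1 | c1 <;> rcases c2 with c2 | c2 | c2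
    · exact absurd (by linear_combination -hs + z1 c1 + z2 c2 : 3 * e = 0) (by simpa using he)
    · exact absurd (by linear_combination z1 c1 + c2 - hs) he
    · have : c = 0 := by simpa [he] using c1
      subst this
      refine ⟨d, ?_, Or.inr hx⟩
      linear_combination 4 * hn
    · exact absurd (by linear_combination c1 + z2 c2 - hs) he
    · exact absurd (by linear_combination hs - c1 - c2) he
    · exact absurd (by linear_combination hs - c1 - c2 : 2 * e = 0) (by simpa using he)
    · have : d = 0 := by simpa [he] using c2
      subst this
      refine ⟨c, ?_, Or.inl hx⟩
      linear_combination 4 * hn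
    · exact absurd (by linear_combination hs - c1 - c2 : 2 * e = 0) (by simpa using he)
    · exact absurd (by linear_combination hs - c1 - c2 : 3 * e = 0) (by simpa using he)
  by_contra! hcon
  obtain ⟨hT, hB', ⟨⟨a, b, c, d⟩, hx, hn, x1, x2, x3, x4⟩⟩ := hcon
  rw [redNorm_mk] at hn
  have hB'' : ∀ c d : F, (⟨1 / 2, 0, c, d⟩ : ℍ[F, -1, -e]) ∈ O → e * (c ^ 2 + d ^ 2) ≠ 3 / 4 := by
    intro c d hx hn
    obtain ⟨c, hc, h1⟩ := hB c d hx hn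
    have := hB' c hc
    tauto
  have hT' : ∀ c d : F, (⟨0, 0, c, d⟩ : ℍ[F, -1, -e]) ∈ O → e * (c ^ 2 + d ^ 2) ≠ 1 := by
    intro c d hx hn
    obtain ⟨p, hp, h1⟩ := h.exists_t hO hi hj hx hn
    exact hT p hp h1
  obtain ⟨m, n, hm, hn', hle, hz⟩ := h.norm_one_coords hO hi hx hn
  have hxi : (⟨b, -a, -d, c⟩ : ℍ[F, -1, -e]) ∈ O := by
    have := O.neg_mem (O.mul_mem hx hi)
    rw [mk_mul, neg_mk] at this
    convert this using 2 <;> ring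
  have hxn := O.neg_mem hx
  have hxin := O.neg_mem hxi
  rw [neg_mk] at hxn hxin
  have half : ∀ {z : F} {k : ℤ}, 2 * z = k → z = k / 2 := fun h => by rw [← h]; ring
  replace hm := half hm
  replace hn' := half hn'
  rcases int_sq_add_sq_le hle with ⟨rfl, rfl⟩ | ⟨rfl | rfl, rfl⟩ | ⟨rfl, rfl | rfl⟩ |
    ⟨hm1, hn1⟩ | ⟨rfl | rfl, rfl⟩ | ⟨rfl, rfl | rfl⟩
  · norm_num at hm hn'; subst hm hn'
    exact hT' c d hx (by linear_combination hn)
  · norm_num at hm hn'; subst hm hn'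
    exact hB'' _ _ hx (by linear_combination hn)
  · norm_num at hm hn'; subst hm hn'
    exact hB'' (-c) (-d) (by convert hxn using 2 <;> ring) (by linear_combination hn)
  · norm_num at hm hn'; subst hm hn'
    exact hB'' (-d) c (by convert hxi using 2; ring) (by linear_combination hn)
  · norm_num at hm hn'; subst hm hn'
    exact hB'' d (-c) (by convert hxin using 2 <;> ring) (by linear_combination hn)
  · have ha : a ^ 2 = 1 / 4 := by
      rcases hm1 with rfl | rfl <;> rw [hm] <;> norm_num
    have hb : b ^ 2 = 1 / 4 := by
      rcases hn1 with rfl | rfl <;> rw [hn'] <;> norm_num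
    have hy := O.mul_mem (O.mul_mem hx hi) (hO.star_mem hx)
    rw [mk_mul, star_mk, mk_mul] at hy
    refine hT' (2 * (a * d + b * c)) (2 * (b * d - a * c)) ?_ ?_
    · convert hy using 2
      · ring
      · linear_combination hn - 2 * ha - 2 * hb
      · ring
      · ring
    · have h3 : e * (c ^ 2 + d ^ 2) = 1 / 2 := by linear_combination hn - ha - hb
      linear_combination 4 * (a ^ 2 + b ^ 2) * h3 + 2 * ha + 2 * hb
  · obtain ⟨rfl, rfl⟩ := hz (by norm_num)
    norm_num at hm hn'; subst hm hn'
    exact x1 rfl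
  · obtain ⟨rfl, rfl⟩ := hz (by norm_num)
    norm_num at hm hn'; subst hm hn'
    exact x2 (by ext <;> simp)
  · obtain ⟨rfl, rfl⟩ := hz (by norm_num)
    norm_num at hm hn'; subst hm hn'
    exact x3 rfl
  · obtain ⟨rfl, rfl⟩ := hz (by norm_num)
    norm_num at hm hn'; subst hm hn'
    exact x4 (by ext <;> simp)

end Classification

section UnitGroups

variable {F}
variable {e : F} {σ₀ σ₁ : F →+* ℝ}

lemma DefData.unit_cases_of (h : DefData σ₀ σ₁ (-1) (-e) e) {O : Subring ℍ[F, -1, -e]}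
    (hO : IsOrder F O) {t : ℍ[F, -1, -e]} (ht : t ∈ O) (hn : redNorm F t = e) (u : (↥O)ˣ) :
    ∃ (c : F) (x : ℍ[F, -1, -e]), x ∈ O ∧ redNorm F x = 1 ∧
      (((u : ↥O) : ℍ[F, -1, -e]) = c * x ∨ ((u : ↥O) : ℍ[F, -1, -e]) = c * (x * t)) := by
  have he := h.ne_zero
  obtain ⟨l, x, hx, hu, hx1 | hxe⟩ := h.unit_cases hO u
  · exact ⟨_, x, hx, hx1, Or.inl (by rw [hu, QuaternionAlgebra.coe_mul_eq_smul])⟩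
  · refine ⟨algebraMap (𝓞 F) F l, e⁻¹ • (x * star t),
      h.inv_smul_mem hO (O.mul_mem hx (hO.star_mem ht)), ?_, Or.inr ?_⟩
    · have : redNorm F (star t) = redNorm F t := by simp [redNorm_eq]
      rw [redNorm_smul, redNorm_mul, hxe, this, hn]
      field_simp
    · rw [hu, QuaternionAlgebra.coe_mul_eq_smul, smul_mul_assoc, mul_assoc, star_mul_eq, hn,
        QuaternionAlgebra.mul_coe_eq_smul, smul_smul e⁻¹, inv_mul_cancel₀ he, one_smul]

lemma DefData.exists_unit_of_norm (h : DefData σ₀ σ₁ (-1) (-e) e) {O : Subring ℍ[F, -1, -e]}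
    (hO : IsOrder F O) {x : ℍ[F, -1, -e]} (hx : x ∈ O) (hn : redNorm F x = 1 ∨ redNorm F x = e) :
    ∃ u : (↥O)ˣ, ((u : ↥O) : ℍ[F, -1, -e]) = x := by
  rcases hn with hn | hn
  · exact hO.exists_unit hx 1 (by rw [hn]; simp)
  · obtain ⟨v, hv⟩ := h.unit
    exact hO.exists_unit hx v (by rw [hn, hv])

lemma mk_ne_coe {a b c d : F} (hne : b ≠ 0 ∨ c ≠ 0 ∨ d ≠ 0) (r : F) :
    (⟨a, b, c, d⟩ : ℍ[F, -1, -e]) ≠ r := by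
  intro h
  have h1 := congrArg QuaternionAlgebra.imI h
  have h2 := congrArg QuaternionAlgebra.imJ h
  have h3 := congrArg QuaternionAlgebra.imK h
  simp at h1 h2 h3
  tauto

lemma mk_eq_coe (a : F) : (⟨a, 0, 0, 0⟩ : ℍ[F, -1, -e]) = a := rfl

lemma coe_mul_mk (r a b c d : F) : (r : ℍ[F, -1, -e]) * ⟨a, b, c, d⟩ =
    ⟨r * a, r * b, r * c, r * d⟩ := by
  rw [QuaternionAlgebra.coe_mul_eq_smul]; ext <;> simp

/-- A criterion for the reduced unit group of an order to be dihedral, where `t` has norm `e`. -/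
lemma DefData.redUnitIso_dihedral (h : DefData σ₀ σ₁ (-1) (-e) e) {O : Subring ℍ[F, -1, -e]}
    (hO : IsOrder F O) {n : ℕ} (hn : 0 < n) {r s : ℍ[F, -1, -e]} (hr : r ∈ O) (hs : s ∈ O)
    (nr : redNorm F r = 1 ∨ redNorm F r = e) (ns : redNorm F s = 1 ∨ redNorm F s = e)
    (hrn : ∃ c : F, r ^ n = c)
    (hrp : ∀ p : ℕ, p.Prime → p ∣ n → ∀ c : F, r ^ (n / p) ≠ c)
    (hss : ∃ c : F, s * s = c) (hsr : ∃ c : F, s * r * s * r = c)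
    {w : ℍ[F, -1, -e]} (hw : r * w = w * r) (hw' : s * w ≠ w * s)
    {t : ℍ[F, -1, -e]} (ht : t ∈ O) (nt : redNorm F t = e)
    (hall : ∀ x ∈ O, redNorm F x = 1 → ∃ (k : ℕ) (c : F),
      (x = c * r ^ k ∨ x = c * (s * r ^ k)))
    (hallt : ∀ x ∈ O, redNorm F x = 1 → ∃ (k : ℕ) (c : F),
      (x * t = c * r ^ k ∨ x * t = c * (s * r ^ k))) :
    RedUnitIso F O (DihedralGroup n) := by
  obtain ⟨r, rfl⟩ := h.exists_unit_of_norm hO hr nr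
  obtain ⟨s, rfl⟩ := h.exists_unit_of_norm hO hs ns
  refine QuatPaper.redUnitIso_dihedral hO hn hrn hrp hss hsr hw hw' fun u => ?_
  obtain ⟨c, x, hx, nx, hu | hu⟩ := h.unit_cases_of hO ht nt u
  · obtain ⟨k, c', h' | h'⟩ := hall x hx nx
    · exact ⟨k, c * c', Or.inl (by rw [hu, h', QuaternionAlgebra.coe_mul, mul_assoc])⟩
    · exact ⟨k, c * c', Or.inr (by rw [hu, h', QuaternionAlgebra.coe_mul, mul_assoc])⟩
  · obtain ⟨k, c', h' | h'⟩ := hallt x hx nx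
    · exact ⟨k, c * c', Or.inl (by rw [hu, h', QuaternionAlgebra.coe_mul, mul_assoc])⟩
    · exact ⟨k, c * c', Or.inr (by rw [hu, h', QuaternionAlgebra.coe_mul, mul_assoc])⟩

lemma DefData.redUnitIso_two (h : DefData σ₀ σ₁ (-1) (-e) e) {O : Subring ℍ[F, -1, -e]}
    (hO : IsOrder F O) (hi : ⟨0, 1, 0, 0⟩ ∈ O) (hj : ⟨0, 0, 1, 0⟩ ∈ O)
    (hN : ∀ x ∈ O, redNorm F x = 1 → x = 1 ∨ x = -1 ∨ x = ⟨0, 1, 0, 0⟩ ∨ x = -⟨0, 1, 0, 0⟩) :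
    RedUnitIso F O (DihedralGroup 2) := by
  refine h.redUnitIso_dihedral hO (by norm_num) hi hj (Or.inl (by rw [redNorm_mk]; ring))
    (Or.inr (by rw [redNorm_mk]; ring)) ⟨-1, ?_⟩ ?_ ⟨-e, ?_⟩ ⟨-e, ?_⟩ (w := ⟨0, 1, 0, 0⟩) rfl ?_
    hj (by rw [redNorm_mk]; ring) ?_ ?_
  · rw [sq, mk_mul, ← mk_eq_coe]; congr 1 <;> ring
  · intro p hp hp2 c
    rw [(Nat.prime_dvd_prime_iff_eq hp Nat.prime_two).1 hp2, Nat.div_self (by norm_num), pow_one]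
    exact mk_ne_coe (by simp) c
  · rw [mk_mul, ← mk_eq_coe]; congr 1 <;> ring
  · rw [mk_mul, mk_mul, mk_mul, ← mk_eq_coe]; congr 1 <;> ring
  · rw [mk_mul, mk_mul]
    intro h1
    have := congrArg QuaternionAlgebra.imK h1
    norm_num at this
  · intro x hx hn
    rcases hN x hx hn with rfl | rfl | rfl | rfl
    · exact ⟨0, 1, Or.inl (by simp)⟩
    · exact ⟨0, -1, Or.inl (by simp)⟩
    · exact ⟨1, 1, Or.inl (by simp)⟩
    · exact ⟨1, -1, Or.inl (by rw [pow_one, neg_mk, coe_mul_mk]; congr 1 <;> ring)⟩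
  · intro x hx hn
    have hij : (⟨0, 1, 0, 0⟩ : ℍ[F, -1, -e]) * ⟨0, 0, 1, 0⟩ = ⟨0, 0, 0, 1⟩ := by
      rw [mk_mul]; congr 1 <;> ring
    have hji : (⟨0, 0, 1, 0⟩ : ℍ[F, -1, -e]) * ⟨0, 1, 0, 0⟩ ^ 1 = ⟨0, 0, 0, -1⟩ := by
      rw [pow_one, mk_mul]; congr 1 <;> ring
    rcases hN x hx hn with rfl | rfl | rfl | rfl
    · exact ⟨0, 1, Or.inr (by simp)⟩
    · exact ⟨0, -1, Or.inr (by simp)⟩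
    · exact ⟨1, -1, Or.inr (by rw [hij, hji, coe_mul_mk]; congr 1 <;> ring)⟩
    · exact ⟨1, 1, Or.inr (by rw [neg_mul, hij, hji, neg_mk, coe_mul_mk]; congr 1 <;> ring)⟩

lemma DefData.second_kind_of_redUnitIso (h : DefData σ₀ σ₁ (-1) (-e) e)
    {O : Subring ℍ[F, -1, -e]} (hO : IsOrder F O) (hj : ⟨0, 0, 1, 0⟩ ∈ O) {n : ℕ}
    (hD : RedUnitIso F O (DihedralGroup n)) : RedUnitDihedralSecondKind F n O := by
  obtain ⟨φ, hs, hker⟩ := hD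
  obtain ⟨u, hu⟩ := h.exists_unit_of_norm hO hj (Or.inr (by rw [redNorm_mk]; ring))
  refine ⟨φ, hs, hker, u, ?_, ?_, ?_⟩
  · rw [Ne, hker, hO.isScalarUnit_iff, hu]
    rintro ⟨r, hr⟩
    exact mk_ne_coe (by simp) r hr
  · rw [← map_mul, hker, hO.isScalarUnit_iff]
    refine ⟨-e, ?_⟩
    rw [Units.val_mul, Subring.coe_mul, hu, mk_mul, ← mk_eq_coe]; congr 1 <;> ring
  · intro v hv r hr
    have h1 : φ (u⁻¹ * v) = 1 := by rw [map_mul, hv, map_inv, inv_mul_cancel]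
    rw [hker, hO.isScalarUnit_iff] at h1
    obtain ⟨c, hc⟩ := h1
    have h2 : ((v : ↥O) : ℍ[F, -1, -e]) = ((u : ↥O) : ℍ[F, -1, -e]) * c := by
      rw [← hc, ← Subring.coe_mul, ← Units.val_mul, mul_inv_cancel_left]
    rw [h2, hu, redNorm_mul, redNorm_mk, redNorm_coe] at hr
    have hc0 : c ≠ 0 := by
      rintro rfl
      have : algebraMap (𝓞 F) F r ^ 2 = 0 := by rw [← hr]; ring
      exact r.ne_zero (FaithfulSMul.algebraMap_injective (𝓞 F) F (by
        rw [map_zero]; simp at this))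
    apply h.not_sq (algebraMap (𝓞 F) F r / c)
    rw [div_pow, ← hr]
    field_simp
    ring

end UnitGroups

section HexagonalUnitGroup

variable {F}
variable {e : F} {σ₀ σ₁ : F →+* ℝ}

lemma sq_sum_eq_twelve {m n M N : ℤ} (hle : m ^ 2 + n ^ 2 ≤ 4)
    (hsum : 3 * m ^ 2 + 3 * n ^ 2 + (m - 2 * M) ^ 2 + (-n - 2 * N) ^ 2 = 12) :
    m ^ 2 + n ^ 2 = 4 ∨
    ((m = 1 ∨ m = -1) ∧ n = 0 ∧ (m - 2 * M = 3 ∨ m - 2 * M = -3) ∧ -n - 2 * N = 0) ∨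
    (m = 0 ∧ (n = 1 ∨ n = -1) ∧ m - 2 * M = 0 ∧ (-n - 2 * N = 3 ∨ -n - 2 * N = -3)) := by
  have h1 : -3 ≤ m - 2 * M := by nlinarith [sq_nonneg m, sq_nonneg n, sq_nonneg (-n - 2 * N)]
  have h2 : m - 2 * M ≤ 3 := by nlinarith [sq_nonneg m, sq_nonneg n, sq_nonneg (-n - 2 * N)]
  have h3 : -3 ≤ -n - 2 * N := by nlinarith [sq_nonneg m, sq_nonneg n, sq_nonneg (m - 2 * M)]
  have h4 : -n - 2 * N ≤ 3 := by nlinarith [sq_nonneg m, sq_nonneg n, sq_nonneg (m - 2 * M)]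
  have h5 : (m - 2 * M) % 2 = m % 2 := by omega
  have h6 : (-n - 2 * N) % 2 = n % 2 := by omega
  generalize m - 2 * M = P at *
  generalize -n - 2 * N = Q at *
  rcases int_sq_add_sq_le hle with ⟨rfl, rfl⟩ | ⟨rfl | rfl, rfl⟩ | ⟨rfl, rfl | rfl⟩ |
    ⟨rfl | rfl, rfl | rfl⟩ | ⟨rfl | rfl, rfl⟩ | ⟨rfl, rfl | rfl⟩ <;>
  interval_cases P <;> interval_cases Q <;> omega

lemma DefData.redUnitIso_six (h : DefData σ₀ σ₁ (-1) (-e) e) {O : Subring ℍ[F, -1, -e]}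
    (hO : IsOrder F O) (hi : ⟨0, 1, 0, 0⟩ ∈ O) (hj : ⟨0, 0, 1, 0⟩ ∈ O) {c : F}
    (hc : 4 * e * c ^ 2 = 3) (hρ : ⟨1 / 2, 0, c, 0⟩ ∈ O) :
    RedUnitIso F O (DihedralGroup 6) := by
  have he := h.ne_zero
  have hc0 : c ≠ 0 := by rintro rfl; norm_num at hc
  have hR : (⟨-(e * c), 0, 1 / 2, 0⟩ : ℍ[F, -1, -e]) ∈ O := by
    have := O.mul_mem hρ hj
    rw [mk_mul] at this
    convert this using 2 <;> ring
  have hnR : redNorm F (⟨-(e * c), 0, 1 / 2, 0⟩ : ℍ[F, -1, -e]) = e := by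
    rw [redNorm_mk]; linear_combination e / 4 * hc
  have hR2 : (⟨-(e * c), 0, 1 / 2, 0⟩ : ℍ[F, -1, -e]) ^ 2 = ⟨e / 2, 0, -(e * c), 0⟩ := by
    rw [sq, mk_mul]
    congr 1
    · linear_combination e / 4 * hc
    all_goals ring
  have hR3 : (⟨-(e * c), 0, 1 / 2, 0⟩ : ℍ[F, -1, -e]) ^ 3 = ⟨0, 0, e, 0⟩ := by
    rw [pow_succ, hR2, mk_mul]
    congr 1
    · ring
    · ring
    · linear_combination e / 4 * hc
    · ring
  have hR4 : (⟨-(e * c), 0, 1 / 2, 0⟩ : ℍ[F, -1, -e]) ^ 4 =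
      ⟨-(e ^ 2 / 2), 0, -(e ^ 2 * c), 0⟩ := by
    rw [pow_succ, hR3, mk_mul]
    congr 1 <;> ring
  have h4ec : 4 * e * c ≠ 0 := by simp [he, hc0]
  have hform : ∀ s t : F, (s = 1 ∨ s = -1) → (t = 1 ∨ t = -1) → ∃ (k : ℕ) (c' : F),
      (⟨s / 2, 0, t * c, 0⟩ : ℍ[F, -1, -e]) = c' * ⟨-(e * c), 0, 1 / 2, 0⟩ ^ k := by
    rintro s t (rfl | rfl) (rfl | rfl)
    · exact ⟨4, -(e ^ 2)⁻¹, by rw [hR4, coe_mul_mk]; congr 1 <;> field_simp <;> ring⟩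
    · exact ⟨2, e⁻¹, by rw [hR2, coe_mul_mk]; congr 1 <;> field_simp <;> ring⟩
    · exact ⟨2, -e⁻¹, by rw [hR2, coe_mul_mk]; congr 1 <;> field_simp <;> ring⟩
    · exact ⟨4, (e ^ 2)⁻¹, by rw [hR4, coe_mul_mk]; congr 1 <;> field_simp <;> ring⟩
  have hall : ∀ x ∈ O, redNorm F x = 1 → ∃ (k : ℕ) (c' : F),
      (x = c' * (⟨-(e * c), 0, 1 / 2, 0⟩ : ℍ[F, -1, -e]) ^ k ∨
        x = c' * ((⟨0, 1, 0, 0⟩ : ℍ[F, -1, -e]) * ⟨-(e * c), 0, 1 / 2, 0⟩ ^ k)) := by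
    rintro ⟨a, b, c', d'⟩ hx hn
    rw [redNorm_mk] at hn
    obtain ⟨m, n, hm, hn', hle, hz⟩ := h.norm_one_coords hO hi hx hn
    have hxρ := O.mul_mem hx hρ
    obtain ⟨M, hM, -⟩ := h.trace_norm_one hO hxρ (by
      rw [redNorm_mul, redNorm_mk, redNorm_mk, hn]; linear_combination hc / 4)
    have hxi := O.mul_mem (O.mul_mem hx hi) hρ
    obtain ⟨N, hN, -⟩ := h.trace_norm_one hO hxi (by
      rw [redNorm_mul, redNorm_mul, redNorm_mk, redNorm_mk, redNorm_mk, hn]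
      linear_combination hc / 4)
    rw [mk_mul] at hM
    rw [mk_mul, mk_mul] at hN
    simp only at hM hN
    have h1 : 4 * e * c * c' = ((m - 2 * M : ℤ) : F) := by
      push_cast; rw [← hM, ← hm]; ring
    have h2 : 4 * e * c * d' = ((-n - 2 * N : ℤ) : F) := by
      push_cast; rw [← hN, ← hn']; ring
    have hsum : 3 * m ^ 2 + 3 * n ^ 2 + (m - 2 * M) ^ 2 + (-n - 2 * N) ^ 2 = 12 := by
      have : (((3 * m ^ 2 + 3 * n ^ 2 + (m - 2 * M) ^ 2 + (-n - 2 * N) ^ 2 : ℤ)) : F) = 12 := by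
        have h3 : (((m - 2 * M) ^ 2 : ℤ) : F) = (4 * e * c * c') ^ 2 := by
          rw [Int.cast_pow, ← h1]
        have h4 : (((-n - 2 * N) ^ 2 : ℤ) : F) = (4 * e * c * d') ^ 2 := by
          rw [Int.cast_pow, ← h2]
        rw [Int.cast_add, Int.cast_add, h3, h4]
        push_cast
        rw [← hm, ← hn']
        linear_combination 12 * hn + 4 * e * (c' ^ 2 + d' ^ 2) * hc
      exact_mod_cast this
    rcases sq_sum_eq_twelve hle hsum with h4 | ⟨hm1, hn1, hP, hQ⟩ | ⟨hm1, hn1, hP, hQ⟩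
    · obtain ⟨rfl, rfl⟩ := hz h4
      have hm2 := int_sq_add_sq_le hle
      have hab : (a = 1 ∧ b = 0) ∨ (a = -1 ∧ b = 0) ∨ (a = 0 ∧ b = 1) ∨ (a = 0 ∧ b = -1) := by
        rcases hm2 with ⟨rfl, rfl⟩ | ⟨rfl | rfl, rfl⟩ | ⟨rfl, rfl | rfl⟩ |
          ⟨rfl | rfl, rfl | rfl⟩ | ⟨rfl | rfl, rfl⟩ | ⟨rfl, rfl | rfl⟩ <;>
        first
        | (exfalso; revert h4; norm_num; done)
        | (push_cast at hm hn'
           simp only [show a = _ from eq_div_of_mul_eq two_ne_zero ((mul_comm _ _).trans hm),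
             show b = _ from eq_div_of_mul_eq two_ne_zero ((mul_comm _ _).trans hn')]
           norm_num)
      rcases hab with ⟨rfl, rfl⟩ | ⟨rfl, rfl⟩ | ⟨rfl, rfl⟩ | ⟨rfl, rfl⟩
      · exact ⟨0, 1, Or.inl (by rw [pow_zero, mul_one]; rfl)⟩
      · exact ⟨0, -1, Or.inl (by rw [pow_zero, mul_one]; rfl)⟩
      · exact ⟨0, 1, Or.inr (by rw [pow_zero, mul_one, coe_mul_mk]; congr 1 <;> ring)⟩
      · exact ⟨0, -1, Or.inr (by rw [pow_zero, mul_one, coe_mul_mk]; congr 1 <;> ring)⟩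
    · have hd : d' = 0 := by
        rw [hQ, Int.cast_zero] at h2; simpa [he, hc0] using h2
      have hb : b = 0 := by rw [hn1] at hn'; simpa using hn'
      subst hd hb
      have hs : ∃ s : F, (s = 1 ∨ s = -1) ∧ a = s / 2 := by
        rcases hm1 with rfl | rfl
        · exact ⟨1, Or.inl rfl, by push_cast at hm; linear_combination hm / 2⟩
        · exact ⟨-1, Or.inr rfl, by push_cast at hm; linear_combination hm / 2⟩
      obtain ⟨s, hs, rfl⟩ := hs
      have ht : ∃ t : F, (t = 1 ∨ t = -1) ∧ c' = t * c := by
        rcases hP with hP | hP <;> rw [hP] at h1 <;> push_cast at h1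
        · exact ⟨1, Or.inl rfl, mul_left_cancel₀ h4ec (by linear_combination h1 - hc)⟩
        · exact ⟨-1, Or.inr rfl, mul_left_cancel₀ h4ec (by linear_combination h1 + hc)⟩
      obtain ⟨t, ht, rfl⟩ := ht
      obtain ⟨k, c', h'⟩ := hform s t hs ht
      exact ⟨k, c', Or.inl h'⟩
    · have hd : c' = 0 := by
        rw [hP, Int.cast_zero] at h1; simpa [he, hc0] using h1
      have hb : a = 0 := by rw [hm1] at hm; simpa using hm
      subst hd hb
      have hs : ∃ s : F, (s = 1 ∨ s = -1) ∧ b = s / 2 := by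
        rcases hn1 with rfl | rfl
        · exact ⟨1, Or.inl rfl, by push_cast at hn'; linear_combination hn' / 2⟩
        · exact ⟨-1, Or.inr rfl, by push_cast at hn'; linear_combination hn' / 2⟩
      obtain ⟨s, hs, rfl⟩ := hs
      have ht : ∃ t : F, (t = 1 ∨ t = -1) ∧ d' = t * c := by
        rcases hQ with hQ | hQ <;> rw [hQ] at h2 <;> push_cast at h2
        · exact ⟨1, Or.inl rfl, mul_left_cancel₀ h4ec (by linear_combination h2 - hc)⟩
        · exact ⟨-1, Or.inr rfl, mul_left_cancel₀ h4ec (by linear_combination h2 + hc)⟩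
      obtain ⟨t, ht, rfl⟩ := ht
      obtain ⟨k, c', h'⟩ := hform s t hs ht
      refine ⟨k, c', Or.inr ?_⟩
      rw [← mul_assoc, (QuaternionAlgebra.coe_commutes _ _), mul_assoc, ← h', mk_mul]
      congr 1 <;> ring
  have hR6 : (⟨-(e * c), 0, 1 / 2, 0⟩ : ℍ[F, -1, -e]) ^ 6 = ((-e ^ 3 : F) : ℍ[F, -1, -e]) := by
    rw [show 6 = 3 + 3 from rfl, pow_add, hR3, mk_mul, ← mk_eq_coe]
    congr 1 <;> ring
  have hiR : (⟨0, 1, 0, 0⟩ : ℍ[F, -1, -e]) * ⟨-(e * c), 0, 1 / 2, 0⟩ =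
      ⟨0, -(e * c), 0, 1 / 2⟩ := by
    rw [mk_mul]; congr 1 <;> ring
  refine h.redUnitIso_dihedral hO (by norm_num) hR hi (Or.inr hnR)
    (Or.inl (by rw [redNorm_mk]; ring)) ⟨_, hR6⟩ ?_ ⟨-1, ?_⟩ ⟨-e, ?_⟩ (w := ⟨0, 0, 1, 0⟩) ?_ ?_
    hR hnR hall ?_
  · intro p hp hp6 r
    have : p = 2 ∨ p = 3 := by
      have := Nat.le_of_dvd (by norm_num) hp6
      interval_cases p <;> revert hp6 hp <;> decide
    rcases this with rfl | rfl
    · rw [show 6 / 2 = 3 from rfl, hR3]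
      exact mk_ne_coe (by simp [he]) r
    · rw [show 6 / 3 = 2 from rfl, hR2]
      exact mk_ne_coe (by simp [he, hc0]) r
  · rw [mk_mul, ← mk_eq_coe]; congr 1 <;> ring
  · rw [mul_assoc, hiR, mk_mul, ← mk_eq_coe]
    congr 1
    · linear_combination -e / 4 * hc
    all_goals ring
  · rw [mk_mul, mk_mul]
    congr 1 <;> ring
  · rw [mk_mul, mk_mul]
    intro h1
    have := congrArg QuaternionAlgebra.imK h1
    norm_num at this
  · intro x hx hn
    obtain ⟨k, c', rfl | rfl⟩ := hall x hx hn
    · exact ⟨k + 1, c', Or.inl (by rw [pow_succ, mul_assoc])⟩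
    · exact ⟨k + 1, c', Or.inr (by rw [pow_succ, mul_assoc, mul_assoc])⟩

end HexagonalUnitGroup

section HamiltonBasis

variable {F}
variable {e : F} {σ₀ σ₁ : F →+* ℝ}

/-- The quaternion with coordinates `a, b, c, d` in the basis `1, i, κ(j - k), κ(j + k)`. When
`2 e κ² = 1`, this is the standard basis of Hamilton's quaternions. -/
def ham (e κ a b c d : F) : ℍ[F, -1, -e] := ⟨a, b, κ * (c + d), κ * (d - c)⟩

lemma ham_mul {κ : F} (hκ : 2 * e * κ ^ 2 = 1) (a b c d a' b' c' d' : F) :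
    ham e κ a b c d * ham e κ a' b' c' d' =
      ham e κ (a * a' - b * b' - c * c' - d * d') (a * b' + b * a' + c * d' - d * c')
        (a * c' - b * d' + c * a' + d * b') (a * d' + b * c' - c * b' + d * a') := by
  rw [ham, ham, mk_mul, ham]
  congr 1
  · linear_combination (- c * c' - d * d') * hκ
  · linear_combination (c * d' - d * c') * hκ
  · ring
  · ring

lemma redNorm_ham {κ : F} (hκ : 2 * e * κ ^ 2 = 1) (a b c d : F) :
    redNorm F (ham e κ a b c d) = a ^ 2 + b ^ 2 + c ^ 2 + d ^ 2 := by
  rw [ham, redNorm_mk]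
  linear_combination (c ^ 2 + d ^ 2) * hκ

lemma neg_ham (κ a b c d : F) : -ham e κ a b c d = ham e κ (-a) (-b) (-c) (-d) := by
  rw [ham, neg_mk, ham]; congr 1 <;> ring

lemma ham_add (κ a b c d a' b' c' d' : F) : ham e κ a b c d + ham e κ a' b' c' d' =
    ham e κ (a + a') (b + b') (c + c') (d + d') := by
  simp only [ham]
  ext <;> simp <;> ring

lemma coe_mul_ham (κ r a b c d : F) : (r : ℍ[F, -1, -e]) * ham e κ a b c d =
    ham e κ (r * a) (r * b) (r * c) (r * d) := by
  rw [ham, coe_mul_mk, ham]; congr 1 <;> ring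

lemma ham_one (κ : F) : ham e κ 1 0 0 0 = 1 := by
  rw [ham]; ext <;> simp

lemma ham_i (κ b : F) : ham e κ 0 b 0 0 = ⟨0, b, 0, 0⟩ := by
  rw [ham]; congr 1 <;> ring

lemma ham_j {κ : F} (hκ : 2 * e * κ ^ 2 = 1) :
    ham e κ 0 0 (e * κ) (e * κ) = ⟨0, 0, 1, 0⟩ := by
  rw [ham]; congr 1
  · linear_combination hκ
  · ring

lemma ham_injective {κ : F} (hκ : 2 * e * κ ^ 2 = 1) {a b c d a' b' c' d' : F}
    (h : ham e κ a b c d = ham e κ a' b' c' d') : a = a' ∧ b = b' ∧ c = c' ∧ d = d' := by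
  have hκ0 : κ ≠ 0 := by rintro rfl; simp at hκ
  have h0 := congrArg QuaternionAlgebra.re h
  have h1 := congrArg QuaternionAlgebra.imI h
  have h2 := mul_left_cancel₀ hκ0 (congrArg QuaternionAlgebra.imJ h)
  have h3 := mul_left_cancel₀ hκ0 (congrArg QuaternionAlgebra.imK h)
  refine ⟨h0, h1, ?_, ?_⟩
  · linear_combination (h2 - h3) / 2
  · linear_combination (h2 + h3) / 2

lemma exists_ham {κ : F} (hκ : 2 * e * κ ^ 2 = 1) (x : ℍ[F, -1, -e]) :
    ∃ a b c d, x = ham e κ a b c d := by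
  refine ⟨x.re, x.imI, e * κ * (x.imJ - x.imK), e * κ * (x.imJ + x.imK), ?_⟩
  ext
  · rfl
  · rfl
  · simp only [ham]; linear_combination -x.imJ * hκ
  · simp only [ham]; linear_combination -x.imK * hκ

/-- The elements of the Hamilton basis belong to an order containing `j` and `κ⁻¹(1 + i)/2`. -/
lemma DefData.ham_basis_mem (h : DefData σ₀ σ₁ (-1) (-e) e) {O : Subring ℍ[F, -1, -e]}
    (hO : IsOrder F O) (hi : ⟨0, 1, 0, 0⟩ ∈ O) (hj : ⟨0, 0, 1, 0⟩ ∈ O) {κ : F}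
    (ht : ham e κ (e * κ) (e * κ) 0 0 ∈ O) :
    ham e κ 0 0 1 0 ∈ O ∧ ham e κ 0 0 0 1 ∈ O := by
  have he := h.ne_zero
  have hu : ham e κ 0 0 1 0 ∈ O := by
    have := h.inv_smul_mem hO (O.mul_mem hj ht)
    rw [ham, mk_mul, ← QuaternionAlgebra.coe_mul_eq_smul, coe_mul_mk] at this
    rw [ham]
    convert this using 2 <;> field_simp <;> ring
  refine ⟨hu, ?_⟩
  have := O.mul_mem hi hu
  rw [ham, mk_mul] at this
  rw [ham]
  convert this using 2 <;> ring

/-- Elements of norm one have integral coordinates in the halved Hamilton basis. -/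
lemma DefData.ham_coords (h : DefData σ₀ σ₁ (-1) (-e) e) {O : Subring ℍ[F, -1, -e]}
    (hO : IsOrder F O) (hi : ⟨0, 1, 0, 0⟩ ∈ O) (hj : ⟨0, 0, 1, 0⟩ ∈ O) {κ : F}
    (hκ : 2 * e * κ ^ 2 = 1) (ht : ham e κ (e * κ) (e * κ) 0 0 ∈ O) {x : ℍ[F, -1, -e]}
    (hx : x ∈ O) (hn : redNorm F x = 1) :
    ∃ m n m' n' : ℤ, x = ham e κ (m / 2) (n / 2) (m' / 2) (n' / 2) ∧
      m ^ 2 + n ^ 2 + m' ^ 2 + n' ^ 2 = 4 := by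
  obtain ⟨hu, hv⟩ := h.ham_basis_mem hO hi hj ht
  rw [← ham_i κ] at hi
  obtain ⟨a, b, c, d, rfl⟩ := exists_ham hκ x
  have key : ∀ y ∈ O, redNorm F y = 1 →
      ∃ m : ℤ, 2 * (ham e κ a b c d * y).re = m := fun y hy hny => by
    obtain ⟨m, hm, -⟩ := h.trace_norm_one hO (O.mul_mem hx hy)
      (by rw [redNorm_mul, hn, hny, one_mul])
    exact ⟨m, hm⟩
  obtain ⟨m, hm⟩ := key 1 O.one_mem (redNorm_one)
  obtain ⟨n, hn1⟩ := key _ (O.neg_mem hi) (by rw [neg_ham, redNorm_ham hκ]; ring)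
  obtain ⟨m', hm'⟩ := key _ (O.neg_mem hu) (by rw [neg_ham, redNorm_ham hκ]; ring)
  obtain ⟨n', hn'⟩ := key _ (O.neg_mem hv) (by rw [neg_ham, redNorm_ham hκ]; ring)
  rw [mul_one] at hm
  rw [neg_ham, ham_mul hκ] at hn1 hm' hn'
  simp only [ham] at hm hn1 hm' hn'
  have h1 : a = m / 2 := by linear_combination hm / 2
  have h2 : b = n / 2 := by linear_combination hn1 / 2
  have h3 : c = m' / 2 := by linear_combination hm' / 2
  have h4 : d = n' / 2 := by linear_combination hn' / 2
  rw [redNorm_ham hκ] at hn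
  refine ⟨m, n, m', n', by rw [h1, h2, h3, h4], ?_⟩
  rw [h1, h2, h3, h4] at hn
  have : (m : F) ^ 2 + n ^ 2 + m' ^ 2 + n' ^ 2 = 4 := by linear_combination 4 * hn
  exact_mod_cast this

set_option synthInstance.maxSize 1000 in
set_option synthInstance.maxHeartbeats 200000 in
lemma sq_add_sq_add_sq_add_sq_eq_four {m n m' n' : ℤ} (h : m ^ 2 + n ^ 2 + m' ^ 2 + n' ^ 2 = 4) :
    ((m = 1 ∨ m = -1) ∧ (n = 1 ∨ n = -1) ∧ (m' = 1 ∨ m' = -1) ∧ (n' = 1 ∨ n' = -1)) ∨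
    ((m = 2 ∨ m = -2) ∧ n = 0 ∧ m' = 0 ∧ n' = 0) ∨ (m = 0 ∧ (n = 2 ∨ n = -2) ∧ m' = 0 ∧ n' = 0) ∨
    (m = 0 ∧ n = 0 ∧ (m' = 2 ∨ m' = -2) ∧ n' = 0) ∨
    (m = 0 ∧ n = 0 ∧ m' = 0 ∧ (n' = 2 ∨ n' = -2)) := by
  have h1 : -2 ≤ m := by nlinarith [sq_nonneg n, sq_nonneg m', sq_nonneg n']
  have h2 : m ≤ 2 := by nlinarith [sq_nonneg n, sq_nonneg m', sq_nonneg n']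
  have h3 : -2 ≤ n := by nlinarith [sq_nonneg m, sq_nonneg m', sq_nonneg n']
  have h4 : n ≤ 2 := by nlinarith [sq_nonneg m, sq_nonneg m', sq_nonneg n']
  have h5 : -2 ≤ m' := by nlinarith [sq_nonneg m, sq_nonneg n, sq_nonneg n']
  have h6 : m' ≤ 2 := by nlinarith [sq_nonneg m, sq_nonneg n, sq_nonneg n']
  have h7 : -2 ≤ n' := by nlinarith [sq_nonneg m, sq_nonneg n, sq_nonneg m']
  have h8 : n' ≤ 2 := by nlinarith [sq_nonneg m, sq_nonneg n, sq_nonneg m']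
  have key : ∀ m ∈ Finset.Icc (-2 : ℤ) 2, ∀ n ∈ Finset.Icc (-2 : ℤ) 2,
      ∀ m' ∈ Finset.Icc (-2 : ℤ) 2, ∀ n' ∈ Finset.Icc (-2 : ℤ) 2,
      m ^ 2 + n ^ 2 + m' ^ 2 + n' ^ 2 = 4 →
    ((m = 1 ∨ m = -1) ∧ (n = 1 ∨ n = -1) ∧ (m' = 1 ∨ m' = -1) ∧ (n' = 1 ∨ n' = -1)) ∨
    ((m = 2 ∨ m = -2) ∧ n = 0 ∧ m' = 0 ∧ n' = 0) ∨ (m = 0 ∧ (n = 2 ∨ n = -2) ∧ m' = 0 ∧ n' = 0) ∨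
    (m = 0 ∧ n = 0 ∧ (m' = 2 ∨ m' = -2) ∧ n' = 0) ∨
    (m = 0 ∧ n = 0 ∧ m' = 0 ∧ (n' = 2 ∨ n' = -2)) := by decide +kernel
  exact key m (Finset.mem_Icc.2 ⟨h1, h2⟩) n (Finset.mem_Icc.2 ⟨h3, h4⟩)
    m' (Finset.mem_Icc.2 ⟨h5, h6⟩) n' (Finset.mem_Icc.2 ⟨h7, h8⟩) h

/-- The reduced unit group is `D₄` as soon as no element of norm one has all its Hamilton
coordinates equal to `± 1/2`. -/
lemma DefData.redUnitIso_four (h : DefData σ₀ σ₁ (-1) (-e) e) {O : Subring ℍ[F, -1, -e]}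
    (hO : IsOrder F O) (hi : ⟨0, 1, 0, 0⟩ ∈ O) (hj : ⟨0, 0, 1, 0⟩ ∈ O) {κ : F}
    (hκ : 2 * e * κ ^ 2 = 1) (ht : ham e κ (e * κ) (e * κ) 0 0 ∈ O)
    (hodd : ∀ m n m' n' : ℤ, m % 2 = 1 → n % 2 = 1 → m' % 2 = 1 → n' % 2 = 1 →
      ham e κ (m / 2) (n / 2) (m' / 2) (n' / 2) ∉ O) :
    RedUnitIso F O (DihedralGroup 4) := by
  have he := h.ne_zero
  have hκ0 : κ ≠ 0 := by rintro rfl; simp at hκ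
  have nt : redNorm F (ham e κ (e * κ) (e * κ) 0 0) = e := by
    rw [redNorm_ham hκ]; linear_combination e * hκ
  have ht2 : ham e κ (e * κ) (e * κ) 0 0 ^ 2 = ham e κ 0 e 0 0 := by
    rw [sq, ham_mul hκ]
    congr 1
    · ring
    · linear_combination e * hκ
    · ring
    · ring
  have ht3 : ham e κ (e * κ) (e * κ) 0 0 ^ 3 = ham e κ (-(e ^ 2 * κ)) (e ^ 2 * κ) 0 0 := by
    rw [pow_succ, ht2, ham_mul hκ]
    congr 1 <;> ring
  have ht4 : ham e κ (e * κ) (e * κ) 0 0 ^ 4 = ((-e ^ 2 : F) : ℍ[F, -1, -e]) := by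
    rw [show 4 = 2 + 2 from rfl, pow_add, ht2, ham_mul hκ, ← mk_eq_coe, ham]
    congr 1 <;> ring
  have hjt : (⟨0, 0, 1, 0⟩ : ℍ[F, -1, -e]) * ham e κ (e * κ) (e * κ) 0 0 = ham e κ 0 0 e 0 := by
    rw [← ham_j hκ, ham_mul hκ]
    congr 1
    · ring
    · ring
    · linear_combination e * hκ
    · ring
  have hjt3 : (⟨0, 0, 1, 0⟩ : ℍ[F, -1, -e]) * ham e κ (-(e ^ 2 * κ)) (e ^ 2 * κ) 0 0 =
      ham e κ 0 0 0 (-e ^ 2) := by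
    rw [← ham_j hκ, ham_mul hκ]
    congr 1
    · ring
    · ring
    · ring
    · linear_combination -e ^ 2 * hκ
  have hall : ∀ x ∈ O, redNorm F x = 1 → ∃ (k : ℕ) (c' : F),
      (x = c' * ham e κ (e * κ) (e * κ) 0 0 ^ k ∨
        x = c' * ((⟨0, 0, 1, 0⟩ : ℍ[F, -1, -e]) * ham e κ (e * κ) (e * κ) 0 0 ^ k)) := by
    intro x hx hn
    obtain ⟨m, n, m', n', rfl, hs⟩ := h.ham_coords hO hi hj hκ ht hx hn
    rcases sq_add_sq_add_sq_add_sq_eq_four hs with ⟨h1, h2, h3, h4⟩ | ⟨hm, rfl, rfl, rfl⟩ |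
      ⟨rfl, hm, rfl, rfl⟩ | ⟨rfl, rfl, hm, rfl⟩ | ⟨rfl, rfl, rfl, hm⟩
    · exact absurd hx (hodd m n m' n' (by omega) (by omega) (by omega) (by omega))
    · refine ⟨0, m / 2, Or.inl ?_⟩
      rw [pow_zero, ← ham_one κ, coe_mul_ham]
      congr 1 <;> simp
    · refine ⟨2, n / (2 * e), Or.inl ?_⟩
      rw [ht2, coe_mul_ham]
      congr 1 <;> field_simp <;> simp
    · refine ⟨1, m' / (2 * e), Or.inr ?_⟩
      rw [pow_one, hjt, coe_mul_ham]
      congr 1 <;> field_simp <;> simp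
    · refine ⟨3, -n' / (2 * e ^ 2), Or.inr ?_⟩
      rw [ht3, hjt3, coe_mul_ham]
      congr 1 <;> field_simp <;> simp
  refine h.redUnitIso_dihedral hO (by norm_num) ht hj (Or.inr nt)
    (Or.inr (by rw [redNorm_mk]; ring)) ⟨_, ht4⟩ ?_ ⟨-e, ?_⟩ ⟨-e ^ 2, ?_⟩
    (w := ham e κ 0 1 0 0) ?_ ?_ ht nt hall ?_
  · intro p hp hp4 r
    have : p = 2 := by
      have := Nat.le_of_dvd (by norm_num) hp4
      interval_cases p <;> revert hp4 hp <;> decide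
    rw [this, show 4 / 2 = 2 from rfl, ht2]
    exact mk_ne_coe (by simp [he]) r
  · rw [mk_mul, ← mk_eq_coe]; congr 1 <;> ring
  · rw [mul_assoc, hjt, ham_mul hκ, ← mk_eq_coe, ham]
    congr 1 <;> ring
  · rw [ham_mul hκ, ham_mul hκ]
    congr 1 <;> ring
  · rw [← ham_j hκ, ham_mul hκ, ham_mul hκ]
    intro h1
    have := (ham_injective hκ h1).2.2.1
    have h2 : 2 * (e * κ) = 0 := by linear_combination this
    simp [he, hκ0] at h2
  · intro x hx hn
    obtain ⟨k, c', rfl | rfl⟩ := hall x hx hn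
    · exact ⟨k + 1, c', Or.inl (by rw [pow_succ, mul_assoc])⟩
    · exact ⟨k + 1, c', Or.inr (by rw [pow_succ, mul_assoc, mul_assoc])⟩

end HamiltonBasis

section OctahedralUnitGroup

variable {F}
variable {e : F} {σ₀ σ₁ : F →+* ℝ}

lemma re_mul_comm {A B : F} (x y : ℍ[F, A, B]) : (x * y).re = (y * x).re := by
  simp only [QuaternionAlgebra.re_mul]; ring

lemma DefData.ham_half_mem (h : DefData σ₀ σ₁ (-1) (-e) e) {O : Subring ℍ[F, -1, -e]}
    (hO : IsOrder F O) (hi : ⟨0, 1, 0, 0⟩ ∈ O) (hj : ⟨0, 0, 1, 0⟩ ∈ O) {κ : F}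
    (ht : ham e κ (e * κ) (e * κ) 0 0 ∈ O) {m n m' n' : ℤ}
    (hx : ham e κ (m / 2) (n / 2) (m' / 2) (n' / 2) ∈ O) (r s r' s' : ℤ) :
    ham e κ ((m + 2 * r : ℤ) / 2) ((n + 2 * s : ℤ) / 2) ((m' + 2 * r' : ℤ) / 2)
      ((n' + 2 * s' : ℤ) / 2) ∈ O := by
  obtain ⟨hu, hv⟩ := h.ham_basis_mem hO hi hj ht
  rw [← ham_i κ] at hi
  have := O.add_mem (O.add_mem (O.add_mem (O.add_mem hx (O.zsmul_mem O.one_mem r))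
    (O.zsmul_mem hi s)) (O.zsmul_mem hu r')) (O.zsmul_mem hv s')
  convert this using 1
  rw [ham, ham, ham, ham, ham]
  ext <;> simp <;> ring

/-- The four diagonals of the cube. -/
def diag (e κ : F) : Fin 4 → ℍ[F, -1, -e] :=
  ![ham e κ 0 1 1 1, ham e κ 0 1 (-1) (-1), ham e κ 0 (-1) 1 (-1), ham e κ 0 (-1) (-1) 1]

/-- Conjugation by `w` maps the diagonal with index `m` to the one with index `m'`, up to sign. -/
def MapsDiag (e κ : F) (w : ℍ[F, -1, -e]) (m m' : Fin 4) : Prop :=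
  w * diag e κ m = diag e κ m' * w ∨ w * diag e κ m = -(diag e κ m' * w)

lemma exists_diag (κ : F) {a b c : ℤ} (ha : a = 1 ∨ a = -1) (hb : b = 1 ∨ b = -1)
    (hc : c = 1 ∨ c = -1) :
    ∃ m, ham e κ 0 a b c = diag e κ m ∨ ham e κ 0 a b c = -diag e κ m := by
  rcases ha with rfl | rfl <;> rcases hb with rfl | rfl <;> rcases hc with rfl | rfl <;>
    push_cast
  · exact ⟨0, Or.inl rfl⟩
  · exact ⟨3, Or.inr (by simp [diag, neg_ham])⟩
  · exact ⟨2, Or.inr (by simp [diag, neg_ham])⟩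
  · exact ⟨1, Or.inl rfl⟩
  · exact ⟨1, Or.inr (by simp [diag, neg_ham])⟩
  · exact ⟨2, Or.inl rfl⟩
  · exact ⟨3, Or.inl rfl⟩
  · exact ⟨0, Or.inr (by simp [diag, neg_ham])⟩

lemma exists_diag_eq (κ : F) (m : Fin 4) : ∃ a b c : ℤ, (a = 1 ∨ a = -1) ∧ (b = 1 ∨ b = -1) ∧
    (c = 1 ∨ c = -1) ∧ diag e κ m = ham e κ 0 a b c := by
  fin_cases m
  · exact ⟨1, 1, 1, by simp, by simp, by simp, by simp [diag]⟩
  · exact ⟨1, -1, -1, by simp, by simp, by simp, by simp [diag]⟩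
  · exact ⟨-1, 1, -1, by simp, by simp, by simp, by simp [diag]⟩
  · exact ⟨-1, -1, 1, by simp, by simp, by simp, by simp [diag]⟩

lemma diag_unique {κ : F} (hκ : 2 * e * κ ^ 2 = 1) {m m' : Fin 4}
    (h : diag e κ m = diag e κ m' ∨ diag e κ m = -diag e κ m') : m = m' := by
  have h1 : (1 : F) ≠ -1 := by
    intro h; have : (2 : F) = 0 := by linear_combination h
    exact two_ne_zero this
  fin_cases m <;> fin_cases m' <;> first | rfl | (
    exfalso
    rcases h with h | h <;> simp [diag, neg_ham] at h <;>
    have h2 := ham_injective hκ h <;> simp [h1, h1.symm] at h2)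

lemma MapsDiag.unique {κ : F} (hκ : 2 * e * κ ^ 2 = 1)
    {w : ℍ[F, -1, -e]} (hw : IsUnit w) {m m₁ m₂ : Fin 4} (h₁ : MapsDiag e κ w m m₁)
    (h₂ : MapsDiag e κ w m m₂) : m₁ = m₂ := by
  apply diag_unique hκ
  rcases h₁ with h₁ | h₁ <;> rcases h₂ with h₂ | h₂ <;> rw [h₁] at h₂
  · exact Or.inl (hw.mul_right_cancel h₂)
  · exact Or.inr (hw.mul_right_cancel (by rw [h₂, neg_mul]))
  · exact Or.inr (hw.mul_right_cancel (by rw [neg_mul, ← h₂, neg_neg]))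
  · exact Or.inl (hw.mul_right_cancel (neg_injective h₂))

lemma MapsDiag.mul {κ : F} {w w' : ℍ[F, -1, -e]} {m m' m'' : Fin 4}
    (h : MapsDiag e κ w m' m'') (h' : MapsDiag e κ w' m m') : MapsDiag e κ (w * w') m m'' := by
  rcases h with h | h <;> rcases h' with h' | h'
  · left; rw [mul_assoc, h', ← mul_assoc, h, mul_assoc]
  · right; rw [mul_assoc, h', mul_neg, ← mul_assoc, h, mul_assoc]
  · right; rw [mul_assoc, h', ← mul_assoc, h, neg_mul, mul_assoc]
  · left; rw [mul_assoc, h', mul_neg, ← mul_assoc, h, neg_mul, neg_neg, mul_assoc]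

lemma mapsDiag_coe (κ r : F) (m : Fin 4) : MapsDiag e κ (r : ℍ[F, -1, -e]) m m :=
  Or.inl (QuaternionAlgebra.coe_commutes _ _)

lemma ham_comm_or_anticomm {κ : F} (hκ : 2 * e * κ ^ 2 = 1) {a b c d q r s : F}
    (h : ham e κ a b c d * ham e κ 0 q r s = ham e κ 0 q r s * ham e κ a b c d ∨
      ham e κ a b c d * ham e κ 0 q r s = -(ham e κ 0 q r s * ham e κ a b c d)) :
    (c * s = d * r ∧ d * q = b * s ∧ b * r = c * q) ∨ b * q + c * r + d * s = 0 := by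
  rw [ham_mul hκ, ham_mul hκ, neg_ham] at h
  rcases h with h | h
  · obtain ⟨-, h1, h2, h3⟩ := ham_injective hκ h
    exact Or.inl ⟨by linear_combination h1 / 2, by linear_combination h2 / 2,
      by linear_combination h3 / 2⟩
  · obtain ⟨h0, -⟩ := ham_injective hκ h
    exact Or.inr (by linear_combination -h0 / 2)

lemma MapsDiag.eq_coe {κ : F} (hκ : 2 * e * κ ^ 2 = 1) {w : ℍ[F, -1, -e]}
    (h : ∀ m, MapsDiag e κ w m m) : ∃ r : F, w = r := by
  obtain ⟨a, b, c, d, rfl⟩ := exists_ham hκ w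
  have h0 := ham_comm_or_anticomm hκ (h 0)
  have h1 := ham_comm_or_anticomm hκ (h 1)
  have h2 := ham_comm_or_anticomm hκ (h 2)
  have h3 := ham_comm_or_anticomm hκ (h 3)
  simp only [mul_one, mul_neg] at h0 h1 h2 h3
  have : b = 0 ∧ c = 0 ∧ d = 0 := by grind
  obtain ⟨rfl, rfl, rfl⟩ := this
  exact ⟨a, by rw [← mk_eq_coe, ham]; congr 1 <;> ring⟩

/-- Conjugation by a unit of an order containing the halved diagonals permutes the diagonals. -/
lemma DefData.exists_mapsDiag (h : DefData σ₀ σ₁ (-1) (-e) e) {O : Subring ℍ[F, -1, -e]}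
    (hO : IsOrder F O) (hi : ⟨0, 1, 0, 0⟩ ∈ O) (hj : ⟨0, 0, 1, 0⟩ ∈ O) {κ : F}
    (hκ : 2 * e * κ ^ 2 = 1) (ht : ham e κ (e * κ) (e * κ) 0 0 ∈ O)
    (hodd : ∀ m n m' n' : ℤ, m % 2 = 1 → n % 2 = 1 → m' % 2 = 1 → n' % 2 = 1 →
      ham e κ (m / 2) (n / 2) (m' / 2) (n' / 2) ∈ O) (u : (↥O)ˣ) (m : Fin 4) :
    ∃ m', MapsDiag e κ ((u : ↥O) : ℍ[F, -1, -e]) m m' := by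
  obtain ⟨a, b, c, ha, hb, hc, hm⟩ := exists_diag_eq (e := e) κ m
  have hx := hodd 1 a b c (by omega) (by omega) (by omega) (by omega)
  have hinv : ((u⁻¹ : (↥O)ˣ) : ↥O) * (u : ↥O) = (1 : ↥O) := u.inv_mul
  have hinv' : (((u⁻¹ : (↥O)ˣ) : ↥O) : ℍ[F, -1, -e]) * ((u : ↥O) : ℍ[F, -1, -e]) = 1 := by
    rw [← Subring.coe_mul, hinv, Subring.coe_one]
  have hwO := ((u : ↥O)).2
  have hwO' := ((u⁻¹ : (↥O)ˣ) : ↥O).2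
  simp only [MapsDiag, hm]
  generalize ((u : ↥O) : ℍ[F, -1, -e]) = w at *
  generalize (((u⁻¹ : (↥O)ˣ) : ↥O) : ℍ[F, -1, -e]) = w' at *
  have hn : redNorm F (w * ham e κ ((1 : ℤ) / 2) (a / 2) (b / 2) (c / 2) * w') = 1 := by
    rw [redNorm_mul, redNorm_mul, redNorm_ham hκ]
    have h1 := congrArg (redNorm F) hinv'
    rw [redNorm_mul, redNorm_one] at h1
    have ha2 : (a : F) ^ 2 = 1 := by rcases ha with rfl | rfl <;> simp
    have hb2 : (b : F) ^ 2 = 1 := by rcases hb with rfl | rfl <;> simp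
    have hc2 : (c : F) ^ 2 = 1 := by rcases hc with rfl | rfl <;> simp
    push_cast
    linear_combination h1 + redNorm F w * redNorm F w' / 4 * (ha2 + hb2 + hc2)
  obtain ⟨m₁, a', b', c', hx', hs⟩ :=
    h.ham_coords hO hi hj hκ ht (O.mul_mem (O.mul_mem hwO hx) hwO') hn
  have hre := congrArg QuaternionAlgebra.re hx'
  rw [re_mul_comm, ← mul_assoc, hinv', one_mul] at hre
  have hm1 : m₁ = 1 := by
    have : (m₁ : F) = 1 := by
      simp only [ham] at hre
      push_cast at hre
      linear_combination -2 * hre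
    exact_mod_cast this
  subst hm1
  have hodd' : (a' = 1 ∨ a' = -1) ∧ (b' = 1 ∨ b' = -1) ∧ (c' = 1 ∨ c' = -1) := by
    rcases sq_add_sq_add_sq_add_sq_eq_four hs with ⟨h1, h2, h3, h4⟩ | ⟨h1, -⟩ | ⟨h1, -⟩ |
      ⟨h1, -⟩ | ⟨h1, -⟩
    · exact ⟨h2, h3, h4⟩
    all_goals omega
  obtain ⟨m', hm'⟩ := exists_diag (e := e) κ hodd'.1 hodd'.2.1 hodd'.2.2
  have hhalf : ∀ a b c : F, ham e κ 0 a b c = (2 : F) * ham e κ ((1 : ℤ) / 2) (a / 2) (b / 2)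
      (c / 2) - 1 := by
    intro a b c
    rw [eq_sub_iff_add_eq, coe_mul_ham, ← ham_one κ, ham_add]
    congr 1 <;> push_cast <;> ring
  have hconj : w * ham e κ 0 a b c = ham e κ 0 a' b' c' * w := by
    rw [hhalf a, hhalf a', ← hx', mul_sub, sub_mul, ← mul_assoc w, ← QuaternionAlgebra.coe_commutes,
      mul_assoc, mul_assoc, mul_assoc, mul_assoc, hinv', mul_one, one_mul, mul_one]
  refine ⟨m', ?_⟩
  rcases hm' with hm' | hm'
  · left; rw [hconj, hm']
  · right; rw [hconj, hm', neg_mul]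

lemma closure_swap_finRotate (S : Subgroup (Equiv.Perm (Fin 4))) (h₁ : finRotate 4 ∈ S)
    (h₂ : Equiv.swap 0 1 ∈ S) : S = ⊤ := by
  rw [eq_top_iff, ← Equiv.Perm.closure_cycle_adjacent_swap (isCycle_finRotate (n := 2))
    support_finRotate 0, Subgroup.closure_le]
  rintro x (rfl | rfl)
  · exact h₁
  · exact h₂

lemma DefData.redUnitIso_perm (h : DefData σ₀ σ₁ (-1) (-e) e) {O : Subring ℍ[F, -1, -e]}
    (hO : IsOrder F O) (hi : ⟨0, 1, 0, 0⟩ ∈ O) (hj : ⟨0, 0, 1, 0⟩ ∈ O) {κ : F}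
    (hκ : 2 * e * κ ^ 2 = 1) (ht : ham e κ (e * κ) (e * κ) 0 0 ∈ O)
    (hodd : ∀ m n m' n' : ℤ, m % 2 = 1 → n % 2 = 1 → m' % 2 = 1 → n' % 2 = 1 →
      ham e κ (m / 2) (n / 2) (m' / 2) (n' / 2) ∈ O) :
    RedUnitIso F O (Equiv.Perm (Fin 4)) := by
  have hunit : ∀ u : (↥O)ˣ, IsUnit ((u : ↥O) : ℍ[F, -1, -e]) := fun u =>
    u.isUnit.map O.subtype
  choose f hf using h.exists_mapsDiag hO hi hj hκ ht hodd
  have huniq : ∀ (u : (↥O)ˣ) m m', MapsDiag e κ ((u : ↥O) : ℍ[F, -1, -e]) m m' → f u m = m' :=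
    fun u m m' hm => (hf u m).unique hκ (hunit u) hm
  let ψ : (↥O)ˣ →* Function.End (Fin 4) :=
    { toFun := f
      map_one' := funext fun m => huniq 1 m m (by simpa using mapsDiag_coe κ 1 m)
      map_mul' := fun u v => funext fun m => huniq (u * v) m (f u (f v m)) (by
        rw [Units.val_mul, Subring.coe_mul]; exact (hf u _).mul (hf v m)) }
  let φ : (↥O)ˣ →* Equiv.Perm (Fin 4) :=
    (Equiv.Perm.equivUnitsEnd (α := Fin 4)).symm.toMonoidHom.comp
      ψ.toHomUnits
  have hφ : ∀ u m, φ u m = f u m := fun u m => rfl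
  refine ⟨φ, ?_, fun u => ?_⟩
  · rw [← MonoidHom.range_eq_top]
    have key : ∀ (π : Equiv.Perm (Fin 4)) (x : ℍ[F, -1, -e]), x ∈ O →
        (redNorm F x = 1 ∨ redNorm F x = e) → (∀ m, MapsDiag e κ x m (π m)) → π ∈ φ.range := by
      intro π x hx hn hm
      obtain ⟨u, rfl⟩ := h.exists_unit_of_norm hO hx hn
      exact ⟨u, Equiv.ext fun m => (hφ u m).trans (huniq u m _ (hm m))⟩
    have hx₀ := hodd 1 1 1 1 (by norm_num) (by norm_num) (by norm_num) (by norm_num)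
    rw [← ham_j hκ] at hj
    have hdiag : ∀ {x : ℍ[F, -1, -e]} {m m' : Fin 4},
        x * diag e κ m = -(diag e κ m' * x) → MapsDiag e κ x m m' := fun h => Or.inr h
    apply closure_swap_finRotate
    · have hx := O.mul_mem hj hx₀
      rw [ham_mul hκ] at hx
      refine key _ _ hx (Or.inr ?_) fun m => ?_
      · rw [redNorm_ham hκ]; push_cast; linear_combination e * hκ
      · fin_cases m
        · exact hdiag (m := 0) (m' := 1) (by simp [diag, ham_mul hκ, neg_ham]; ring_nf)
        · exact hdiag (m := 1) (m' := 2) (by simp [diag, ham_mul hκ, neg_ham]; ring_nf)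
        · exact hdiag (m := 2) (m' := 3) (by simp [diag, ham_mul hκ, neg_ham]; ring_nf)
        · exact hdiag (m := 3) (m' := 0) (by simp [diag, ham_mul hκ, neg_ham]; ring_nf)
    · refine key _ _ hj (Or.inr ?_) fun m => ?_
      · rw [redNorm_ham hκ]; linear_combination e * hκ
      · fin_cases m
        · exact hdiag (m := 0) (m' := 1) (by simp [diag, ham_mul hκ, neg_ham]; ring_nf)
        · exact hdiag (m := 1) (m' := 0) (by simp [diag, ham_mul hκ, neg_ham])
        · exact hdiag (m := 2) (m' := 2) (by simp [diag, ham_mul hκ, neg_ham]; ring_nf)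
        · exact hdiag (m := 3) (m' := 3) (by simp [diag, ham_mul hκ, neg_ham])
  · rw [hO.isScalarUnit_iff]
    constructor
    · intro hu
      refine MapsDiag.eq_coe hκ fun m => ?_
      have : f u m = m := by rw [← hφ, hu]; rfl
      simpa only [this] using hf u m
    · rintro ⟨r, hr⟩
      exact Equiv.ext fun m => (hφ u m).trans (huniq u m m (by rw [hr]; exact mapsDiag_coe κ r m))

end OctahedralUnitGroup

section Classification

variable {F}
variable {e : F} {σ₀ σ₁ : F →+* ℝ}

/-- The second possible position of an element of order six. -/
lemma DefData.redUnitIso_six' (h : DefData σ₀ σ₁ (-1) (-e) e) {O : Subring ℍ[F, -1, -e]}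
    (hO : IsOrder F O) (hi : ⟨0, 1, 0, 0⟩ ∈ O) (hj : ⟨0, 0, 1, 0⟩ ∈ O) {c : F}
    (hc : 4 * e * c ^ 2 = 3) (hρ : ⟨1 / 2, 0, 0, c⟩ ∈ O) :
    RedUnitIso F O (DihedralGroup 6) := by
  have hg : redNorm F (⟨1, -1, 0, 0⟩ : ℍ[F, -1, -e]) ≠ 0 := by
    rw [redNorm_mk]; norm_num
  obtain ⟨x, hx⟩ := isUnit_of_redNorm_ne_zero hg
  have key : ∀ y z : ℍ[F, -1, -e], (⟨1, -1, 0, 0⟩ : ℍ[F, -1, -e]) * y = z * ⟨1, -1, 0, 0⟩ →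
      y ∈ O → z ∈ O.map ((conjEquiv (F := F) x : ℍ[F, -1, -e] →+* ℍ[F, -1, -e])) := by
    intro y z hyz hy
    refine ⟨y, hy, ?_⟩
    rw [← hx] at hyz
    change (x : ℍ[F, -1, -e]) * y * ((x⁻¹ : ℍ[F, -1, -e]ˣ) : ℍ[F, -1, -e]) = z
    rw [hyz, mul_assoc, Units.mul_inv, mul_one]
  have hk := k_mem hi hj
  have h6 := h.redUnitIso_six (hO.map (conjEquiv (F := F) x))
    (key ⟨0, 1, 0, 0⟩ _ (by rw [mk_mul, mk_mul]; congr 1 <;> ring) hi)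
    (key ⟨0, 0, 0, 1⟩ _ (by rw [mk_mul, mk_mul]; congr 1 <;> ring) hk) hc
    (key _ _ (by rw [mk_mul, mk_mul]; congr 1 <;> ring) hρ)
  have := h6.map (conjEquiv (F := F) x).symm
  rwa [map_map_symm] at this

/-- The possible reduced unit groups of an order containing `i` and `j`. -/
lemma DefData.redUnitIso_cases (h : DefData σ₀ σ₁ (-1) (-e) e) {O : Subring ℍ[F, -1, -e]}
    (hO : IsOrder F O) (hi : ⟨0, 1, 0, 0⟩ ∈ O) (hj : ⟨0, 0, 1, 0⟩ ∈ O) :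
    RedUnitDihedralSecondKind F 2 O ∨ RedUnitIso F O (DihedralGroup 4) ∨
      RedUnitIso F O (Equiv.Perm (Fin 4)) ∨ RedUnitIso F O (DihedralGroup 6) := by
  have he := h.ne_zero
  rcases h.trichotomy hO hi hj with ⟨p, hp, ht⟩ | ⟨c, hc, hρ | hρ⟩ | hN
  · obtain ⟨κ, rfl⟩ : ∃ κ, p = e * κ := ⟨p / e, by field_simp⟩
    have hκ : 2 * e * κ ^ 2 = 1 := mul_left_cancel₀ he (by linear_combination hp)
    have ht' : ham e κ (e * κ) (e * κ) 0 0 ∈ O := by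
      rw [ham]; convert ht using 2 <;> ring
    by_cases hodd : ∃ m n m' n' : ℤ, m % 2 = 1 ∧ n % 2 = 1 ∧ m' % 2 = 1 ∧ n' % 2 = 1 ∧
        ham e κ (m / 2) (n / 2) (m' / 2) (n' / 2) ∈ O
    · obtain ⟨m, n, m', n', hm, hn, hm', hn', hx⟩ := hodd
      refine Or.inr (Or.inr (Or.inl (h.redUnitIso_perm hO hi hj hκ ht' ?_)))
      intro a b c d ha hb hc hd
      have := h.ham_half_mem hO hi hj ht' hx ((a - m) / 2) ((b - n) / 2) ((c - m') / 2)
        ((d - n') / 2)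
      rwa [show m + 2 * ((a - m) / 2) = a by omega, show n + 2 * ((b - n) / 2) = b by omega,
        show m' + 2 * ((c - m') / 2) = c by omega,
        show n' + 2 * ((d - n') / 2) = d by omega] at this
    · refine Or.inr (Or.inl (h.redUnitIso_four hO hi hj hκ ht' ?_))
      intro m n m' n' hm hn hm' hn' hx
      exact hodd ⟨m, n, m', n', hm, hn, hm', hn', hx⟩
  · exact Or.inr (Or.inr (Or.inr (h.redUnitIso_six hO hi hj hc hρ)))
  · exact Or.inr (Or.inr (Or.inr (h.redUnitIso_six' hO hi hj hc hρ)))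
  · exact Or.inl (h.second_kind_of_redUnitIso hO hj (h.redUnitIso_two hO hi hj hN))

end Classification

section Normalizer

variable {F}
variable {e : F} {σ₀ σ₁ : F →+* ℝ}

lemma re_eq_zero_of_sq_neg (σ : F →+* ℝ) {r : F} (hr : 0 < σ r) {x : ℍ[F, -1, -e]}
    (hx : x * x = -(r : ℍ[F, -1, -e])) : x.re = 0 ∧ redNorm F x = r := by
  have h0 : x.re = 0 := by
    refine re_eq_zero_of_sq (s := -r) (fun s hs => ?_) (by rw [hx]; ext <;> simp)
    rw [hs] at hx
    have := congrArg (fun y => σ (QuaternionAlgebra.re y)) hx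
    simp at this
    nlinarith [mul_self_nonneg (σ s)]
  refine ⟨h0, ?_⟩
  rw [sq_eq, h0] at hx
  have := congrArg QuaternionAlgebra.re hx
  simpa using this

lemma StdPair.coords (h : DefData σ₀ σ₁ (-1) (-e) e) {I J : ℍ[F, -1, -e]} (hp : StdPair e I J) :
    ∃ b c d β γ δ : F, I = ⟨0, b, c, d⟩ ∧ J = ⟨0, β, γ, δ⟩ ∧ b ^ 2 + e * (c ^ 2 + d ^ 2) = 1 ∧
      β ^ 2 + e * (γ ^ 2 + δ ^ 2) = e ∧ b * β + e * (c * γ + d * δ) = 0 := by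
  have h1 : I.re = 0 ∧ redNorm F I = 1 := re_eq_zero_of_sq_neg σ₀ (by simp) (by
    rw [hp.sq_left, QuaternionAlgebra.coe_one])
  have h2 : J.re = 0 ∧ redNorm F J = e := re_eq_zero_of_sq_neg σ₀ h.pos₀ hp.sq_right
  have h3 := congrArg QuaternionAlgebra.re hp.anti
  obtain ⟨a, b, c, d⟩ := I
  obtain ⟨α, β, γ, δ⟩ := J
  obtain ⟨h1, h1'⟩ := h1
  obtain ⟨h2, h2'⟩ := h2
  dsimp only at h1 h2
  subst h1 h2
  refine ⟨b, c, d, β, γ, δ, rfl, rfl, ?_, ?_, ?_⟩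
  · rw [← h1', redNorm_mk]; ring
  · rw [redNorm_mk] at h2'; linear_combination h2'
  · rw [mk_mul, mk_mul, neg_mk] at h3
    dsimp only at h3
    linear_combination -h3 / 2

lemma sq_cases_of_int {m : ℤ} (hm : m ^ 2 ≤ 4) :
    m = 0 ∨ m = 1 ∨ m = -1 ∨ m = 2 ∨ m = -2 := by
  have h1 : m ≤ 2 := by nlinarith
  have h2 : -2 ≤ m := by nlinarith
  omega

lemma DefData.exists_conj_left (h : DefData σ₀ σ₁ (-1) (-e) e) {O : Subring ℍ[F, -1, -e]}
    (hO : IsOrder F O) (hi : ⟨0, 1, 0, 0⟩ ∈ O) (hj : ⟨0, 0, 1, 0⟩ ∈ O) {I J : ℍ[F, -1, -e]}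
    (hI : I ∈ O) (hJ : J ∈ O) (hp : StdPair e I J) : ∃ g ∈ O, redNorm F g = 1 ∧
      (g * ⟨0, 1, 0, 0⟩ = I * g ∨ g * ⟨0, 1, 0, 0⟩ = -(I * g)) := by
  have he := h.ne_zero
  obtain ⟨b, c, d, β, γ, δ, rfl, rfl, nI, nJ, hIJ⟩ := hp.coords h
  obtain ⟨m, n, hm, hn, hle, h4⟩ := h.norm_one_coords hO hi hI (by linear_combination nI)
  have hm0 : m = 0 := by
    have : (m : F) = 0 := by rw [← hm]; ring
    exact_mod_cast this
  subst hm0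
  have hIi := O.mul_mem hI hi
  rw [mk_mul] at hIi
  rcases sq_cases_of_int (by linarith : n ^ 2 ≤ 4) with rfl | rfl | rfl | rfl | rfl
  · have hb : b = 0 := by simpa using hn
    subst hb
    have nI' : e * (c ^ 2 + d ^ 2) = 1 := by linear_combination nI
    have hJi : (⟨-β, 0, δ, -γ⟩ : ℍ[F, -1, -e]) ∈ O := by
      convert O.mul_mem hJ hi using 1
      rw [mk_mul]; congr 1 <;> ring
    have hjI : (⟨-(e * c), e * d, 0, 0⟩ : ℍ[F, -1, -e]) ∈ O := by
      convert O.mul_mem hj hI using 1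
      rw [mk_mul]; congr 1 <;> ring
    have hkI : (⟨-(e * d), -(e * c), 0, 0⟩ : ℍ[F, -1, -e]) ∈ O := by
      convert O.mul_mem (k_mem hi hj) hI using 1
      rw [mk_mul]; congr 1 <;> ring
    have hjJ : (⟨-γ, δ, 0, -(e⁻¹ * β)⟩ : ℍ[F, -1, -e]) ∈ O := by
      convert h.inv_smul_mem hO (O.mul_mem hj hJ) using 1
      rw [mk_mul]; ext <;> simp <;> field_simp
    have hβ := h.trace_cases hO hJi (by linear_combination nJ)
    have hc := h.trace_cases hO hjI (by linear_combination e * nI')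
    have hd := h.trace_cases hO hkI (by linear_combination e * nI')
    obtain ⟨m, n, hm, hn, hle, -⟩ := h.norm_one_coords hO hi hjJ (by
      field_simp; linear_combination nJ)
    have sq_of : ∀ x : F, (-(e * x) = 0 ∨ (2 * -(e * x)) ^ 2 = 2 * e ∨
        (2 * -(e * x)) ^ 2 = 3 * e) → x = 0 ∨ 2 * e * x ^ 2 = 1 ∨ 4 * e * x ^ 2 = 3 := by
      rintro x (hx | hx | hx)
      · left; simpa [he] using hx
      · right; left; exact mul_left_cancel₀ he (by linear_combination hx / 2)
      · right; right; exact mul_left_cancel₀ he (by linear_combination hx)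
    obtain ⟨hc2, hd2⟩ : 2 * e * c ^ 2 = 1 ∧ 2 * e * d ^ 2 = 1 := by
      rcases sq_of c hc with rfl | hc | hc
      · exfalso
        rcases sq_of d hd with rfl | hd | hd
        · norm_num at nI'
        · exact one_ne_zero (α := F) (by linear_combination hd - 2 * nI')
        · exact one_ne_zero (α := F) (by linear_combination hd - 4 * nI')
      · exact ⟨hc, by linear_combination 2 * nI' - hc⟩
      · exfalso
        rcases sq_of d hd with rfl | hd | hd
        · exact one_ne_zero (α := F) (by linear_combination hc - 4 * nI')
        · exact one_ne_zero (α := F) (by linear_combination 4 * nI' - hc - 2 * hd)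
        · exact two_ne_zero (α := F) (by linear_combination 4 * nI' - hc - hd)
    have hc0 : c ≠ 0 := by rintro rfl; norm_num at hc2
    obtain ⟨s, hs, rfl⟩ : ∃ s : F, (s = 1 ∨ s = -1) ∧ d = s * c := by
      have : d ^ 2 = c ^ 2 := mul_left_cancel₀ (mul_ne_zero two_ne_zero he) (by
        linear_combination hd2 - hc2)
      rcases sq_eq_sq_iff_eq_or_eq_neg.1 this with rfl | rfl
      · exact ⟨1, Or.inl rfl, by ring⟩
      · exact ⟨-1, Or.inr rfl, by ring⟩
    have hs2 : s ^ 2 = 1 := by rcases hs with rfl | rfl <;> ring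
    obtain rfl : δ = -(s * γ) := by
      have : γ + s * δ = 0 := by
        have := mul_left_cancel₀ he (hIJ.trans (mul_zero e).symm |> fun h => by
          linear_combination h : e * (c * γ + s * c * δ) = e * 0)
        exact mul_left_cancel₀ hc0 (by linear_combination this)
      linear_combination s * this - δ * hs2
    have hβ2 : β ^ 2 + 2 * e * γ ^ 2 = e := by linear_combination nJ - e * γ ^ 2 * hs2
    have hγ : γ = -m / 2 := by linear_combination -hm / 2
    have hm1 : (m : F) ^ 2 = 1 := by
      rw [hγ] at hβ2
      rcases hβ with hβ | hβ | hβ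
      · have : (m : F) ^ 2 = 2 := mul_left_cancel₀ he (by linear_combination 2 * hβ2 + 2 * β * hβ)
        have : m ^ 2 = 2 := by exact_mod_cast this
        rcases sq_cases_of_int (by linarith : m ^ 2 ≤ 4) with rfl | rfl | rfl | rfl | rfl <;>
          norm_num at this
      · exact mul_left_cancel₀ he (by linear_combination 2 * hβ2 - hβ / 2)
      · have : 2 * (m : F) ^ 2 = 1 := mul_left_cancel₀ he (by linear_combination 4 * hβ2 - hβ)
        have : 2 * m ^ 2 = 1 := by exact_mod_cast this
        omega
    obtain ⟨r, hr, rfl⟩ : ∃ r : F, (r = 1 ∨ r = -1) ∧ γ = r / 2 :=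
      ⟨-m, by rcases sq_eq_one_iff.1 hm1 with h | h <;> simp [h], hγ⟩
    have hr2 : r ^ 2 = 1 := by rcases hr with rfl | rfl <;> ring
    obtain ⟨q, hq, rfl⟩ : ∃ q : F, (q = 1 ∨ q = -1) ∧ β = q * (e * c) := by
      have : β ^ 2 = (e * c) ^ 2 := by linear_combination hβ2 - e / 2 * hr2 - e / 2 * hc2
      rcases sq_eq_sq_iff_eq_or_eq_neg.1 this with rfl | rfl
      · exact ⟨1, Or.inl rfl, by ring⟩
      · exact ⟨-1, Or.inr rfl, by ring⟩
    have hg : (⟨q / 2, -(s * q) / 2, s * r * c, 0⟩ : ℍ[F, -1, -e]) ∈ O := by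
      convert h.inv_smul_mem hO (O.mul_mem hjI hJi) using 1
      rw [mk_mul]
      ext <;> simp <;> field_simp
      · linear_combination -q * hc2
      · linear_combination s * q * hc2
      · ring
      · right; linear_combination -(e * c * r) * hs2
    refine ⟨_, hg, ?_, ?_⟩
    · rw [redNorm_mk]
      rcases hs with rfl | rfl <;> rcases hr with rfl | rfl <;> rcases hq with rfl | rfl <;>
        linear_combination hc2 / 2
    · rw [mk_mul, mk_mul, neg_mk]
      rcases hs with rfl | rfl <;> rcases hr with rfl | rfl <;> rcases hq with rfl | rfl <;>
      first
      | (left; congr 1 <;> first | ring1 | linear_combination hc2 / 2 | linear_combination -hc2 / 2)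
      | (right; congr 1 <;> first | ring1 | linear_combination hc2 / 2 | linear_combination -hc2 / 2)
  · have hb : b = 1 / 2 := by push_cast at hn; linear_combination hn / 2
    subst hb
    refine ⟨⟨1 / 2, 0, d, -c⟩, ?_, ?_, Or.inr ?_⟩
    · convert O.add_mem O.one_mem hIi using 1
      ext <;> simp; norm_num
    · rw [redNorm_mk]; linear_combination nI
    · rw [mk_mul, mk_mul, neg_mk]
      congr 1 <;> first | ring1 | linear_combination nI | linear_combination -nI
  · have hb : b = -1 / 2 := by push_cast at hn; linear_combination hn / 2
    subst hb
    refine ⟨⟨1 / 2, 0, -d, c⟩, ?_, ?_, Or.inl ?_⟩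
    · convert O.sub_mem O.one_mem hIi using 1
      ext <;> simp; norm_num
    · rw [redNorm_mk]; linear_combination nI
    · rw [mk_mul, mk_mul]
      congr 1 <;> first | ring1 | linear_combination nI | linear_combination -nI
  · obtain ⟨rfl, rfl⟩ := h4 (by norm_num)
    refine ⟨1, O.one_mem, redNorm_one, Or.inl ?_⟩
    rw [one_mul, mul_one]
    congr 1
    push_cast at hn; linear_combination -hn / 2
  · obtain ⟨rfl, rfl⟩ := h4 (by norm_num)
    refine ⟨1, O.one_mem, redNorm_one, Or.inr ?_⟩
    rw [one_mul, mul_one, neg_mk]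
    congr 1
    · ring
    · push_cast at hn; linear_combination hn / 2
    · ring
    · ring

lemma DefData.exists_conj_right (h : DefData σ₀ σ₁ (-1) (-e) e) {O : Subring ℍ[F, -1, -e]}
    (hO : IsOrder F O) (hi : ⟨0, 1, 0, 0⟩ ∈ O) (hj : ⟨0, 0, 1, 0⟩ ∈ O) {I J : ℍ[F, -1, -e]}
    (hJ : J ∈ O) (hp : StdPair e I J) (hI : I = ⟨0, 1, 0, 0⟩ ∨ I = -⟨0, 1, 0, 0⟩) :
    (J = ⟨0, 0, 1, 0⟩ ∨ J = -⟨0, 0, 1, 0⟩) ∨ (J = ⟨0, 0, 0, 1⟩ ∨ J = -⟨0, 0, 0, 1⟩) := by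
  have he := h.ne_zero
  obtain ⟨b, c, d, β, γ, δ, hI', rfl, nI, nJ, hIJ⟩ := hp.coords h
  have hβ : β = 0 := by
    rcases hI with hI | hI <;> rw [hI'] at hI <;> simp at hI <;>
      obtain ⟨rfl, rfl, rfl⟩ := hI <;> first | linear_combination hIJ | linear_combination -hIJ
  subst hβ
  have hn : γ ^ 2 + δ ^ 2 = 1 := mul_left_cancel₀ he (by linear_combination nJ)
  have hg := h.inv_smul_mem hO (O.mul_mem hj hJ)
  rw [mk_mul] at hg
  have hg' : (⟨-γ, δ, 0, 0⟩ : ℍ[F, -1, -e]) ∈ O := by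
    convert hg using 1
    ext <;> simp <;> field_simp
  obtain ⟨m, n, hm, hn', -, -⟩ := h.norm_one_coords hO hi hg' (by linear_combination hn)
  have hmn : m ^ 2 + n ^ 2 = 4 := by
    have : (m : F) ^ 2 + n ^ 2 = 4 := by rw [← hm, ← hn']; linear_combination 4 * hn
    exact_mod_cast this
  have hγ : γ = -m / 2 := by linear_combination -hm / 2
  have hδ : δ = n / 2 := by linear_combination hn' / 2
  subst hγ hδ
  simp only [neg_mk]
  rcases sq_cases_of_int (by nlinarith : m ^ 2 ≤ 4) with rfl | rfl | rfl | rfl | rfl <;>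
  rcases sq_cases_of_int (by nlinarith : n ^ 2 ≤ 4) with rfl | rfl | rfl | rfl | rfl <;>
  first
  | (exfalso; revert hmn; norm_num; done)
  | norm_num

end Normalizer

section Orbits

variable {F}
variable {e : F} {σ₀ σ₁ : F →+* ℝ}

lemma IsOrder.closure_le {O : Subring ℍ[F, -1, -e]} (hO : IsOrder F O)
    (hi : ⟨0, 1, 0, 0⟩ ∈ O) (hj : ⟨0, 0, 1, 0⟩ ∈ O) :
    Subring.closure (scalarSet F ℍ[F, -1, -e] ∪ {⟨0, 1, 0, 0⟩, ⟨0, 0, 1, 0⟩}) ≤ O := by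
  rw [Subring.closure_le]
  rintro x (hx | rfl | rfl)
  exacts [hO.1 hx, hi, hj]

lemma gen_mem : (⟨0, 1, 0, 0⟩ : ℍ[F, -1, -e]) ∈
      Subring.closure (scalarSet F ℍ[F, -1, -e] ∪ {⟨0, 1, 0, 0⟩, ⟨0, 0, 1, 0⟩}) ∧
    (⟨0, 0, 1, 0⟩ : ℍ[F, -1, -e]) ∈
      Subring.closure (scalarSet F ℍ[F, -1, -e] ∪ {⟨0, 1, 0, 0⟩, ⟨0, 0, 1, 0⟩}) :=
  ⟨Subring.subset_closure (by simp), Subring.subset_closure (by simp)⟩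

lemma conj_mem_closure {x : ℍ[F, -1, -e]ˣ} {S : Subring ℍ[F, -1, -e]} {s : Set ℍ[F, -1, -e]}
    (hS : scalarSet F ℍ[F, -1, -e] ⊆ S)
    (hs : ∀ y ∈ s, (x : ℍ[F, -1, -e]) * y * ((x⁻¹ : ℍ[F, -1, -e]ˣ) : ℍ[F, -1, -e]) ∈ S)
    {y : ℍ[F, -1, -e]} (hy : y ∈ Subring.closure (scalarSet F ℍ[F, -1, -e] ∪ s)) :
    (x : ℍ[F, -1, -e]) * y * ((x⁻¹ : ℍ[F, -1, -e]ˣ) : ℍ[F, -1, -e]) ∈ S := by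
  have : Subring.closure (scalarSet F ℍ[F, -1, -e] ∪ s) ≤
      S.comap ((conjEquiv (F := F) x : ℍ[F, -1, -e] ≃ₐ[F] ℍ[F, -1, -e]) :
        ℍ[F, -1, -e] →+* ℍ[F, -1, -e]) := by
    rw [Subring.closure_le]
    rintro z (⟨r, rfl⟩ | hz)
    · change (conjEquiv (F := F) x) _ ∈ S
      rw [AlgEquiv.commutes]
      exact hS ⟨r, rfl⟩
    · exact hs z hz
  exact this hy

/-- A unit that maps `i` to `±i` and one of `j`, `k` to `±j` normalizes the subring generated by
`i` and `j`. -/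
lemma isConjugate_closure {y : ℍ[F, -1, -e]ˣ}
    (h1 : (y : ℍ[F, -1, -e]) * ⟨0, 1, 0, 0⟩ = ⟨0, 1, 0, 0⟩ * y ∨
      (y : ℍ[F, -1, -e]) * ⟨0, 1, 0, 0⟩ = -(⟨0, 1, 0, 0⟩ * y))
    (h2 : ((y : ℍ[F, -1, -e]) * ⟨0, 0, 1, 0⟩ = ⟨0, 0, 1, 0⟩ * y ∨
      (y : ℍ[F, -1, -e]) * ⟨0, 0, 1, 0⟩ = -(⟨0, 0, 1, 0⟩ * y)) ∨
      ((y : ℍ[F, -1, -e]) * ⟨0, 0, 0, 1⟩ = ⟨0, 0, 1, 0⟩ * y ∨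
      (y : ℍ[F, -1, -e]) * ⟨0, 0, 0, 1⟩ = -(⟨0, 0, 1, 0⟩ * y))) :
    IsConjugate y
      (Subring.closure (scalarSet F ℍ[F, -1, -e] ∪ {⟨0, 1, 0, 0⟩, ⟨0, 0, 1, 0⟩}))
      (Subring.closure (scalarSet F ℍ[F, -1, -e] ∪ {⟨0, 1, 0, 0⟩, ⟨0, 0, 1, 0⟩})) := by
  obtain ⟨mi, mj⟩ := gen_mem (F := F) (e := e)
  have hS : scalarSet F ℍ[F, -1, -e] ⊆
      Subring.closure (scalarSet F ℍ[F, -1, -e] ∪ {⟨0, 1, 0, 0⟩, ⟨0, 0, 1, 0⟩}) :=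
    Set.subset_union_left.trans Subring.subset_closure
  have mk := k_mem mi mj
  generalize hS₀ : Subring.closure (scalarSet F ℍ[F, -1, -e] ∪ {⟨0, 1, 0, 0⟩, ⟨0, 0, 1, 0⟩}) = S
    at *
  have hk : (⟨0, 0, 0, 1⟩ : ℍ[F, -1, -e]) = ⟨0, 1, 0, 0⟩ * ⟨0, 0, 1, 0⟩ := by
    rw [mk_mul]; congr 1 <;> ring
  have hik : (⟨0, 1, 0, 0⟩ : ℍ[F, -1, -e]) * ⟨0, 0, 0, 1⟩ = -⟨0, 0, 1, 0⟩ := by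
    rw [mk_mul, neg_mk]; congr 1 <;> ring
  generalize (⟨0, 1, 0, 0⟩ : ℍ[F, -1, -e]) = i at *
  generalize (⟨0, 0, 1, 0⟩ : ℍ[F, -1, -e]) = j at *
  generalize (⟨0, 0, 0, 1⟩ : ℍ[F, -1, -e]) = k at *
  have fwd : ∀ {z w : ℍ[F, -1, -e]}, (y : ℍ[F, -1, -e]) * z = w * y → w ∈ S →
      (y : ℍ[F, -1, -e]) * z * ((y⁻¹ : ℍ[F, -1, -e]ˣ) : ℍ[F, -1, -e]) ∈ S := by
    intro z w hzw hw
    rwa [hzw, mul_assoc, Units.mul_inv, mul_one]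
  have bwd : ∀ {z w : ℍ[F, -1, -e]}, (y : ℍ[F, -1, -e]) * z = w * y → z ∈ S →
      ((y⁻¹ : ℍ[F, -1, -e]ˣ) : ℍ[F, -1, -e]) * w * (y⁻¹⁻¹ : ℍ[F, -1, -e]ˣ) ∈ S := by
    intro z w hzw hw
    rwa [inv_inv, mul_assoc, ← hzw, ← mul_assoc, Units.inv_mul, one_mul]
  obtain ⟨I, hI, hyI⟩ : ∃ I, (I = i ∨ I = -i) ∧ (y : ℍ[F, -1, -e]) * i = I * y := by
    rcases h1 with h1 | h1
    · exact ⟨i, Or.inl rfl, h1⟩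
    · exact ⟨-i, Or.inr rfl, by rw [h1, neg_mul]⟩
  have memI : I ∈ S := by rcases hI with rfl | rfl; exacts [mi, S.neg_mem mi]
  have bwd_i : ((y⁻¹ : ℍ[F, -1, -e]ˣ) : ℍ[F, -1, -e]) * i * (y⁻¹⁻¹ : ℍ[F, -1, -e]ˣ) ∈ S := by
    rcases hI with rfl | rfl
    · exact bwd hyI mi
    · exact bwd (z := -i) (by rw [mul_neg, hyI, neg_mul, neg_neg]) (S.neg_mem mi)
  have hyj : (y : ℍ[F, -1, -e]) * j = -(I * (y * k)) := by
    rw [← mul_assoc, ← hyI, mul_assoc, hik, mul_neg, neg_neg]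
  have fwd_j : (y : ℍ[F, -1, -e]) * j * ((y⁻¹ : ℍ[F, -1, -e]ˣ) : ℍ[F, -1, -e]) ∈ S := by
    rcases h2 with (h2 | h2) | h2 | h2
    · exact fwd h2 mj
    · exact fwd (w := -j) (by rw [h2, neg_mul]) (S.neg_mem mj)
    · refine fwd (w := -(I * j)) ?_ (S.neg_mem (S.mul_mem memI mj))
      rw [hyj, h2, neg_mul, mul_assoc]
    · refine fwd (w := I * j) ?_ (S.mul_mem memI mj)
      rw [hyj, h2, mul_neg, neg_neg, mul_assoc]
  have bwd_j : ((y⁻¹ : ℍ[F, -1, -e]ˣ) : ℍ[F, -1, -e]) * j * (y⁻¹⁻¹ : ℍ[F, -1, -e]ˣ) ∈ S := by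
    rcases h2 with (h2 | h2) | h2 | h2
    · exact bwd h2 mj
    · exact bwd (z := -j) (by rw [mul_neg, h2, neg_neg]) (S.neg_mem mj)
    · exact bwd h2 mk
    · exact bwd (z := -k) (by rw [mul_neg, h2, neg_neg]) (S.neg_mem mk)
  intro z
  constructor
  · intro hz
    rw [← hS₀] at hz
    refine conj_mem_closure hS ?_ hz
    rintro w (rfl | rfl)
    exacts [fwd hyI memI, fwd_j]
  · intro hz
    nth_rw 1 [← hS₀] at hz
    have := conj_mem_closure (x := y⁻¹) hS (by
      rintro w (rfl | rfl)
      exacts [bwd_i, bwd_j]) hz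
    simpa [mul_assoc] using this

lemma DefData.exists_conj (h : DefData σ₀ σ₁ (-1) (-e) e) {O : Subring ℍ[F, -1, -e]}
    (hO : IsOrder F O) (hi : ⟨0, 1, 0, 0⟩ ∈ O) (hj : ⟨0, 0, 1, 0⟩ ∈ O) {I J : ℍ[F, -1, -e]}
    (hI : I ∈ O) (hJ : J ∈ O) (hp : StdPair e I J) :
    ∃ g : ℍ[F, -1, -e]ˣ, IsConjugate g O O ∧
      ((g : ℍ[F, -1, -e]) * ⟨0, 1, 0, 0⟩ = I * g ∨
        (g : ℍ[F, -1, -e]) * ⟨0, 1, 0, 0⟩ = -(I * g)) ∧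
      (((g : ℍ[F, -1, -e]) * ⟨0, 0, 1, 0⟩ = J * g ∨
        (g : ℍ[F, -1, -e]) * ⟨0, 0, 1, 0⟩ = -(J * g)) ∨
      ((g : ℍ[F, -1, -e]) * ⟨0, 0, 0, 1⟩ = J * g ∨
        (g : ℍ[F, -1, -e]) * ⟨0, 0, 0, 1⟩ = -(J * g))) := by
  obtain ⟨x, hx, hn, hxI⟩ := h.exists_conj_left hO hi hj hI hJ hp
  have hxs : x * star x = 1 := by rw [mul_star_eq, hn]; rfl
  have hsx : star x * x = 1 := by rw [star_mul_eq, hn]; rfl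
  have hsm := hO.star_mem hx
  have key : ∀ {z w}, star x * w * x = z → x * z = w * x := by
    rintro z w rfl
    rw [mul_assoc, ← mul_assoc, hxs, one_mul]
  have hI' : star x * I * x = ⟨0, 1, 0, 0⟩ ∨ star x * I * x = -⟨0, 1, 0, 0⟩ := by
    rcases hxI with hxI | hxI
    · left; rw [mul_assoc, ← hxI, ← mul_assoc, hsx, one_mul]
    · right; rw [mul_assoc, ← neg_eq_iff_eq_neg.2 hxI, mul_neg, ← mul_assoc, hsx, one_mul]
  have hp' : StdPair e (star x * I * x) (star x * J * x) := by
    have mm : ∀ z w, star x * z * x * (star x * w * x) = star x * (z * w) * x := by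
      intro z w
      rw [mul_assoc, mul_assoc (star x) w, ← mul_assoc x, hxs, one_mul]
      simp only [mul_assoc]
    refine ⟨?_, ?_, ?_⟩
    · rw [mm, hp.sq_left, mul_neg, mul_one, neg_mul, hsx]
    · have : (e : ℍ[F, -1, -e]) * x = x * e := Algebra.commutes e x
      rw [mm, hp.sq_right, mul_neg, neg_mul, mul_assoc, this, ← mul_assoc, hsx, one_mul]
    · rw [mm, mm, hp.anti, mul_neg, neg_mul]
  refine ⟨⟨x, star x, hxs, hsx⟩, ?_, hxI, ?_⟩
  · intro y
    change y ∈ O ↔ x * y * star x ∈ O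
    refine ⟨fun hy => O.mul_mem (O.mul_mem hx hy) hsm, fun hy => ?_⟩
    have := O.mul_mem (O.mul_mem hsm hy) hx
    rwa [show star x * (x * y * star x) * x = star x * x * y * (star x * x) by
      simp only [mul_assoc], hsx, one_mul, mul_one] at this
  · have := h.exists_conj_right hO hi hj (O.mul_mem (O.mul_mem hsm hJ) hx) hp' hI'
    refine this.imp (Or.imp key fun h => ?_) (Or.imp key fun h => ?_) <;>
    · have := key h
      rwa [mul_neg, neg_eq_iff_eq_neg] at this

/-- Conjugate orders containing `i` and `j` are conjugate under the normalizer of the subring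
generated by `i` and `j`. -/
lemma DefData.exists_normalizer (h : DefData σ₀ σ₁ (-1) (-e) e) {O O' : Subring ℍ[F, -1, -e]}
    (hO : IsOrder F O) (hi : ⟨0, 1, 0, 0⟩ ∈ O) (hj : ⟨0, 0, 1, 0⟩ ∈ O)
    (hi' : ⟨0, 1, 0, 0⟩ ∈ O') (hj' : ⟨0, 0, 1, 0⟩ ∈ O') (hc : ConjRel O O') :
    ∃ y : ℍ[F, -1, -e]ˣ, IsConjugate y
      (Subring.closure (scalarSet F ℍ[F, -1, -e] ∪ {⟨0, 1, 0, 0⟩, ⟨0, 0, 1, 0⟩}))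
      (Subring.closure (scalarSet F ℍ[F, -1, -e] ∪ {⟨0, 1, 0, 0⟩, ⟨0, 0, 1, 0⟩})) ∧
      IsConjugate y O O' := by
  obtain ⟨x, hx⟩ := hc
  have mem : ∀ z ∈ O', ((x⁻¹ : ℍ[F, -1, -e]ˣ) : ℍ[F, -1, -e]) * z * x ∈ O := fun z hz => by
    rw [hx]; simpa [mul_assoc] using hz
  have hs := stdPair_std (e := e)
  have hp : StdPair e (((x⁻¹ : ℍ[F, -1, -e]ˣ) : ℍ[F, -1, -e]) *
      (⟨0, 1, 0, 0⟩ : ℍ[F, -1, -e]) * (x : ℍ[F, -1, -e]))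
      (((x⁻¹ : ℍ[F, -1, -e]ˣ) : ℍ[F, -1, -e]) *
        (⟨0, 0, 1, 0⟩ : ℍ[F, -1, -e]) * (x : ℍ[F, -1, -e])) := by
    have mm : ∀ z w, ((x⁻¹ : ℍ[F, -1, -e]ˣ) : ℍ[F, -1, -e]) * z * x *
        (((x⁻¹ : ℍ[F, -1, -e]ˣ) : ℍ[F, -1, -e]) * w * x) =
        ((x⁻¹ : ℍ[F, -1, -e]ˣ) : ℍ[F, -1, -e]) * (z * w) * x := by
      intro z w; simp [mul_assoc]
    refine ⟨?_, ?_, ?_⟩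
    · rw [mm, hs.sq_left]; simp
    · have : (e : ℍ[F, -1, -e]) * x = x * e := Algebra.commutes e _
      rw [mm, hs.sq_right, mul_neg, neg_mul, mul_assoc, this]; simp
    · rw [mm, mm, hs.anti, mul_neg, neg_mul]
  obtain ⟨g, hg, h1, h2⟩ := h.exists_conj hO hi hj (mem _ hi') (mem _ hj') hp
  refine ⟨x * g, isConjugate_closure ?_ ?_, hg.trans hx⟩
  · refine h1.imp (fun h => ?_) (fun h => ?_) <;>
    · rw [Units.val_mul, mul_assoc, h]; simp [mul_assoc]
  · refine h2.imp (Or.imp (fun h => ?_) (fun h => ?_)) (Or.imp (fun h => ?_) (fun h => ?_)) <;>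
    · rw [Units.val_mul, mul_assoc, h]; simp [mul_assoc]

/-- A maximal order containing a standard pair is conjugate to one containing `i` and `j`. -/
lemma DefData.exists_conjRel (h : DefData σ₀ σ₁ (-1) (-e) e) {O : Subring ℍ[F, -1, -e]}
    (hp : ∃ I ∈ O, ∃ J ∈ O, StdPair e I J) : ∃ x : ℍ[F, -1, -e]ˣ,
      ⟨0, 1, 0, 0⟩ ∈ O.map ((conjEquiv (F := F) x : ℍ[F, -1, -e] →+* ℍ[F, -1, -e])) ∧
      ⟨0, 0, 1, 0⟩ ∈ O.map ((conjEquiv (F := F) x : ℍ[F, -1, -e] →+* ℍ[F, -1, -e])) := by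
  obtain ⟨I, hI, J, hJ, hp⟩ := hp
  obtain ⟨x, h1, h2⟩ := h.exists_conj_pair hp
  refine ⟨x⁻¹, ⟨I, hI, ?_⟩, ⟨J, hJ, ?_⟩⟩
  · change ((x⁻¹ : ℍ[F, -1, -e]ˣ) : ℍ[F, -1, -e]) * I * (x⁻¹⁻¹ : ℍ[F, -1, -e]ˣ) = _
    rw [inv_inv, mul_assoc, ← h1]; simp
  · change ((x⁻¹ : ℍ[F, -1, -e]ˣ) : ℍ[F, -1, -e]) * J * (x⁻¹⁻¹ : ℍ[F, -1, -e]ˣ) = _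
    rw [inv_inv, mul_assoc, ← h2]; simp

end Orbits

section Counting

variable {F}
variable {e : F} {σ₀ σ₁ : F →+* ℝ}

/-- The residues modulo `2` of the scaled coordinates of the elements of `O`. -/
def residues (e : F) (O : Subring ℍ[F, -1, -e]) :
    Set (Fin 4 → 𝓞 F ⧸ Ideal.span {(2 : 𝓞 F)}) :=
  {t | ∃ v : Fin 4 → 𝓞 F, (⟨v 0 / 2, v 1 / 2, v 2 / (2 * e), v 3 / (2 * e)⟩ : ℍ[F, -1, -e]) ∈ O ∧
    ∀ l, t l = Ideal.Quotient.mk _ (v l)}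

lemma DefData.exists_coords (h : DefData σ₀ σ₁ (-1) (-e) e) {O : Subring ℍ[F, -1, -e]}
    (hO : IsOrder F O) (hi : ⟨0, 1, 0, 0⟩ ∈ O) (hj : ⟨0, 0, 1, 0⟩ ∈ O) {x : ℍ[F, -1, -e]}
    (hx : x ∈ O) : ∃ v : Fin 4 → 𝓞 F, x = ⟨v 0 / 2, v 1 / 2, v 2 / (2 * e), v 3 / (2 * e)⟩ := by
  have he := h.ne_zero
  have key : ∀ y ∈ O, ∃ a : 𝓞 F, (a : F) = 2 * y.re := fun y hy =>
    ⟨⟨2 * y.re, (isIntegral_trace_norm (hO.isIntegral hy)).1⟩, rfl⟩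
  obtain ⟨x0, x1, x2, x3⟩ := x
  obtain ⟨a, ha⟩ := key _ hx
  obtain ⟨b, hb⟩ := key _ (O.neg_mem (O.mul_mem hx hi))
  obtain ⟨c, hc⟩ := key _ (O.neg_mem (O.mul_mem hx hj))
  obtain ⟨d, hd⟩ := key _ (O.neg_mem (O.mul_mem hx (k_mem hi hj)))
  rw [mk_mul, neg_mk] at hb hc hd
  dsimp only at ha hb hc hd
  refine ⟨![a, b, c, d], ?_⟩
  simp only [Matrix.cons_val, ha, hb, hc, hd]
  congr 1 <;> field_simp <;> ring

lemma DefData.le_of_residues_le (h : DefData σ₀ σ₁ (-1) (-e) e) {O O' : Subring ℍ[F, -1, -e]}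
    (hO : IsOrder F O) (hi : ⟨0, 1, 0, 0⟩ ∈ O) (hj : ⟨0, 0, 1, 0⟩ ∈ O) (hO' : IsOrder F O')
    (hi' : ⟨0, 1, 0, 0⟩ ∈ O') (hj' : ⟨0, 0, 1, 0⟩ ∈ O') (hle : residues e O ⊆ residues e O') :
    O ≤ O' := by
  have he := h.ne_zero
  intro x hx
  obtain ⟨v, rfl⟩ := h.exists_coords hO hi hj hx
  obtain ⟨w, hw, hvw⟩ := hle ⟨v, hx, fun l => rfl⟩
  have : ∀ l, ∃ u : 𝓞 F, (v l : F) = w l + 2 * u := by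
    intro l
    have := Ideal.Quotient.eq.1 (hvw l)
    rw [Ideal.mem_span_singleton] at this
    obtain ⟨u, hu⟩ := this
    refine ⟨u, ?_⟩
    have := congrArg (algebraMap (𝓞 F) F) hu
    rw [map_sub, map_mul, map_ofNat] at this
    linear_combination this
  choose u hu using this
  have m0 : (⟨u 0, 0, 0, 0⟩ : ℍ[F, -1, -e]) ∈ O' := hO'.1 ⟨u 0, rfl⟩
  have m1 := hO'.smul_mem (u 1) hi'
  have m2 := h.inv_smul_mem hO' (hO'.smul_mem (u 2) hj')
  have m3 := h.inv_smul_mem hO' (hO'.smul_mem (u 3) (k_mem hi' hj'))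
  convert O'.add_mem hw (O'.add_mem (O'.add_mem m0 m1) (O'.add_mem m2 m3)) using 1
  ext <;> simp [hu, -algebraMap_smul] <;> field_simp

lemma DefData.finite_orders (h : DefData σ₀ σ₁ (-1) (-e) e) :
    {O : Subring ℍ[F, -1, -e] | IsOrder F O ∧ ⟨0, 1, 0, 0⟩ ∈ O ∧ ⟨0, 0, 1, 0⟩ ∈ O}.Finite := by
  have : Finite (𝓞 F ⧸ Ideal.span {(2 : 𝓞 F)}) :=
    Ideal.finiteQuotientOfFreeOfNeBot _ (by simp)
  refine Set.Finite.of_injOn (f := residues e) (t := Set.univ) (fun _ _ => Set.mem_univ _) ?_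
    Set.finite_univ
  rintro O ⟨hO, hi, hj⟩ O' ⟨hO', hi', hj'⟩ heq
  exact le_antisymm (h.le_of_residues_le hO hi hj hO' hi' hj' heq.le)
    (h.le_of_residues_le hO' hi' hj' hO hi hj heq.ge)

lemma card_quot_eq_ncard {α : Type*} (s : Setoid α) (P : α → Prop)
    (r : {a // P a} → {a // P a} → Prop) (hr : ∀ a b, r a b ↔ s a.1 b.1) :
    Nat.card (Quot r) = (Quotient.mk s '' {a | P a}).ncard := by
  let f : Quot r → Quotient s := Quot.lift (fun a => Quotient.mk s a.1) fun a b hab =>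
    Quotient.sound ((hr a b).1 hab)
  have hf : Function.Injective f := by
    rintro ⟨a⟩ ⟨b⟩ hab
    exact Quot.sound ((hr a b).2 (Quotient.exact hab))
  have hrange : Set.range f = Quotient.mk s '' {a | P a} := by
    ext q
    constructor
    · rintro ⟨⟨a⟩, rfl⟩
      exact ⟨a.1, a.2, rfl⟩
    · rintro ⟨a, ha, rfl⟩
      exact ⟨Quot.mk _ ⟨a, ha⟩, rfl⟩
  rw [← hrange, ← Nat.card_coe_set_eq, Nat.card_range_of_injective hf]

/-- The setoid of conjugacy of subrings. -/
def conjSetoid (H : Type) [Ring H] : Setoid (Subring H) := ⟨ConjRel, conjRel_equivalence⟩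

lemma disjoint_image_of_card_ne {H : Type} [Ring H] [Algebra F H] {G G' : Type*} [Group G]
    [Group G'] {P P' : Subring H → Prop} (hP : ∀ O, P O → RedUnitIso F O G)
    (hP' : ∀ O, P' O → RedUnitIso F O G') (hne : Nat.card G ≠ Nat.card G') :
    Disjoint (Quotient.mk (conjSetoid H) '' {O | P O})
      (Quotient.mk (conjSetoid H) '' {O | P' O}) := by
  rw [Set.disjoint_left]
  rintro _ ⟨O, hO, rfl⟩ ⟨O', hO', heq⟩
  obtain ⟨x, hx⟩ := (Quotient.exact heq : ConjRel O' O)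
  rw [isConjugate_iff (F := F)] at hx
  subst hx
  exact hne ((hP _ hO).card_eq ((hP' _ hO').map (conjEquiv x)))

lemma RedUnitDihedralSecondKind.redUnitIso {A B : F} {n : ℕ} {O : Subring ℍ[F, A, B]}
    (h : RedUnitDihedralSecondKind F n O) : RedUnitIso F O (DihedralGroup n) := by
  obtain ⟨φ, hs, hk, -⟩ := h
  exact ⟨φ, hs, hk⟩

lemma DefData.typeNum_add (h : DefData σ₀ σ₁ (-1) (-e) e) :
    typeNumDnSecondKind F (-1) (-e) 2 + typeNum F ℍ[F, -1, -e] (DihedralGroup 4)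
        + typeNum F ℍ[F, -1, -e] (Equiv.Perm (Fin 4)) + typeNum F ℍ[F, -1, -e] (DihedralGroup 6)
      = bethNum F (Subring.closure
          (scalarSet F ℍ[F, -1, -e] ∪ {⟨0, 1, 0, 0⟩, ⟨0, 0, 1, 0⟩})) := by
  have hle : ∀ O : Subring ℍ[F, -1, -e], IsMaximalOrder F O ∧ Subring.closure
      (scalarSet F ℍ[F, -1, -e] ∪ {⟨0, 1, 0, 0⟩, ⟨0, 0, 1, 0⟩}) ≤ O ↔
      IsMaximalOrder F O ∧ ⟨0, 1, 0, 0⟩ ∈ O ∧ ⟨0, 0, 1, 0⟩ ∈ O := fun O =>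
    and_congr_right fun hO => ⟨fun hle => ⟨hle gen_mem.1, hle gen_mem.2⟩,
      fun hm => hO.1.closure_le hm.1 hm.2⟩
  have hbeth : bethNum F (Subring.closure
      (scalarSet F ℍ[F, -1, -e] ∪ {⟨0, 1, 0, 0⟩, ⟨0, 0, 1, 0⟩})) =
      (Quotient.mk (conjSetoid ℍ[F, -1, -e]) '' {O | IsMaximalOrder F O ∧ Subring.closure
        (scalarSet F ℍ[F, -1, -e] ∪ {⟨0, 1, 0, 0⟩, ⟨0, 0, 1, 0⟩}) ≤ O}).ncard := by
    refine card_quot_eq_ncard (conjSetoid _) _ _ fun O O' => ?_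
    obtain ⟨hO, hi, hj⟩ := (hle _).1 O.2
    obtain ⟨-, hi', hj'⟩ := (hle _).1 O'.2
    exact ⟨fun ⟨x, _, hx⟩ => ⟨x, hx⟩, h.exists_normalizer hO.1 hi hj hi' hj'⟩
  have ht : ∀ P : Subring ℍ[F, -1, -e] → Prop, Nat.card (Quot fun O O' :
      {O : Subring ℍ[F, -1, -e] // IsMaximalOrder F O ∧ P O} => ConjRel O.1 O'.1) =
      (Quotient.mk (conjSetoid ℍ[F, -1, -e]) '' {O | IsMaximalOrder F O ∧ P O}).ncard := fun P =>
    card_quot_eq_ncard (conjSetoid _) _ _ fun O O' => Iff.rfl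
  have hunion : Quotient.mk (conjSetoid ℍ[F, -1, -e]) '' {O | IsMaximalOrder F O ∧
        Subring.closure (scalarSet F ℍ[F, -1, -e] ∪ {⟨0, 1, 0, 0⟩, ⟨0, 0, 1, 0⟩}) ≤ O} =
      Quotient.mk (conjSetoid ℍ[F, -1, -e]) ''
          {O | IsMaximalOrder F O ∧ RedUnitDihedralSecondKind F 2 O} ∪
        Quotient.mk (conjSetoid ℍ[F, -1, -e]) ''
          {O | IsMaximalOrder F O ∧ RedUnitIso F O (DihedralGroup 4)} ∪
        Quotient.mk (conjSetoid ℍ[F, -1, -e]) ''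
          {O | IsMaximalOrder F O ∧ RedUnitIso F O (Equiv.Perm (Fin 4))} ∪
        Quotient.mk (conjSetoid ℍ[F, -1, -e]) ''
          {O | IsMaximalOrder F O ∧ RedUnitIso F O (DihedralGroup 6)} := by
    simp only [hle]
    rw [← Set.image_union, ← Set.image_union, ← Set.image_union]
    apply subset_antisymm
    · apply Set.image_mono
      rintro O ⟨hO, hi, hj⟩
      rcases h.redUnitIso_cases hO.1 hi hj with hc | hc | hc | hc
      exacts [Or.inl (Or.inl (Or.inl ⟨hO, hc⟩)), Or.inl (Or.inl (Or.inr ⟨hO, hc⟩)),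
        Or.inl (Or.inr ⟨hO, hc⟩), Or.inr ⟨hO, hc⟩]
    · rintro _ ⟨O, hO, rfl⟩
      obtain ⟨hmax, hp⟩ : IsMaximalOrder F O ∧ ∃ I ∈ O, ∃ J ∈ O, StdPair e I J := by
        rcases hO with ((⟨hO, hG⟩ | ⟨hO, hG⟩) | ⟨hO, hG⟩) | ⟨hO, hG⟩
        exacts [⟨hO, h.exists_stdPair_of_second_kind hO.1 hG⟩,
          ⟨hO, h.exists_stdPair_of_dihedral_four hO.1 hG⟩,
          ⟨hO, h.exists_stdPair_of_perm hO.1 hG⟩,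
          ⟨hO, h.exists_stdPair_of_dihedral_six hO.1 hG⟩]
      obtain ⟨x, hi, hj⟩ := h.exists_conjRel hp
      refine ⟨_, ⟨hmax.map (conjEquiv (F := F) x), hi, hj⟩, Quotient.sound ?_⟩
      exact conjRel_equivalence.symm ⟨x, (isConjugate_iff (F := F) x _ _).2 rfl⟩
  have hfin : (Quotient.mk (conjSetoid ℍ[F, -1, -e]) '' {O | IsMaximalOrder F O ∧
      Subring.closure (scalarSet F ℍ[F, -1, -e] ∪ {⟨0, 1, 0, 0⟩, ⟨0, 0, 1, 0⟩}) ≤ O}).Finite := by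
    refine (h.finite_orders.subset ?_).image _
    simp only [hle]
    exact fun O hO => ⟨hO.1.1, hO.2⟩
  have c2 : Nat.card (DihedralGroup 2) = 4 := DihedralGroup.nat_card
  have c4 : Nat.card (DihedralGroup 4) = 8 := DihedralGroup.nat_card
  have c6 : Nat.card (DihedralGroup 6) = 12 := DihedralGroup.nat_card
  have cS : Nat.card (Equiv.Perm (Fin 4)) = 24 := by
    rw [Nat.card_perm, Nat.card_eq_fintype_card, Fintype.card_fin]; rfl
  rw [hunion] at hfin hbeth
  obtain ⟨⟨⟨f2, f4⟩, fS⟩, f6⟩ := by simpa only [Set.finite_union] using hfin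
  rw [hbeth, Set.ncard_union_eq _ ((f2.union f4).union fS) f6,
    Set.ncard_union_eq _ (f2.union f4) fS, Set.ncard_union_eq _ f2 f4]
  · simp only [typeNumDnSecondKind, typeNum, ht]
  · exact disjoint_image_of_card_ne (fun O hO => hO.2.redUnitIso) (fun O hO => hO.2) (by
      rw [c2, c4]; norm_num)
  · exact Set.disjoint_union_left.2 ⟨disjoint_image_of_card_ne (fun O hO => hO.2.redUnitIso)
      (fun O hO => hO.2) (by rw [c2, cS]; norm_num), disjoint_image_of_card_ne
      (fun O hO => hO.2) (fun O hO => hO.2) (by rw [c4, cS]; norm_num)⟩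
  · exact Set.disjoint_union_left.2 ⟨Set.disjoint_union_left.2
      ⟨disjoint_image_of_card_ne (fun O hO => hO.2.redUnitIso)
      (fun O hO => hO.2) (by rw [c2, c6]; norm_num), disjoint_image_of_card_ne
      (fun O hO => hO.2) (fun O hO => hO.2) (by rw [c4, c6]; norm_num)⟩, disjoint_image_of_card_ne
      (fun O hO => hO.2) (fun O hO => hO.2) (by rw [cS, c6]; norm_num)⟩

end Counting

/-- **Type numbers for `D₂‡` via the minimal order `𝒪₂‡ = O_F[i,j] ⊂ (−1,−ε / F)`** -/
theorem typeNum_D2_second_kind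
    (d : ℕ) (hd6 : 6 ≤ d) (hdsf : Squarefree d)
    (sqrtd : F) (hsqrtd : sqrtd ^ 2 = (d : F))
    (hgen : Algebra.adjoin ℚ {sqrtd} = ⊤)
    (σ₀ : F →+* ℝ) (hσ₀ : 0 < σ₀ sqrtd)
    -- `ε` is the fundamental unit of `F`: the smallest unit greater than `1`
    (ε : (𝓞 F)ˣ) (hε : 1 < σ₀ (algebraMap (𝓞 F) F ↑ε))
    (hεfund : ∀ u : (𝓞 F)ˣ, 1 < σ₀ (algebraMap (𝓞 F) F ↑u) →
      σ₀ (algebraMap (𝓞 F) F ↑ε) ≤ σ₀ (algebraMap (𝓞 F) F ↑u)) :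
    -- If `Nm(ε) = 1` and `H = (−1, −ε / F)`, then
    -- `t(D₂‡) + t(D₄) + t(S₄) + t(D₆) = ℶ(𝒪₂‡)`, where `𝒪₂‡ = O_F[i, j]`.
    (Algebra.norm ℚ (algebraMap (𝓞 F) F ↑ε) = 1 →
      typeNumDnSecondKind F (-1) (-(algebraMap (𝓞 F) F ↑ε)) 2
        + typeNum F ℍ[F, -1, -(algebraMap (𝓞 F) F ↑ε)] (DihedralGroup 4)
        + typeNum F ℍ[F, -1, -(algebraMap (𝓞 F) F ↑ε)] (Equiv.Perm (Fin 4))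
        + typeNum F ℍ[F, -1, -(algebraMap (𝓞 F) F ↑ε)] (DihedralGroup 6)
        = bethNum F (Subring.closure
            (scalarSet F ℍ[F, -1, -(algebraMap (𝓞 F) F ↑ε)] ∪
              {⟨0, 1, 0, 0⟩, ⟨0, 0, 1, 0⟩}))) ∧
    -- In all the remaining cases `t(H, D₂‡) = 0` for every totally definite
    -- quaternion `F`-algebra `H = ℍ[F, A, B]`.
    (∀ A B : F, (∀ σ : F →+* ℝ, σ A < 0 ∧ σ B < 0) →
      (Algebra.norm ℚ (algebraMap (𝓞 F) F ↑ε) = -1 ∨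
        ¬Nonempty (ℍ[F, A, B] ≃ₐ[F] ℍ[F, -1, -(algebraMap (𝓞 F) F ↑ε)])) →
      typeNumDnSecondKind F A B 2 = 0) := by
  obtain ⟨σ₁, hU, hV⟩ := exists_unitData hd6 hdsf hsqrtd hgen σ₀ hσ₀ ε hε hεfund
  refine ⟨fun hN => ?_, fun A B hdef hcase => ?_⟩
  · have h := hU hN
    exact DefData.typeNum_add (σ₀ := σ₀) (σ₁ := σ₁)
      ⟨h, by simp, by simp, by simpa using h.pos₀, by simpa using h.pos₁⟩
  · have hempty : ∀ O : Subring ℍ[F, A, B], IsOrder F O → ¬ RedUnitDihedralSecondKind F 2 O := by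
      intro O hO hD
      rcases norm_unit ε with hN | hN
      · have h : DefData σ₀ σ₁ A B (algebraMap (𝓞 F) F ↑ε) :=
          ⟨hU hN, (hdef σ₀).1, (hdef σ₁).1, (hdef σ₀).2, (hdef σ₁).2⟩
        have h' : DefData σ₀ σ₁ (-1) (-(algebraMap (𝓞 F) F ↑ε)) (algebraMap (𝓞 F) F ↑ε) :=
          ⟨hU hN, by simp, by simp, by simpa using h.pos₀, by simpa using h.pos₁⟩
        obtain ⟨I, -, J, -, hp⟩ := h.exists_stdPair_of_second_kind hO hD
        rcases hcase with hN' | hH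
        · rw [hN] at hN'
          norm_num at hN'
        · exact hH (hp.algEquiv h')
      · exact not_second_kind_of_units hO (hdef σ₀).1 (hdef σ₀).2 (hdef σ₁).1 (hdef σ₁).2
          (hV hN) 2 hD
    have : IsEmpty {O : Subring ℍ[F, A, B] //
        IsMaximalOrder F O ∧ RedUnitDihedralSecondKind F 2 O} :=
      ⟨fun O => hempty O.1 O.2.1.1 O.2.2⟩
    rw [typeNumDnSecondKind]
    exact Nat.card_of_isEmpty

end QuatPaper
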